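/- arXiv:2202.12539 — 3 statements merged into one kernel-verified Lean document; each statement's English description precedes it below -/
import Mathlib

section
/- Let p be a classical stationary solution of the voltage–conductance equation which is strictly positive on Ω, and assume moreover that ∫_Ω e^{g²/(8a)}·|∂_g p(v,g)| dv dg < ∞ and ∫_Ω (g + g_L)²·p(v,g) dv dg < ∞. Then p is bounded on Ω, i.e. sup_{(v,g)∈Ω} p(v,g) < ∞. -/
open Real MeasureTheory Set Filter

noncomputable section

/-- The voltage flux `J(v,g) = -g_L v + g (V_E - v)`. -/
def Jflux (VE gL v g : ℝ) : ℝ := -gL * v + g * (VE - v)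

/-- The Maxwellian `M(g) = exp(-(g - g_in)^2 / (2a))`. -/
def Mw (gin a g : ℝ) : ℝ := Real.exp (-(g - gin) ^ 2 / (2 * a))

/-- A classical stationary solution of the voltage-conductance equation:
`p : (0,V_F) × [0,∞) → [0,∞)`, C¹ in `v` (with continuous boundary extension) and
C² in `g` up to `g = 0`, satisfying the stationary equation, the no-flux boundary
condition at `g = 0`, the `v`-boundary conditions changing type at `g_F = g_L V_F/(V_E - V_F)`,
the normalization, and decay (uniform in `v`) of `p`, `g² p`, `∂_g p` as `g → ∞`. -/
structure StatSol (VF VE gL gin a σE : ℝ) (p : ℝ → ℝ → ℝ) : Prop where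
  nonneg : ∀ v ∈ Ioo 0 VF, ∀ g ∈ Ici (0:ℝ), 0 ≤ p v g
  cont_v : ∀ g ∈ Ici (0:ℝ), ContinuousOn (fun v => p v g) (Icc 0 VF)
  diff_v : ∀ v ∈ Ioo 0 VF, ∀ g ∈ Ioi (0:ℝ), DifferentiableAt ℝ (fun v' => p v' g) v
  smooth_g : ∀ v ∈ Ioo 0 VF, ContDiffOn ℝ 2 (fun g => p v g) (Ici 0)
  pde : ∀ v ∈ Ioo 0 VF, ∀ g ∈ Ioi (0:ℝ),
    deriv (fun v' => Jflux VE gL v' g * p v' g) v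
      + deriv (fun g' => ((gin - g') / σE) * p v g') g
      - (a / σE) * deriv (deriv (fun g' => p v g')) g = 0
  bc_g : ∀ v ∈ Ioo 0 VF, (0 - gin) * p v 0 + a * deriv (fun g' => p v g') 0 = 0
  bc_v_low : ∀ g ∈ Ioo 0 (gL * VF / (VE - VF)),
    Jflux VE gL 0 g * p 0 g = 0 ∧ Jflux VE gL VF g * p VF g = 0
  bc_v_high : ∀ g ∈ Ici (gL * VF / (VE - VF)),
    Jflux VE gL 0 g * p 0 g = Jflux VE gL VF g * p VF g
  normalized : ∫ v in Ioo 0 VF, ∫ g in Ioi (0:ℝ), p v g = 1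
  decay : ∀ ε > 0, ∃ G : ℝ, ∀ g ∈ Ici G, ∀ v ∈ Ioo 0 VF,
    p v g < ε ∧ g ^ 2 * p v g < ε ∧ |deriv (fun g' => p v g') g| < ε

open scoped Topology

/-- second symmetric difference -/
def vcD2 (f : ℝ → ℝ) (g h : ℝ) : ℝ := f (g + h) + f (g - h) - 2 * f g

lemma vc_max0 {f : ℝ → ℝ} {c d : ℝ} (hf : ContinuousOn f (Icc c d))
    (hc : f c ≤ 0) (hd : f d ≤ 0)
    (hS : ∀ g ∈ Ioo c d, ∀ δ > 0, ∃ᶠ h in 𝓝[>] (0:ℝ), -δ * h ^ 2 ≤ vcD2 f g h) :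
    ∀ g ∈ Icc c d, f g ≤ 0 := by
  intro gs hgs
  by_contra hcon
  push Not at hcon
  have hcd : c < d := by
    rcases hgs.1.eq_or_lt with h | h
    · subst h; linarith
    · exact lt_of_lt_of_le h hgs.2
  set δ : ℝ := f gs / (2 * (d - c) ^ 2) with hδ
  have hδ0 : 0 < δ := by have : 0 < d - c := by linarith
                         positivity
  set F : ℝ → ℝ := fun x => f x + δ * ((x - c) * (x - d)) with hF
  have hFc : ContinuousOn F (Icc c d) := by
    apply hf.add; fun_prop
  obtain ⟨x0, hx0, hmax⟩ := isCompact_Icc.exists_isMaxOn ⟨gs, hgs⟩ hFc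
  have hFgs : 0 < F gs := by
    have h1 : (gs - c) * (d - gs) ≤ (d - c) ^ 2 := by nlinarith [hgs.1, hgs.2]
    have h2 : δ * (d - c) ^ 2 = f gs / 2 := by
      have : d - c ≠ 0 := by linarith
      rw [hδ]; field_simp
    have h3 : δ * ((gs - c) * (d - gs)) ≤ δ * (d - c) ^ 2 := by gcongr
    have : F gs = f gs - δ * ((gs - c) * (d - gs)) := by simp only [hF]; ring
    linarith
  have hFx0 : 0 < F x0 := lt_of_lt_of_le hFgs (hmax hgs)
  have hx0c : x0 ≠ c := by
    rintro rfl
    have : F x0 = f x0 := by simp [hF]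
    linarith
  have hx0d : x0 ≠ d := by
    rintro rfl
    have : F x0 = f x0 := by simp [hF]
    linarith
  have hx0' : x0 ∈ Ioo c d := ⟨lt_of_le_of_ne hx0.1 (Ne.symm hx0c), lt_of_le_of_ne hx0.2 hx0d⟩
  have hev : ∀ᶠ h in 𝓝[>] (0:ℝ), 0 < h ∧ x0 + h ∈ Icc c d ∧ x0 - h ∈ Icc c d := by
    have : Ioo (0:ℝ) (min (x0 - c) (d - x0)) ∈ 𝓝[>] (0:ℝ) :=
      Ioo_mem_nhdsGT (lt_min (by linarith [hx0'.1]) (by linarith [hx0'.2]))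
    filter_upwards [this] with h hh
    have h1 := lt_of_lt_of_le hh.2 (min_le_left _ _)
    have h2 := lt_of_lt_of_le hh.2 (min_le_right _ _)
    exact ⟨hh.1, ⟨by linarith [hh.1], by linarith⟩, ⟨by linarith, by linarith [hh.1]⟩⟩
  obtain ⟨h, hh1, hh0, hhp, hhm⟩ := ((hS x0 hx0' δ hδ0).and_eventually hev).exists
  have e1 := hmax hhp
  have e2 := hmax hhm
  simp only [mem_ofPred_eq, hF] at e1 e2
  simp only [vcD2] at hh1
  have : 0 < δ * h ^ 2 := by positivity
  nlinarith

lemma vc_chord {f : ℝ → ℝ} {c d : ℝ} (hcd : c < d) (hf : ContinuousOn f (Icc c d))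
    (hS : ∀ g ∈ Ioo c d, ∀ δ > 0, ∃ᶠ h in 𝓝[>] (0:ℝ), -δ * h ^ 2 ≤ vcD2 f g h) :
    ∀ g ∈ Icc c d, f g ≤ f c + (f d - f c) / (d - c) * (g - c) := by
  intro g hg
  have hdc : d - c ≠ 0 := by linarith
  have := vc_max0 (f := fun x => f x - (f c + (f d - f c) / (d - c) * (x - c))) (c := c) (d := d)
    (hf.sub (by fun_prop)) (by simp) (by field_simp; simp) ?_ g hg
  · simpa using this
  · intro x hx δ hδ
    refine (hS x hx δ hδ).mono ?_
    intro h hh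
    simp only [vcD2] at hh ⊢
    linarith

lemma vc_D2_tendsto {f f' : ℝ → ℝ} {f'' g : ℝ} (h1 : ∀ᶠ x in 𝓝 g, HasDerivAt f (f' x) x)
    (h2 : HasDerivAt f' f'' g) :
    Tendsto (fun h => vcD2 f g h / h ^ 2) (𝓝[>] (0:ℝ)) (𝓝 f'') := by
  have hp : Tendsto (fun h : ℝ => g + h) (𝓝[>] 0) (𝓝 g) := by
    have : Tendsto (fun h : ℝ => g + h) (𝓝 0) (𝓝 (g + 0)) := (by fun_prop : Continuous fun h : ℝ => g + h).tendsto 0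
    rw [add_zero] at this
    exact this.mono_left nhdsWithin_le_nhds
  have hm : Tendsto (fun h : ℝ => g - h) (𝓝[>] 0) (𝓝 g) := by
    have : Tendsto (fun h : ℝ => g - h) (𝓝 0) (𝓝 (g - 0)) := (by fun_prop : Continuous fun h : ℝ => g - h).tendsto 0
    rw [sub_zero] at this
    exact this.mono_left nhdsWithin_le_nhds
  have hcont : ContinuousAt f g := h1.self_of_nhds.continuousAt
  refine HasDerivAt.lhopital_zero_nhdsGT (f' := fun h => f' (g + h) - f' (g - h)) (g' := fun h => 2 * h) ?_ ?_ ?_ ?_ ?_ ?_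
  · filter_upwards [hp.eventually h1, hm.eventually h1] with h a b
    have ha : HasDerivAt (fun h => f (g + h)) (f' (g + h)) h := by
      simpa using HasDerivAt.comp_const_add g h a
    have hb : HasDerivAt (fun h => f (g - h)) (- f' (g - h)) h := by
      simpa using HasDerivAt.comp_const_sub g h b
    have := (ha.add hb).sub_const (2 * f g)
    have e : f' (g + h) - f' (g - h) = f' (g + h) + -f' (g - h) := by ring
    rw [e]; exact this
  · filter_upwards with h
    simpa using hasDerivAt_pow 2 h
  · filter_upwards [self_mem_nhdsWithin] with h hh
    have : (0:ℝ) < h := hh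
    positivity
  · have a := hcont.tendsto.comp hp
    have b := hcont.tendsto.comp hm
    have := (a.add b).sub_const (2 * f g)
    have e : f g + f g - 2 * f g = 0 := by ring
    rw [e] at this
    exact this
  · have : Tendsto (fun h : ℝ => h ^ 2) (𝓝 0) (𝓝 (0 ^ 2)) := (by fun_prop : Continuous fun h : ℝ => h ^ 2).tendsto 0
    simp only [ne_eq, OfNat.ofNat_ne_zero, not_false_eq_true, zero_pow] at this
    exact this.mono_left nhdsWithin_le_nhds
  · have hs := hasDerivAt_iff_tendsto_slope_zero.1 h2
    have hs1 : Tendsto (fun t => t⁻¹ • (f' (g + t) - f' g)) (𝓝[>] 0) (𝓝 f'') :=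
      hs.mono_left (nhdsWithin_mono _ (fun x hx => ne_of_gt hx))
    have hneg : Tendsto (fun t : ℝ => -t) (𝓝[>] 0) (𝓝[≠] 0) := by
      apply tendsto_nhdsWithin_of_tendsto_nhds_of_eventually_within
      · have : Tendsto (fun h : ℝ => -h) (𝓝 0) (𝓝 (-0)) := (by fun_prop : Continuous fun h : ℝ => -h).tendsto 0
        rw [neg_zero] at this
        exact this.mono_left nhdsWithin_le_nhds
      · filter_upwards [self_mem_nhdsWithin] with h hh
        have : (0:ℝ) < h := hh
        simp [this.ne']
    have hs2 := hs.comp hneg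
    have hh := (hs1.add hs2).const_mul (1/2)
    have e : 1 / 2 * (f'' + f'') = f'' := by ring
    rw [e] at hh
    refine hh.congr' ?_
    filter_upwards [self_mem_nhdsWithin] with h hh
    have : (0:ℝ) < h := hh
    simp only [Function.comp, smul_eq_mul, ← sub_eq_add_neg]
    field_simp
    ring

lemma vc_semiconvex {f : ℝ → ℝ} {c d C : ℝ} (hf : ContinuousOn f (Icc c d))
    (hS : ∀ g ∈ Ioo c d, ∀ δ > 0, ∃ᶠ h in 𝓝[>] (0:ℝ), -(C + δ) * h ^ 2 ≤ vcD2 f g h)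
    {g h : ℝ} (hh : 0 < h) (h1 : c ≤ g - h) (h2 : g + h ≤ d) : -C * h ^ 2 ≤ vcD2 f g h := by
  have := vc_chord (f := fun x => f x + C / 2 * x ^ 2) (c := g - h) (d := g + h) (by linarith)
    ((hf.mono (Icc_subset_Icc h1 h2)).add (by fun_prop)) ?_ g ⟨by linarith, by linarith⟩
  · have e : g + h - (g - h) = 2 * h := by ring
    have e2 : g - (g - h) = h := by ring
    simp only [e, e2] at this
    have e3 : ∀ X : ℝ, X / (2 * h) * h = X / 2 := by intro X; field_simp
    rw [e3] at this
    simp only [vcD2]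
    nlinarith
  · intro x hx δ hδ
    refine (hS x ⟨by linarith [hx.1], by linarith [hx.2]⟩ δ hδ).mono ?_
    intro k hk
    simp only [vcD2] at hk ⊢
    nlinarith

lemma vc_L1' {f e : ℝ → ℝ} {c d : ℝ} (hcd : c < d) (hf : ContinuousOn f (Icc c d))
    (he : ContinuousOn e (Icc c d)) (he0 : ∀ g ∈ Icc c d, 0 ≤ e g)
    (hS : ∀ g ∈ Ioo c d, ∀ δ > 0, ∃ᶠ h in 𝓝[>] (0:ℝ), -(e g + δ) * h ^ 2 ≤ vcD2 f g h) :
    ∀ g ∈ Icc c d, f g ≤ max (f c) (f d) + (d - c) * ∫ t in c..d, e t := by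
  set E : ℝ → ℝ := IccExtend hcd.le (domRestrict (Icc c d) e) with hE
  have hEc : Continuous E := (continuousOn_iff_continuous_domRestrict.1 he).Icc_extend'
  have hEe : ∀ g ∈ Icc c d, E g = e g := fun g hg => by simp [hE, IccExtend_of_mem _ _ hg]
  have hE0 : ∀ g, 0 ≤ E g := fun g => by
    simp only [hE, IccExtend, Function.comp, domRestrict_apply]
    exact he0 _ (projIcc c d hcd.le g).2
  set E1 : ℝ → ℝ := fun x => ∫ t in c..x, E t with hE1
  have hE1d : ∀ x, HasDerivAt E1 (E x) x := fun x =>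
    intervalIntegral.integral_hasDerivAt_right (hEc.intervalIntegrable _ _)
      hEc.stronglyMeasurable.stronglyMeasurableAtFilter hEc.continuousAt
  have hE1c : Continuous E1 := continuous_iff_continuousAt.2 fun x => (hE1d x).continuousAt
  set X : ℝ → ℝ := fun x => ∫ t in c..x, E1 t with hX
  have hXd : ∀ x, HasDerivAt X (E1 x) x := fun x =>
    intervalIntegral.integral_hasDerivAt_right (hE1c.intervalIntegrable _ _)
      hE1c.stronglyMeasurable.stronglyMeasurableAtFilter hE1c.continuousAt
  have hXc : Continuous X := continuous_iff_continuousAt.2 fun x => (hXd x).continuousAt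
  have hE1n : ∀ x, c ≤ x → 0 ≤ E1 x := fun x hx =>
    intervalIntegral.integral_nonneg hx fun t _ => hE0 t
  have hE1m : ∀ x, c ≤ x → x ≤ d → E1 x ≤ E1 d := fun x hx hxd => by
    have : E1 x + ∫ t in x..d, E t = E1 d :=
      intervalIntegral.integral_add_adjacent_intervals (hEc.intervalIntegrable _ _) (hEc.intervalIntegrable _ _)
    have h2 : 0 ≤ ∫ t in x..d, E t := intervalIntegral.integral_nonneg hxd fun t _ => hE0 t
    linarith
  have hXn : ∀ x, c ≤ x → 0 ≤ X x := fun x hx =>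
    intervalIntegral.integral_nonneg hx fun t ht => hE1n t ht.1
  have hXd' : X d ≤ (d - c) * E1 d := by
    have := intervalIntegral.integral_mono_on (μ := volume) hcd.le (hE1c.intervalIntegrable c d)
      (intervalIntegrable_const (c := E1 d)) (fun x hx => hE1m x hx.1 hx.2)
    simpa using this
  have hEd : E1 d = ∫ t in c..d, e t := by
    apply intervalIntegral.integral_congr
    intro t ht
    rw [uIcc_of_le hcd.le] at ht
    exact hEe t ht
  have hXc0 : X c = 0 := by simp [hX]
  intro g hg
  have key := vc_max0 (f := fun x => f x + X x - (max (f c) (f d) + X d)) (c := c) (d := d)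
    ((hf.add hXc.continuousOn).sub continuousOn_const) ?_ ?_ ?_ g hg
  · have := hXn g hg.1
    rw [← hEd]; linarith
  · have := hXn d hcd.le
    have := le_max_left (f c) (f d)
    simp only [hXc0]; linarith
  · have := le_max_right (f c) (f d)
    linarith
  · intro x hx δ hδ
    have ht := vc_D2_tendsto (f := X) (f' := E1) (g := x) (Eventually.of_forall hXd) (hE1d x)
    have hev : ∀ᶠ h in 𝓝[>] (0:ℝ), E x - δ / 2 < vcD2 X x h / h ^ 2 :=
      ht.eventually (lt_mem_nhds (by linarith))
    have hev2 := hev.and self_mem_nhdsWithin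
    refine ((hS x hx (δ/2) (by linarith)).and_eventually hev2).mono ?_
    rintro h ⟨a1, a2, a3⟩
    have : (0:ℝ) < h := a3
    rw [lt_div_iff₀ (by positivity), hEe x ⟨hx.1.le, hx.2.le⟩] at a2
    simp only [vcD2] at a1 a2 ⊢
    nlinarith

section P2

structure VcH (y : ℝ → ℝ → ℝ) (a1 a2 c d Λ : ℝ) : Prop where
  ha : a1 < a2
  hcd : c < d
  nn : ∀ v ∈ Icc a1 a2, ∀ g ∈ Icc c d, 0 ≤ y v g
  up : ∀ v ∈ Icc a1 a2, ∀ g ∈ Icc c d, y v g ≤ Λ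
  cv : ∀ g ∈ Icc c d, ContinuousOn (fun v => y v g) (Icc a1 a2)
  cg : ∀ v ∈ Icc a1 a2, ContinuousOn (fun g => y v g) (Icc c d)
  usc : ∀ v ∈ Icc a1 a2, ∀ g ∈ Icc c d, ∀ t > y v g,
    ∀ᶠ z in 𝓝 (v, g), z.1 ∈ Icc a1 a2 → z.2 ∈ Icc c d → y z.1 z.2 < t

/-- sup-convolution in the first variable -/
def vcS (y : ℝ → ℝ → ℝ) (a1 a2 ε v g : ℝ) : ℝ :=
  sSup ((fun x => y x g - (v - x) ^ 2 / (2 * ε)) '' Icc a1 a2)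

variable {y : ℝ → ℝ → ℝ} {a1 a2 c d Λ ε : ℝ}

lemma VcH.maxi (H : VcH y a1 a2 c d Λ) (ε : ℝ) (v : ℝ) {g : ℝ} (hg : g ∈ Icc c d) :
    ∃ x ∈ Icc a1 a2, vcS y a1 a2 ε v g = y x g - (v - x) ^ 2 / (2 * ε) ∧
      ∀ x' ∈ Icc a1 a2, y x' g - (v - x') ^ 2 / (2 * ε) ≤ vcS y a1 a2 ε v g := by
  have hc : ContinuousOn (fun x => y x g - (v - x) ^ 2 / (2 * ε)) (Icc a1 a2) :=
    (H.cv g hg).sub (by fun_prop)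
  obtain ⟨x, hx, he, hm⟩ := isCompact_Icc.exists_sSup_image_eq_and_ge (nonempty_Icc.2 H.ha.le) hc
  refine ⟨x, hx, he, fun x' hx' => ?_⟩
  have := hm x' hx'
  unfold vcS
  rw [he]; exact this

lemma VcH.S_ge (H : VcH y a1 a2 c d Λ) (ε : ℝ) (v : ℝ) {g : ℝ} (hg : g ∈ Icc c d) {x : ℝ}
    (hx : x ∈ Icc a1 a2) : y x g - (v - x) ^ 2 / (2 * ε) ≤ vcS y a1 a2 ε v g := by
  obtain ⟨_, _, _, h⟩ := H.maxi ε v hg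
  exact h x hx

lemma VcH.y_le_S (H : VcH y a1 a2 c d Λ) (ε : ℝ) {v g : ℝ} (hv : v ∈ Icc a1 a2) (hg : g ∈ Icc c d) :
    y v g ≤ vcS y a1 a2 ε v g := by
  simpa using H.S_ge ε v hg hv

lemma VcH.S_nonneg (H : VcH y a1 a2 c d Λ) (ε : ℝ) {v g : ℝ} (hv : v ∈ Icc a1 a2)
    (hg : g ∈ Icc c d) : 0 ≤ vcS y a1 a2 ε v g :=
  (H.nn v hv g hg).trans (H.y_le_S ε hv hg)

lemma VcH.S_le (H : VcH y a1 a2 c d Λ) (hε : 0 < ε) (v : ℝ) {g : ℝ}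
    (hg : g ∈ Icc c d) : vcS y a1 a2 ε v g ≤ Λ := by
  obtain ⟨x, hx, h, _⟩ := H.maxi ε v hg
  have := H.up x hx g hg
  have h2 : 0 ≤ (v - x) ^ 2 / (2 * ε) := by positivity
  linarith

lemma VcH.maxi_close (H : VcH y a1 a2 c d Λ) (hε : 0 < ε) {v g x : ℝ} (hv : v ∈ Icc a1 a2)
    (hg : g ∈ Icc c d) (hx : x ∈ Icc a1 a2)
    (h : vcS y a1 a2 ε v g = y x g - (v - x) ^ 2 / (2 * ε)) : (v - x) ^ 2 ≤ 2 * ε * Λ := by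
  have h1 := H.S_nonneg ε hv hg
  have h2 := H.up x hx g hg
  have h3 : (v - x) ^ 2 / (2 * ε) ≤ Λ := by linarith
  rw [div_le_iff₀ (by positivity)] at h3
  linarith

lemma VcH.S_lip (H : VcH y a1 a2 c d Λ) (hε : 0 < ε) {v u g : ℝ} (hv : v ∈ Icc a1 a2)
    (hu : u ∈ Icc a1 a2) (hg : g ∈ Icc c d) :
    vcS y a1 a2 ε v g - vcS y a1 a2 ε u g ≤ (a2 - a1) / ε * |v - u| := by
  obtain ⟨x, hx, h, _⟩ := H.maxi ε v hg
  have h2 := H.S_ge ε u hg hx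
  have h3 : ((u - x) ^ 2 - (v - x) ^ 2) / (2 * ε) ≤ (a2 - a1) / ε * |v - u| := by
    rw [div_le_iff₀ (by positivity)]
    have e : (a2 - a1) / ε * |v - u| * (2 * ε) = 2 * (a2 - a1) * |v - u| := by field_simp
    rw [e]
    have e2 : (u - x) ^ 2 - (v - x) ^ 2 = (u - v) * (u + v - 2 * x) := by ring
    rw [e2]
    calc (u - v) * (u + v - 2 * x) ≤ |(u - v) * (u + v - 2 * x)| := le_abs_self _
      _ = |u + v - 2 * x| * |v - u| := by rw [abs_mul, abs_sub_comm u v, mul_comm]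
      _ ≤ _ := by
        gcongr
        rw [abs_le]
        constructor <;> linarith [hx.1, hx.2, hv.1, hv.2, hu.1, hu.2]
  have e : ((u - x) ^ 2 - (v - x) ^ 2) / (2 * ε) = (u - x) ^ 2 / (2 * ε) - (v - x) ^ 2 / (2 * ε) := by ring
  linarith

lemma VcH.S_lipOn (H : VcH y a1 a2 c d Λ) (hε : 0 < ε) {g : ℝ} (hg : g ∈ Icc c d) :
    LipschitzOnWith (Real.toNNReal ((a2 - a1) / ε)) (fun v => vcS y a1 a2 ε v g) (Icc a1 a2) := by
  have h0 : 0 ≤ (a2 - a1) / ε := div_nonneg (by linarith [H.ha]) hε.le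
  apply LipschitzOnWith.of_dist_le_mul
  intro v hv u hu
  rw [Real.dist_eq, Real.dist_eq, Real.coe_toNNReal _ h0, abs_sub_le_iff]
  exact ⟨H.S_lip hε hv hu hg, by rw [abs_sub_comm]; exact H.S_lip hε hu hv hg⟩

lemma VcH.S_two (H : VcH y a1 a2 c d Λ) (hε : 0 < ε) {v g x : ℝ}
    (hg : g ∈ Icc c d) (hx : x ∈ Icc a1 a2)
    (h : vcS y a1 a2 ε v g = y x g - (v - x) ^ 2 / (2 * ε)) :
    (v - x) ^ 2 / (4 * ε) ≤ vcS y a1 a2 (2 * ε) v g - vcS y a1 a2 ε v g := by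
  have h2 := H.S_ge (2 * ε) v hg hx
  have e1 : (v - x) ^ 2 / (2 * ε) = 2 * ((v - x) ^ 2 / (4 * ε)) := by field_simp; ring
  have e2 : (v - x) ^ 2 / (2 * (2 * ε)) = ((v - x) ^ 2 / (4 * ε)) := by field_simp; ring
  rw [e1] at h; rw [e2] at h2; linarith

lemma VcH.S_tendsto (H : VcH y a1 a2 c d Λ) {v g : ℝ} (hv : v ∈ Icc a1 a2)
    (hg : g ∈ Icc c d) : Tendsto (fun ε => vcS y a1 a2 ε v g) (𝓝[>] 0) (𝓝 (y v g)) := by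
  rw [tendsto_order]
  constructor
  · intro t ht
    exact Eventually.of_forall fun ε => lt_of_lt_of_le ht (H.y_le_S ε hv hg)
  · intro t ht
    have hc := H.cv g hg v hv
    have := hc.eventually (gt_mem_nhds ht)
    rw [eventually_nhdsWithin_iff, Metric.eventually_nhds_iff] at this
    obtain ⟨r, hr, h⟩ := this
    have hlim : Tendsto (fun ε : ℝ => 2 * ε * Λ) (𝓝[>] 0) (𝓝 (2 * 0 * Λ)) :=
      ((by fun_prop : Continuous fun ε : ℝ => 2 * ε * Λ).tendsto 0).mono_left nhdsWithin_le_nhds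
    have hr2 : 2 * 0 * Λ < r ^ 2 := by simp; positivity
    filter_upwards [hlim.eventually (gt_mem_nhds hr2), self_mem_nhdsWithin] with ε h1 h2
    have hε : 0 < ε := h2
    obtain ⟨x, hx, he, _⟩ := H.maxi ε v hg
    have hcl := H.maxi_close hε hv hg hx he
    have hlt : dist x v < r := by
      rw [Real.dist_eq, abs_sub_comm]
      exact abs_lt_of_sq_lt_sq (by linarith) hr.le
    have := h hlt hx
    have h0 : 0 ≤ (v - x) ^ 2 / (2 * ε) := by positivity
    linarith

lemma VcH.S_cg (H : VcH y a1 a2 c d Λ) (ε v : ℝ) :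
    ContinuousOn (fun g => vcS y a1 a2 ε v g) (Icc c d) := by
  intro g0 hg0
  rw [ContinuousWithinAt, tendsto_order]
  constructor
  · intro t ht
    obtain ⟨x, hx, he, _⟩ := H.maxi ε v hg0
    have hc := (H.cg x hx g0 hg0).eventually (lt_mem_nhds (show t + (v - x) ^ 2 / (2 * ε) < y x g0 by linarith))
    filter_upwards [hc, self_mem_nhdsWithin] with g h1 h2
    have := H.S_ge ε v h2 hx
    linarith
  · intro t ht
    have key : ∀ᶠ g in 𝓝 g0, ∀ x ∈ Icc a1 a2, x ∈ Icc a1 a2 → g ∈ Icc c d → y x g - (v - x) ^ 2 / (2 * ε) < t := by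
      refine isCompact_Icc.eventually_forall_of_forall_eventually ?_
      intro x hx
      have hlt : y x g0 - (v - x) ^ 2 / (2 * ε) < t := lt_of_le_of_lt (H.S_ge ε v hg0 hx) ht
      obtain ⟨t1, ht1, ht2⟩ : ∃ t1, y x g0 < t1 ∧ t1 < t + (v - x) ^ 2 / (2 * ε) :=
        exists_between (by linarith)
      have h1 := H.usc x hx g0 hg0 t1 ht1
      have h1' : ∀ᶠ z : ℝ × ℝ in 𝓝 (g0, x), z.2 ∈ Icc a1 a2 → z.1 ∈ Icc c d → y z.2 z.1 < t1 := by
        have := (continuous_swap.tendsto (g0, x)).eventually (p := fun z : ℝ × ℝ => z.1 ∈ Icc a1 a2 → z.2 ∈ Icc c d → y z.1 z.2 < t1) h1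
        exact this
      have h2 : ∀ᶠ z : ℝ × ℝ in 𝓝 (g0, x), t1 < t + (v - z.2) ^ 2 / (2 * ε) := by
        have : Continuous fun z : ℝ × ℝ => t + (v - z.2) ^ 2 / (2 * ε) := by fun_prop
        exact (this.tendsto (g0, x)).eventually (lt_mem_nhds ht2)
      filter_upwards [h1', h2] with z b1 b2 b3 b4
      have := b1 b3 b4
      linarith
    rw [eventually_nhdsWithin_iff]
    filter_upwards [key] with g h1 h2
    obtain ⟨x, hx, he, _⟩ := H.maxi ε v h2
    rw [he]
    exact h1 x hx hx h2

end P2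

section P3

/-- pointwise differential inequality where `y` is positive -/
def VcP (VE gL A K : ℝ) (y : ℝ → ℝ → ℝ) (a1 a2 c d : ℝ) : Prop :=
  ∀ v ∈ Ioo a1 a2, ∀ g ∈ Ioo c d, 0 < y v g → ∃ dv dgg : ℝ,
    HasDerivAt (fun v' => y v' g) dv v ∧
    Tendsto (fun h => vcD2 (y v) g h / h ^ 2) (𝓝[>] (0:ℝ)) (𝓝 dgg) ∧
    Jflux VE gL v g * dv - K * y v g ≤ A * dgg

variable {y : ℝ → ℝ → ℝ} {a1 a2 c d Λ ε VE gL A K : ℝ}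

lemma vc_ev_small {c d g : ℝ} (hg : g ∈ Ioo c d) :
    ∀ᶠ h in 𝓝[>] (0:ℝ), 0 < h ∧ g + h ∈ Icc c d ∧ g - h ∈ Icc c d := by
  have : Ioo (0:ℝ) (min (g - c) (d - g)) ∈ 𝓝[>] (0:ℝ) :=
    Ioo_mem_nhdsGT (lt_min (by linarith [hg.1]) (by linarith [hg.2]))
  filter_upwards [this] with h hh
  have h1 := lt_of_lt_of_le hh.2 (min_le_left _ _)
  have h2 := lt_of_lt_of_le hh.2 (min_le_right _ _)
  exact ⟨hh.1, ⟨by linarith [hh.1], by linarith⟩, ⟨by linarith, by linarith [hh.1]⟩⟩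

lemma VcH.schwarz (H : VcH y a1 a2 c d Λ) (hP : VcP VE gL A K y a1 a2 c d) (hA : 0 < A)
    (hε : 0 < ε) {v g x : ℝ} (hv : v ∈ Icc a1 a2) (hg : g ∈ Ioo c d) (hx : x ∈ Ioo a1 a2)
    (h : vcS y a1 a2 ε v g = y x g - (v - x) ^ 2 / (2 * ε)) {δ : ℝ} (hδ : 0 < δ) :
    ∀ᶠ h in 𝓝[>] (0:ℝ), ((Jflux VE gL x g * ((x - v) / ε) - K * y x g) / A - δ) * h ^ 2
      ≤ vcD2 (fun g' => vcS y a1 a2 ε v g') g h := by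
  have hg' : g ∈ Icc c d := ⟨hg.1.le, hg.2.le⟩
  have hx' : x ∈ Icc a1 a2 := ⟨hx.1.le, hx.2.le⟩
  have hD2 : ∀ᶠ h in 𝓝[>] (0:ℝ), vcD2 (y x) g h ≤ vcD2 (fun g' => vcS y a1 a2 ε v g') g h := by
    filter_upwards [vc_ev_small hg] with k hk
    have h1 := H.S_ge ε v hk.2.1 hx'
    have h2 := H.S_ge ε v hk.2.2 hx'
    simp only [vcD2]
    linarith
  rcases (H.nn x hx' g hg').eq_or_lt with h0 | h0
  · have h1 := H.S_nonneg ε hv hg'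
    have h2 : 0 ≤ (v - x) ^ 2 / (2 * ε) := by positivity
    have h3 : (v - x) ^ 2 / (2 * ε) = 0 := by linarith
    have h4 : v - x = 0 := by
      rcases div_eq_zero_iff.1 h3 with h | h
      · exact pow_eq_zero_iff (two_ne_zero) |>.1 h
      · linarith
    have h5 : x - v = 0 := by linarith
    rw [h5, ← h0]
    filter_upwards [hD2, vc_ev_small hg] with k hk hk2
    refine le_trans ?_ hk
    have p1 := H.nn x hx' _ hk2.2.1
    have p2 := H.nn x hx' _ hk2.2.2
    simp only [vcD2, ← h0]
    have : 0 ≤ δ * k ^ 2 := by positivity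
    simp only [zero_div, mul_zero, sub_zero]
    linarith
  · obtain ⟨dv, dgg, hd, ht, hle⟩ := hP x hx g hg h0
    have hdv : dv = (x - v) / ε := by
      have hmax : IsLocalMax (fun x' => y x' g - (v - x') ^ 2 / (2 * ε)) x := by
        filter_upwards [Icc_mem_nhds hx.1 hx.2] with x' hx'
        rw [← h]
        exact H.S_ge ε v hg' hx'
      have hdd : HasDerivAt (fun x' => y x' g - (v - x') ^ 2 / (2 * ε)) (dv - (-(2 * (v - x))) / (2 * ε)) x := by
        have h1 : HasDerivAt (fun x' : ℝ => (v - x') ^ 2) (-(2 * (v - x))) x := by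
          simpa using ((hasDerivAt_id x).const_sub v).fun_pow 2
        exact hd.sub (h1.div_const (2 * ε))
      have := hmax.hasDerivAt_eq_zero hdd
      field_simp at this ⊢
      linarith
    subst hdv
    have hlim : (Jflux VE gL x g * ((x - v) / ε) - K * y x g) / A - δ < dgg := by
      have : (Jflux VE gL x g * ((x - v) / ε) - K * y x g) / A ≤ dgg := by
        rw [div_le_iff₀ hA]; linarith
      linarith
    filter_upwards [hD2, ht.eventually (lt_mem_nhds hlim), self_mem_nhdsWithin] with k h1 h2 h3
    have : (0:ℝ) < k := h3
    rw [lt_div_iff₀ (by positivity)] at h2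
    linarith

lemma VcH.deriv_eq (H : VcH y a1 a2 c d Λ) (hε : 0 < ε) {v g x D : ℝ} 
    (hg : g ∈ Icc c d) (hx : x ∈ Icc a1 a2)
    (h : vcS y a1 a2 ε v g = y x g - (v - x) ^ 2 / (2 * ε))
    (hD : HasDerivAt (fun u => vcS y a1 a2 ε u g) D v) : D = (x - v) / ε := by
  have hmin : IsLocalMin (fun u => vcS y a1 a2 ε u g - (y x g - (u - x) ^ 2 / (2 * ε))) v := by
    refine Eventually.of_forall fun u => ?_
    have := H.S_ge ε u hg hx
    simp only
    linarith
  have hdd : HasDerivAt (fun u => vcS y a1 a2 ε u g - (y x g - (u - x) ^ 2 / (2 * ε)))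
      (D - (0 - 2 * (v - x) / (2 * ε))) v := by
    have h1 : HasDerivAt (fun x' : ℝ => (x' - x) ^ 2) (2 * (v - x)) v := by
      simpa using ((hasDerivAt_id v).sub_const x).fun_pow 2
    exact hD.sub ((hasDerivAt_const v _).sub (h1.div_const (2 * ε)))
  have := hmin.hasDerivAt_eq_zero hdd
  field_simp at this ⊢
  linarith

/-- pointwise lower bound density -/
def vcκ (VE gL A K : ℝ) (y : ℝ → ℝ → ℝ) (a1 a2 ε v g : ℝ) : ℝ :=
  (Jflux VE gL v g * deriv (fun u => vcS y a1 a2 ε u g) v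
    - (4 * (gL + g) + 2 * K) * (vcS y a1 a2 (2 * ε) v g - vcS y a1 a2 ε v g)
    - K * vcS y a1 a2 ε v g) / A

lemma VcH.kappa (H : VcH y a1 a2 c d Λ) (hP : VcP VE gL A K y a1 a2 c d) (hA : 0 < A) (hK : 0 ≤ K)
    (hgL : 0 ≤ gL) (hc : 0 ≤ c)
    (hε : 0 < ε) {v g : ℝ} {s : ℝ} (hs : 2 * ε * Λ < s ^ 2) (hs0 : 0 < s)
    (hv : v ∈ Icc (a1 + s) (a2 - s)) (hg : g ∈ Ioo c d)
    (hd : DifferentiableAt ℝ (fun u => vcS y a1 a2 ε u g) v) {δ : ℝ} (hδ : 0 < δ) :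
    ∀ᶠ h in 𝓝[>] (0:ℝ), (vcκ VE gL A K y a1 a2 ε v g - δ) * h ^ 2
      ≤ vcD2 (fun g' => vcS y a1 a2 ε v g') g h := by
  have hg' : g ∈ Icc c d := ⟨hg.1.le, hg.2.le⟩
  have hv' : v ∈ Icc a1 a2 := ⟨by linarith [hv.1], by linarith [hv.2]⟩
  obtain ⟨x, hx, he, _⟩ := H.maxi ε v hg'
  have hcl := H.maxi_close hε hv' hg' hx he
  have hlt : |v - x| < s := abs_lt_of_sq_lt_sq (by linarith) hs0.le
  rw [abs_lt] at hlt
  have hx' : x ∈ Ioo a1 a2 := ⟨by linarith [hv.1], by linarith [hv.2]⟩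
  have hder := H.deriv_eq hε hg' hx he hd.hasDerivAt
  have htwo := H.S_two hε hg' hx he
  filter_upwards [H.schwarz hP hA hε hv' hg hx' he hδ] with h hh
  refine le_trans ?_ hh
  gcongr
  unfold vcκ
  rw [hder]
  have e1 : Jflux VE gL x g * ((x - v) / ε) = Jflux VE gL v g * ((x - v) / ε) - 4 * (gL + g) * ((v - x) ^ 2 / (4 * ε)) := by
    unfold Jflux; field_simp; ring
  have e2 : y x g = vcS y a1 a2 ε v g + 2 * ((v - x) ^ 2 / (4 * ε)) := by
    rw [he]; field_simp; ring
  have hgg : 0 ≤ gL + g := by linarith [hg.1]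
  set Q := (v - x) ^ 2 / (4 * ε)
  rw [e1, e2]
  have m1 := mul_le_mul_of_nonneg_left htwo (show 0 ≤ 4 * (gL + g) + 2 * K by linarith)
  refine div_le_div_of_nonneg_right ?_ hA.le
  linarith

lemma VcH.unif (H : VcH y a1 a2 c d Λ) (hP : VcP VE gL A K y a1 a2 c d) (hA : 0 < A) (hK : 0 ≤ K)
    (hε : 0 < ε) {s : ℝ} (hs : 2 * ε * Λ < s ^ 2) (hs0 : 0 < s) :
    ∃ C : ℝ, 0 ≤ C ∧ ∀ v ∈ Icc (a1 + s) (a2 - s), ∀ g h : ℝ, 0 < h → c ≤ g - h → g + h ≤ d →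
      -C * h ^ 2 ≤ vcD2 (fun g' => vcS y a1 a2 ε v g') g h := by
  obtain ⟨Jm, hJm⟩ : ∃ Jm, ∀ z ∈ Icc a1 a2 ×ˢ Icc c d, ‖Jflux VE gL z.1 z.2‖ ≤ Jm := by
    apply (isCompact_Icc.prod isCompact_Icc).exists_bound_of_continuousOn
    unfold Jflux; fun_prop
  have hJ0 : 0 ≤ Jm := (norm_nonneg _).trans (hJm (a1, c) ⟨⟨le_rfl, H.ha.le⟩, ⟨le_rfl, H.hcd.le⟩⟩)
  have hL0 : 0 ≤ Λ := (H.nn a1 ⟨le_rfl, H.ha.le⟩ c ⟨le_rfl, H.hcd.le⟩).trans (H.up a1 ⟨le_rfl, H.ha.le⟩ c ⟨le_rfl, H.hcd.le⟩)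
  have h00 : 0 ≤ (a2 - a1) / ε := div_nonneg (by linarith [H.ha]) hε.le
  refine ⟨(Jm * ((a2 - a1) / ε) + K * Λ) / A, by positivity, ?_⟩
  intro v hv g h hh h1 h2
  refine vc_semiconvex (H.S_cg ε v) ?_ hh h1 h2
  intro g hg δ hδ
  have hg' : g ∈ Icc c d := ⟨hg.1.le, hg.2.le⟩
  have hv' : v ∈ Icc a1 a2 := ⟨by linarith [hv.1], by linarith [hv.2]⟩
  obtain ⟨x, hx, he, _⟩ := H.maxi ε v hg'
  have hcl := H.maxi_close hε hv' hg' hx he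
  have hlt : |v - x| < s := abs_lt_of_sq_lt_sq (by linarith) hs0.le
  rw [abs_lt] at hlt
  have hx' : x ∈ Ioo a1 a2 := ⟨by linarith [hv.1], by linarith [hv.2]⟩
  apply Eventually.frequently
  filter_upwards [H.schwarz hP hA hε hv' hg hx' he hδ] with h hh
  refine le_trans ?_ hh
  gcongr
  have b1 : |Jflux VE gL x g * ((x - v) / ε)| ≤ Jm * ((a2 - a1) / ε) := by
    rw [abs_mul]
    have j := hJm (x, g) ⟨hx, hg'⟩
    rw [Real.norm_eq_abs] at j
    have : |(x - v) / ε| ≤ (a2 - a1) / ε := by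
      rw [abs_div, abs_of_pos hε]
      gcongr
      rw [abs_le]; constructor <;> linarith [hx.1, hx.2, hv'.1, hv'.2]
    gcongr
  have b2 : K * y x g ≤ K * Λ := mul_le_mul_of_nonneg_left (H.up x hx g hg') hK
  have b3 : -(Jm * ((a2 - a1) / ε) + K * Λ) ≤ Jflux VE gL x g * ((x - v) / ε) - K * y x g := by
    have := (abs_le.1 b1).1
    linarith
  have b4 : -(Jm * ((a2 - a1) / ε) + K * Λ) / A ≤ (Jflux VE gL x g * ((x - v) / ε) - K * y x g) / A := by
    gcongr
  rw [neg_div] at b4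
  linarith

end P3

section P4

variable {y : ℝ → ℝ → ℝ} {a1 a2 c d Λ ε VE gL A K : ℝ}

lemma vc_dct {ι : Type*} {l : Filter ι} [l.IsCountablyGenerated] {F : ι → ℝ → ℝ} {f : ℝ → ℝ}
    {b1 b2 B : ℝ} (hb : b1 ≤ b2)
    (hF : ∀ᶠ n in l, ContinuousOn (F n) (Icc b1 b2))
    (hB : ∀ᶠ n in l, ∀ x ∈ Icc b1 b2, |F n x| ≤ B)
    (hlim : ∀ x ∈ Icc b1 b2, Tendsto (fun n => F n x) l (𝓝 (f x))) :
    Tendsto (fun n => ∫ x in b1..b2, F n x) l (𝓝 (∫ x in b1..b2, f x)) := by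
  have hsub : uIoc b1 b2 ⊆ Icc b1 b2 := by rw [uIoc_of_le hb]; exact Ioc_subset_Icc_self
  refine intervalIntegral.tendsto_integral_filter_of_dominated_convergence (fun _ => B) ?_ ?_ ?_ ?_
  · filter_upwards [hF] with n hn
    exact (hn.mono hsub).aestronglyMeasurable measurableSet_uIoc
  · filter_upwards [hB] with n hn
    exact Eventually.of_forall fun x hx => hn x (hsub hx)
  · exact intervalIntegrable_const
  · exact Eventually.of_forall fun x hx => hlim x (hsub hx)

lemma vc_fatou {F : ℝ → ℝ → ℝ} {κ : ℝ → ℝ} {b1 b2 C : ℝ} (hb : b1 ≤ b2)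
    (hκ : IntervalIntegrable κ volume b1 b2)
    (hF : ∀ᶠ h in 𝓝[>] (0:ℝ), ContinuousOn (F h) (Icc b1 b2) ∧ ∀ x ∈ Icc b1 b2, -C ≤ F h x)
    (hlim : ∀ᵐ x, x ∈ Icc b1 b2 → ∀ δ > 0, ∀ᶠ h in 𝓝[>] (0:ℝ), κ x - δ ≤ F h x)
    {δ : ℝ} (hδ : 0 < δ) :
    ∀ᶠ h in 𝓝[>] (0:ℝ), (∫ x in b1..b2, κ x) - δ ≤ ∫ x in b1..b2, F h x := by
  have hsub : uIoc b1 b2 ⊆ Icc b1 b2 := by rw [uIoc_of_le hb]; exact Ioc_subset_Icc_self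
  have hint : ∀ h, ContinuousOn (F h) (Icc b1 b2) → IntervalIntegrable (F h) volume b1 b2 := by
    intro h hh
    exact ContinuousOn.intervalIntegrable (by rwa [uIcc_of_le hb])
  have hmeas : ∀ h, ContinuousOn (F h) (Icc b1 b2) →
      AEStronglyMeasurable (fun x => min (F h x) (κ x)) (volume.restrict (uIoc b1 b2)) := by
    intro h hh
    exact ((hh.mono hsub).aestronglyMeasurable measurableSet_uIoc).inf
      (intervalIntegrable_iff.1 hκ).aestronglyMeasurable
  have hbd : ∀ h x, -C ≤ F h x → ‖min (F h x) (κ x)‖ ≤ |C| + |κ x| := by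
    intro h x hx
    rw [Real.norm_eq_abs, abs_le]
    constructor
    · apply le_min
      · linarith [le_abs_self C, abs_nonneg (κ x)]
      · linarith [neg_abs_le (κ x), abs_nonneg C]
    · exact (min_le_right _ _).trans (by linarith [le_abs_self (κ x), abs_nonneg C])
  have hbi : IntervalIntegrable (fun x => |C| + |κ x|) volume b1 b2 :=
    intervalIntegrable_const.add hκ.abs
  have ht : Tendsto (fun h => ∫ x in b1..b2, min (F h x) (κ x)) (𝓝[>] 0) (𝓝 (∫ x in b1..b2, κ x)) := by
    refine intervalIntegral.tendsto_integral_filter_of_dominated_convergence (fun x => |C| + |κ x|) ?_ ?_ hbi ?_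
    · filter_upwards [hF] with h hh
      exact hmeas h hh.1
    · filter_upwards [hF] with h hh
      exact Eventually.of_forall fun x hx => hbd h x (hh.2 x (hsub hx))
    · filter_upwards [hlim] with x hx hx2
      have hx3 := hx (hsub hx2)
      rw [tendsto_order]
      constructor
      · intro t ht
        filter_upwards [hx3 ((κ x - t) / 2) (by linarith)] with h hh
        exact lt_min (by linarith) ht
      · intro t ht
        exact Eventually.of_forall fun h => lt_of_le_of_lt (min_le_right _ _) ht
  filter_upwards [ht.eventually (lt_mem_nhds (show (∫ x in b1..b2, κ x) - δ < _ by linarith)), hF] with h h1 h2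
  refine h1.le.trans ?_
  refine intervalIntegral.integral_mono_on hb ?_ (hint h h2.1) (fun x _ => min_le_left _ _)
  rw [intervalIntegrable_iff]
  refine Integrable.mono' (intervalIntegrable_iff.1 hbi) (hmeas h h2.1) ?_
  rw [ae_restrict_iff' measurableSet_uIoc]
  exact Eventually.of_forall fun x hx => hbd h x (h2.2 x (hsub hx))

/-- the error density -/
def vcE (VE gL A K : ℝ) (y : ℝ → ℝ → ℝ) (a1 a2 d b1 b2 ε g : ℝ) : ℝ :=
  (max 0 (Jflux VE gL b1 g * vcS y a1 a2 ε b1 g - Jflux VE gL b2 g * vcS y a1 a2 ε b2 g)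
    + (4 * (gL + d) + 2 * K) * ((∫ v in b1..b2, vcS y a1 a2 (2 * ε) v g) - ∫ v in b1..b2, vcS y a1 a2 ε v g)
    + K * ∫ v in b1..b2, vcS y a1 a2 ε v g) / A

lemma VcH.S_cv (H : VcH y a1 a2 c d Λ) (hε : 0 < ε) {b1 b2 : ℝ} (h1 : a1 ≤ b1) (h2 : b2 ≤ a2)
    {g : ℝ} (hg : g ∈ Icc c d) : ContinuousOn (fun v => vcS y a1 a2 ε v g) (Icc b1 b2) :=
  (H.S_lipOn hε hg).continuousOn.mono (Icc_subset_Icc h1 h2)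

lemma VcH.S_ii (H : VcH y a1 a2 c d Λ) (hε : 0 < ε) {b1 b2 : ℝ} (h1 : a1 ≤ b1) (hb : b1 ≤ b2)
    (h2 : b2 ≤ a2)
    {g : ℝ} (hg : g ∈ Icc c d) : IntervalIntegrable (fun v => vcS y a1 a2 ε v g) volume b1 b2 :=
  ContinuousOn.intervalIntegrable (by rw [uIcc_of_le hb]; exact H.S_cv hε h1 h2 hg)

lemma VcH.abs_S_le (H : VcH y a1 a2 c d Λ) (hε : 0 < ε) {v g : ℝ} (hv : v ∈ Icc a1 a2)
    (hg : g ∈ Icc c d) : |vcS y a1 a2 ε v g| ≤ Λ := by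
  rw [abs_of_nonneg (H.S_nonneg ε hv hg)]; exact H.S_le hε v hg

lemma VcH.int_S_cont (H : VcH y a1 a2 c d Λ) (hε : 0 < ε) {b1 b2 : ℝ} (h1 : a1 ≤ b1) (hb : b1 ≤ b2)
    (h2 : b2 ≤ a2) : ContinuousOn (fun g => ∫ v in b1..b2, vcS y a1 a2 ε v g) (Icc c d) := by
  intro g0 hg0
  refine vc_dct (B := Λ) hb ?_ ?_ ?_
  · filter_upwards [self_mem_nhdsWithin] with g hg
    exact H.S_cv hε h1 h2 hg
  · filter_upwards [self_mem_nhdsWithin] with g hg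
    exact fun x hx => H.abs_S_le hε ⟨h1.trans hx.1, hx.2.trans h2⟩ hg
  · intro x hx
    exact H.S_cg ε x g0 hg0

lemma VcH.int_S_tendsto (H : VcH y a1 a2 c d Λ) {b1 b2 : ℝ} (h1 : a1 ≤ b1) (hb : b1 ≤ b2)
    (h2 : b2 ≤ a2) {g : ℝ} (hg : g ∈ Icc c d) :
    Tendsto (fun ε => ∫ v in b1..b2, vcS y a1 a2 ε v g) (𝓝[>] 0) (𝓝 (∫ v in b1..b2, y v g)) := by
  refine vc_dct (B := Λ) hb ?_ ?_ ?_
  · filter_upwards [self_mem_nhdsWithin] with ε hε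
    exact H.S_cv hε h1 h2 hg
  · filter_upwards [self_mem_nhdsWithin] with ε hε
    exact fun x hx => H.abs_S_le hε ⟨h1.trans hx.1, hx.2.trans h2⟩ hg
  · intro x hx
    exact H.S_tendsto ⟨h1.trans hx.1, hx.2.trans h2⟩ hg

lemma VcH.int_kappa (H : VcH y a1 a2 c d Λ) (hA : 0 < A) (hK : 0 ≤ K)
    (hgL : 0 ≤ gL) (hc : 0 ≤ c) (hε : 0 < ε) {b1 b2 : ℝ} (h1 : a1 ≤ b1) (hb : b1 ≤ b2)
    (h2 : b2 ≤ a2) {g : ℝ} (hg : g ∈ Icc c d) :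
    IntervalIntegrable (fun v => vcκ VE gL A K y a1 a2 ε v g) volume b1 b2 ∧
    -vcE VE gL A K y a1 a2 d b1 b2 ε g ≤ ∫ v in b1..b2, vcκ VE gL A K y a1 a2 ε v g := by
  have hac : AbsolutelyContinuousOnInterval (fun v => vcS y a1 a2 ε v g) b1 b2 := by
    refine LipschitzOnWith.absolutelyContinuousOnInterval (K := Real.toNNReal ((a2 - a1) / ε)) ?_
    rw [uIcc_of_le hb]
    exact (H.S_lipOn hε hg).mono (Icc_subset_Icc h1 h2)
  have hJd : ∀ v, HasDerivAt (fun v => Jflux VE gL v g) (-(gL + g)) v := by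
    intro v
    unfold Jflux
    have := ((hasDerivAt_id v).const_mul (-gL)).add (((hasDerivAt_id v).const_sub VE).const_mul g)
    have e : -(gL + g) = -gL * 1 + g * -1 := by ring
    rw [e]; exact this
  have hJac : AbsolutelyContinuousOnInterval (fun v => Jflux VE gL v g) b1 b2 := by
    obtain ⟨K', hK'⟩ : ∃ K', LipschitzOnWith K' (fun v => Jflux VE gL v g) (uIcc b1 b2) := by
      refine ⟨‖(gL + g)‖₊, LipschitzOnWith.of_dist_le_mul ?_⟩
      intro x _ z _
      rw [Real.dist_eq, Real.dist_eq]
      have : Jflux VE gL x g - Jflux VE gL z g = -((gL + g) * (x - z)) := by unfold Jflux; ring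
      rw [this, abs_neg, abs_mul]; simp
    exact hK'.absolutelyContinuousOnInterval
  have hS2 := H.S_ii (ε := 2 * ε) (by linarith) h1 hb h2 hg
  have hS1 := H.S_ii hε h1 hb h2 hg
  have hparts := hJac.integral_mul_deriv_eq_deriv_mul hac
  have hd' : (fun v => deriv (fun v => Jflux VE gL v g) v * vcS y a1 a2 ε v g) = fun v => -(gL + g) * vcS y a1 a2 ε v g := by
    funext v; rw [(hJd v).deriv]
  rw [hd', intervalIntegral.integral_const_mul] at hparts
  have hJi : IntervalIntegrable (fun v => Jflux VE gL v g * deriv (fun u => vcS y a1 a2 ε u g) v) volume b1 b2 :=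
    hac.intervalIntegrable_deriv.continuousOn_mul hJac.continuousOn
  have hi2 : IntervalIntegrable (fun v => (4 * (gL + g) + 2 * K) * (vcS y a1 a2 (2 * ε) v g - vcS y a1 a2 ε v g)) volume b1 b2 :=
    (hS2.sub hS1).const_mul _
  have hi3 : IntervalIntegrable (fun v => K * vcS y a1 a2 ε v g) volume b1 b2 := hS1.const_mul _
  refine ⟨((hJi.sub hi2).sub hi3).div_const A, ?_⟩
  unfold vcκ
  rw [intervalIntegral.integral_div, intervalIntegral.integral_sub (hJi.sub hi2) hi3, intervalIntegral.integral_sub hJi hi2,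
    intervalIntegral.integral_const_mul, intervalIntegral.integral_const_mul, intervalIntegral.integral_sub hS2 hS1, hparts]
  unfold vcE
  rw [← neg_div]
  refine div_le_div_of_nonneg_right ?_ hA.le
  set I2 := ∫ v in b1..b2, vcS y a1 a2 (2 * ε) v g
  set I1 := ∫ v in b1..b2, vcS y a1 a2 ε v g with hI1
  have hI10 : 0 ≤ I1 := intervalIntegral.integral_nonneg hb fun v hv =>
    H.S_nonneg ε ⟨h1.trans hv.1, hv.2.trans h2⟩ hg
  have hI12 : I1 ≤ I2 := by
    refine intervalIntegral.integral_mono_on hb hS1 hS2 fun v hv => ?_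
    obtain ⟨x, hx, he, _⟩ := H.maxi ε v hg
    have := H.S_two hε hg hx he
    have h0 : 0 ≤ (v - x) ^ 2 / (4 * ε) := by positivity
    linarith
  have hm := le_max_right 0 (Jflux VE gL b1 g * vcS y a1 a2 ε b1 g - Jflux VE gL b2 g * vcS y a1 a2 ε b2 g)
  have hgg : 0 ≤ (gL + g) * I1 := mul_nonneg (by linarith [hg.1]) hI10
  have hm2 : (4 * (gL + g) + 2 * K) * (I2 - I1) ≤ (4 * (gL + d) + 2 * K) * (I2 - I1) := by
    apply mul_le_mul_of_nonneg_right _ (by linarith)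
    linarith [hg.2]
  linarith

lemma VcH.P_schwarz (H : VcH y a1 a2 c d Λ) (hP : VcP VE gL A K y a1 a2 c d) (hA : 0 < A) (hK : 0 ≤ K)
    (hgL : 0 ≤ gL) (hc : 0 ≤ c) (hε : 0 < ε) {s : ℝ} (hs : 2 * ε * Λ < s ^ 2) (hs0 : 0 < s)
    (hb : a1 + s ≤ a2 - s) {g : ℝ} (hg : g ∈ Ioo c d) {δ : ℝ} (hδ : 0 < δ) :
    ∀ᶠ h in 𝓝[>] (0:ℝ), -(vcE VE gL A K y a1 a2 d (a1 + s) (a2 - s) ε g + δ) * h ^ 2 ≤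
      vcD2 (fun g' => ∫ v in (a1 + s)..(a2 - s), vcS y a1 a2 ε v g') g h := by
  have hg' : g ∈ Icc c d := ⟨hg.1.le, hg.2.le⟩
  obtain ⟨C, hC0, hC⟩ := H.unif hP hA hK hε hs hs0
  have h1 : a1 ≤ a1 + s := by linarith
  have h2 : a2 - s ≤ a2 := by linarith
  obtain ⟨hκi, hκ⟩ := H.int_kappa (VE := VE) hA hK hgL hc hε h1 hb h2 hg'
  have hae : ∀ᵐ x, x ∈ Icc (a1 + s) (a2 - s) → DifferentiableAt ℝ (fun u => vcS y a1 a2 ε u g) x := by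
    have hac : AbsolutelyContinuousOnInterval (fun v => vcS y a1 a2 ε v g) (a1 + s) (a2 - s) := by
      refine LipschitzOnWith.absolutelyContinuousOnInterval (K := Real.toNNReal ((a2 - a1) / ε)) ?_
      rw [uIcc_of_le hb]
      exact (H.S_lipOn hε hg').mono (Icc_subset_Icc h1 h2)
    have := hac.ae_differentiableAt
    rwa [uIcc_of_le hb] at this
  have hfat := vc_fatou (F := fun h v => vcD2 (fun g' => vcS y a1 a2 ε v g') g h / h ^ 2) (C := C) hb hκi ?_ ?_ hδ
  · filter_upwards [hfat, vc_ev_small hg] with h hh hk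
    have hpos : 0 < h := hk.1
    rw [intervalIntegral.integral_div, le_div_iff₀ (by positivity)] at hh
    have e : ∫ v in (a1 + s)..(a2 - s), vcD2 (fun g' => vcS y a1 a2 ε v g') g h
        = vcD2 (fun g' => ∫ v in (a1 + s)..(a2 - s), vcS y a1 a2 ε v g') g h := by
      have i1 := H.S_ii hε h1 hb h2 hk.2.1
      have i2 := H.S_ii hε h1 hb h2 hk.2.2
      have i3 := H.S_ii hε h1 hb h2 hg'
      simp only [vcD2]
      rw [intervalIntegral.integral_sub (i1.add i2) (i3.const_mul 2), intervalIntegral.integral_add i1 i2,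
        intervalIntegral.integral_const_mul]
    rw [e] at hh
    refine le_trans ?_ hh
    gcongr
    linarith
  · filter_upwards [vc_ev_small hg] with h hk
    have hpos : 0 < h := hk.1
    refine ⟨?_, ?_⟩
    · simp only [vcD2]
      exact (((H.S_cv hε h1 h2 hk.2.1).add (H.S_cv hε h1 h2 hk.2.2)).sub
        ((H.S_cv hε h1 h2 hg').const_mul 2)).div_const _
    · intro x hx
      rw [le_div_iff₀ (by positivity)]
      exact hC x hx g h hpos hk.2.2.1 hk.2.1.2
  · filter_upwards [hae] with x hx hx2 δ' hδ'
    filter_upwards [H.kappa hP hA hK hgL hc hε hs hs0 hx2 hg (hx hx2) hδ', self_mem_nhdsWithin] with h hh hp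
    have hpos : (0:ℝ) < h := hp
    rw [le_div_iff₀ (by positivity)]
    exact hh

end P4

section P5

variable {y : ℝ → ℝ → ℝ} {a1 a2 c d Λ ε VE gL A K : ℝ}

lemma vc_J_bound (VE gL a1 a2 c d : ℝ) : ∃ Jm, 0 ≤ Jm ∧ ∀ v ∈ Icc a1 a2, ∀ g ∈ Icc c d, |Jflux VE gL v g| ≤ Jm := by
  obtain ⟨Jm, hJm⟩ : ∃ Jm, ∀ z ∈ Icc a1 a2 ×ˢ Icc c d, ‖Jflux VE gL z.1 z.2‖ ≤ Jm := by
    apply (isCompact_Icc.prod isCompact_Icc).exists_bound_of_continuousOn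
    unfold Jflux; fun_prop
  refine ⟨|Jm|, abs_nonneg _, fun v hv g hg => ?_⟩
  have := hJm (v, g) ⟨hv, hg⟩
  rw [Real.norm_eq_abs] at this
  exact this.trans (le_abs_self _)

lemma vc_max_bound {p q B1 B2 : ℝ} (h1 : |p| ≤ B1) (h2 : |q| ≤ B2) : |max 0 (p - q)| ≤ B1 + B2 := by
  rw [abs_of_nonneg (le_max_left _ _)]
  rw [abs_le] at h1 h2
  apply max_le <;> linarith

lemma VcH.core1 (H : VcH y a1 a2 c d Λ) (hP : VcP VE gL A K y a1 a2 c d) (hA : 0 < A) (hK : 0 ≤ K)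
    (hgL : 0 ≤ gL) (hc : 0 ≤ c) {s : ℝ} (hs0 : 0 < s)
    (hb : a1 + s ≤ a2 - s) {g : ℝ} (hg : g ∈ Icc c d) :
    ∫ v in (a1 + s)..(a2 - s), y v g ≤
      max (∫ v in (a1 + s)..(a2 - s), y v c) (∫ v in (a1 + s)..(a2 - s), y v d) +
      (d - c) * ∫ t in c..d, (max 0 (Jflux VE gL (a1 + s) t * y (a1 + s) t - Jflux VE gL (a2 - s) t * y (a2 - s) t)
        + K * ∫ v in (a1 + s)..(a2 - s), y v t) / A := by
  have h1 : a1 ≤ a1 + s := by linarith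
  have h2 : a2 - s ≤ a2 := by linarith
  have hb1 : a1 + s ∈ Icc a1 a2 := ⟨by linarith, by linarith⟩
  have hb2 : a2 - s ∈ Icc a1 a2 := ⟨by linarith, by linarith⟩
  have hcm : c ∈ Icc c d := ⟨le_rfl, H.hcd.le⟩
  have hdm : d ∈ Icc c d := ⟨H.hcd.le, le_rfl⟩
  have hL0 : 0 ≤ Λ := (H.nn a1 ⟨le_rfl, H.ha.le⟩ c hcm).trans (H.up a1 ⟨le_rfl, H.ha.le⟩ c hcm)
  obtain ⟨Jm, hJ0, hJm⟩ := vc_J_bound VE gL a1 a2 c d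
  have hsm : ∀ᶠ ε in 𝓝[>] (0:ℝ), 0 < ε ∧ 2 * ε * Λ < s ^ 2 := by
    have hlim : Tendsto (fun ε : ℝ => 2 * ε * Λ) (𝓝[>] 0) (𝓝 (2 * 0 * Λ)) :=
      ((by fun_prop : Continuous fun ε : ℝ => 2 * ε * Λ).tendsto 0).mono_left nhdsWithin_le_nhds
    have hr2 : 2 * 0 * Λ < s ^ 2 := by simp; positivity
    filter_upwards [hlim.eventually (gt_mem_nhds hr2), self_mem_nhdsWithin] with ε h1 h2
    exact ⟨h2, h1⟩
  have h2ε : Tendsto (fun ε : ℝ => 2 * ε) (𝓝[>] 0) (𝓝[>] 0) := by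
    apply tendsto_nhdsWithin_of_tendsto_nhds_of_eventually_within
    · have hlim : Tendsto (fun ε : ℝ => 2 * ε) (𝓝[>] 0) (𝓝 (2 * 0)) :=
        ((by fun_prop : Continuous fun ε : ℝ => 2 * ε).tendsto 0).mono_left nhdsWithin_le_nhds
      simpa using hlim
    · filter_upwards [self_mem_nhdsWithin] with ε h2
      have : (0:ℝ) < ε := h2
      simp [this]
  have hJc : ∀ v, Continuous (fun t => Jflux VE gL v t) := by
    intro v; unfold Jflux; fun_prop
  have hecont : ∀ ε, 0 < ε → ContinuousOn (vcE VE gL A K y a1 a2 d (a1 + s) (a2 - s) ε) (Icc c d) := by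
    intro ε hε
    unfold vcE
    refine ContinuousOn.div_const ?_ A
    refine ContinuousOn.add (ContinuousOn.add ?_ ?_) ?_
    · exact continuousOn_const.sup (((hJc _).continuousOn.mul (H.S_cg ε _)).sub ((hJc _).continuousOn.mul (H.S_cg ε _)))
    · exact ((H.int_S_cont (by linarith) h1 hb h2).sub (H.int_S_cont hε h1 hb h2)).const_mul _
    · exact (H.int_S_cont hε h1 hb h2).const_mul _
  have hI12 : ∀ ε, 0 < ε → ∀ t ∈ Icc c d, ∫ v in (a1 + s)..(a2 - s), vcS y a1 a2 ε v t ≤ ∫ v in (a1 + s)..(a2 - s), vcS y a1 a2 (2 * ε) v t := by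
    intro ε hε t ht
    refine intervalIntegral.integral_mono_on hb (H.S_ii hε h1 hb h2 ht) (H.S_ii (by linarith) h1 hb h2 ht) fun v hv => ?_
    obtain ⟨x, hx, he, _⟩ := H.maxi ε v ht
    have := H.S_two hε ht hx he
    have h0 : 0 ≤ (v - x) ^ 2 / (4 * ε) := by positivity
    linarith
  have hI0 : ∀ ε, 0 < ε → ∀ t ∈ Icc c d, 0 ≤ ∫ v in (a1 + s)..(a2 - s), vcS y a1 a2 ε v t := by
    intro ε hε t ht
    exact intervalIntegral.integral_nonneg hb fun v hv =>
      H.S_nonneg ε ⟨h1.trans hv.1, hv.2.trans h2⟩ ht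
  have hIB : ∀ ε, 0 < ε → ∀ t ∈ Icc c d, ∫ v in (a1 + s)..(a2 - s), vcS y a1 a2 ε v t ≤ (a2 - s - (a1 + s)) * Λ := by
    intro ε hε t ht
    have := intervalIntegral.integral_mono_on (μ := volume) hb (H.S_ii hε h1 hb h2 ht) (intervalIntegrable_const (c := Λ)) fun v hv =>
      H.S_le hε v ht
    simpa using this
  have hC1 : 0 ≤ 4 * (gL + d) + 2 * K := by linarith [H.hcd]
  have he0 : ∀ ε, 0 < ε → ∀ t ∈ Icc c d, 0 ≤ vcE VE gL A K y a1 a2 d (a1 + s) (a2 - s) ε t := by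
    intro ε hε t ht
    unfold vcE
    refine div_nonneg (add_nonneg (add_nonneg (le_max_left _ _) ?_) ?_) hA.le
    · exact mul_nonneg hC1 (by linarith [hI12 ε hε t ht])
    · exact mul_nonneg hK (hI0 ε hε t ht)
  have hineq : ∀ᶠ ε in 𝓝[>] (0:ℝ), ∫ v in (a1 + s)..(a2 - s), vcS y a1 a2 ε v g ≤
      max (∫ v in (a1 + s)..(a2 - s), vcS y a1 a2 ε v c) (∫ v in (a1 + s)..(a2 - s), vcS y a1 a2 ε v d) +
      (d - c) * ∫ t in c..d, vcE VE gL A K y a1 a2 d (a1 + s) (a2 - s) ε t := by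
    filter_upwards [hsm] with ε hε
    refine vc_L1' (f := fun g => ∫ v in (a1 + s)..(a2 - s), vcS y a1 a2 ε v g) H.hcd (H.int_S_cont hε.1 h1 hb h2) (hecont ε hε.1) (he0 ε hε.1) ?_ g hg
    intro x hx δ hδ
    exact (H.P_schwarz hP hA hK hgL hc hε.1 hε.2 hs0 hb hx hδ).frequently
  have hT : ∀ t ∈ Icc c d, Tendsto (fun ε => vcE VE gL A K y a1 a2 d (a1 + s) (a2 - s) ε t) (𝓝[>] 0)
      (𝓝 ((max 0 (Jflux VE gL (a1 + s) t * y (a1 + s) t - Jflux VE gL (a2 - s) t * y (a2 - s) t)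
        + K * ∫ v in (a1 + s)..(a2 - s), y v t) / A)) := by
    intro t ht
    have i1 := H.int_S_tendsto h1 hb h2 ht
    have i2 := i1.comp h2ε
    have m1 := ((H.S_tendsto hb1 ht).const_mul (Jflux VE gL (a1 + s) t)).sub ((H.S_tendsto hb2 ht).const_mul (Jflux VE gL (a2 - s) t))
    have m2 := (tendsto_const_nhds (x := (0:ℝ))).max m1
    have := ((m2.add ((i2.sub i1).const_mul (4 * (gL + d) + 2 * K))).add (i1.const_mul K)).div_const A
    simp only [sub_self, mul_zero, add_zero] at this
    exact this
  have hIT : Tendsto (fun ε => ∫ t in c..d, vcE VE gL A K y a1 a2 d (a1 + s) (a2 - s) ε t) (𝓝[>] 0)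
      (𝓝 (∫ t in c..d, (max 0 (Jflux VE gL (a1 + s) t * y (a1 + s) t - Jflux VE gL (a2 - s) t * y (a2 - s) t)
        + K * ∫ v in (a1 + s)..(a2 - s), y v t) / A)) := by
    refine vc_dct (B := (Jm * Λ + Jm * Λ + (4 * (gL + d) + 2 * K) * ((a2 - s - (a1 + s)) * Λ) + K * ((a2 - s - (a1 + s)) * Λ)) / A)
      H.hcd.le ?_ ?_ hT
    · filter_upwards [hsm] with ε hε
      exact hecont ε hε.1
    · filter_upwards [hsm] with ε hε t ht
      rw [abs_of_nonneg (he0 ε hε.1 t ht)]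
      unfold vcE
      refine div_le_div_of_nonneg_right ?_ hA.le
      have q1 := hIB ε hε.1 t ht
      have q2 := hIB (2 * ε) (by linarith [hε.1]) t ht
      have q3 := hI0 ε hε.1 t ht
      refine add_le_add (add_le_add ?_ ?_) (mul_le_mul_of_nonneg_left q1 hK)
      · have : ∀ v ∈ Icc a1 a2, |Jflux VE gL v t * vcS y a1 a2 ε v t| ≤ Jm * Λ := by
          intro v hv
          rw [abs_mul]
          exact mul_le_mul (hJm v hv t ht) (H.abs_S_le hε.1 hv ht) (abs_nonneg _) hJ0
        exact (le_abs_self _).trans (vc_max_bound (this _ hb1) (this _ hb2))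
      · exact mul_le_mul_of_nonneg_left (by linarith) hC1
  exact le_of_tendsto_of_tendsto (H.int_S_tendsto h1 hb h2 hg)
    (((H.int_S_tendsto h1 hb h2 hcm).max (H.int_S_tendsto h1 hb h2 hdm)).add (hIT.const_mul (d - c))) hineq

lemma vc_core {v1 v2 m : ℝ} (hv : v1 < v2) (hcd : c < d) (hA : 0 < A) (hK : 0 ≤ K)
    (hgL : 0 ≤ gL) (hc : 0 ≤ c)
    (nn : ∀ v ∈ Icc v1 v2, ∀ g ∈ Icc c d, 0 ≤ y v g)
    (up : ∀ v ∈ Icc v1 v2, ∀ g ∈ Icc c d, y v g ≤ Λ)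
    (cv : ∀ g ∈ Icc c d, ContinuousOn (fun v => y v g) (Icc v1 v2))
    (cg : ∀ v ∈ Ioo v1 v2, ContinuousOn (fun g => y v g) (Icc c d))
    (usc : ∀ v ∈ Ioo v1 v2, ∀ g ∈ Icc c d, ∀ t > y v g, ∀ᶠ z in 𝓝 (v, g), y z.1 z.2 < t)
    (hP : VcP VE gL A K y v1 v2 c d)
    (bd : ∀ g ∈ Icc c d, Jflux VE gL v1 g * y v1 g ≤ Jflux VE gL v2 g * y v2 g)
    (hm : ∀ g ∈ Icc c d, ∫ v in v1..v2, y v g ≤ m) {g : ℝ} (hg : g ∈ Icc c d) :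
    ∫ v in v1..v2, y v g ≤ max (∫ v in v1..v2, y v c) (∫ v in v1..v2, y v d)
      + K * m / A * (d - c) ^ 2 := by
  have hcm : c ∈ Icc c d := ⟨le_rfl, hcd.le⟩
  have hdm : d ∈ Icc c d := ⟨hcd.le, le_rfl⟩
  have hL0 : 0 ≤ Λ := (nn v1 ⟨le_rfl, hv.le⟩ c hcm).trans (up v1 ⟨le_rfl, hv.le⟩ c hcm)
  obtain ⟨Jm, hJ0, hJm⟩ := vc_J_bound VE gL v1 v2 c d
  have hJc : ∀ v, Continuous (fun t => Jflux VE gL v t) := by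
    intro v; unfold Jflux; fun_prop
  have hJc' : ∀ t, Continuous (fun v => Jflux VE gL v t) := by
    intro v; unfold Jflux; fun_prop
  set R : ℝ → ℝ → ℝ := fun s t => max 0 (Jflux VE gL (v1 + s) t * y (v1 + s) t - Jflux VE gL (v2 - s) t * y (v2 - s) t) with hR
  have hsm : ∀ᶠ s in 𝓝[>] (0:ℝ), 0 < s ∧ s < (v2 - v1) / 2 := by
    have := Ioo_mem_nhdsGT (show (0:ℝ) < (v2 - v1) / 2 by linarith)
    filter_upwards [this] with s hs using hs
  have hii : ∀ t ∈ Icc c d, ∀ x z, v1 ≤ x → x ≤ z → z ≤ v2 → IntervalIntegrable (fun v => y v t) volume x z := by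
    intro t ht x z h1 h2 h3
    apply ContinuousOn.intervalIntegrable
    rw [uIcc_of_le h2]
    exact (cv t ht).mono (Icc_subset_Icc h1 h3)
  have hdiff : ∀ t ∈ Icc c d, ∀ s, 0 < s → s < (v2 - v1) / 2 →
      ∫ v in (v1 + s)..(v2 - s), y v t ≤ ∫ v in v1..v2, y v t ∧
      ∫ v in v1..v2, y v t ≤ (∫ v in (v1 + s)..(v2 - s), y v t) + 2 * s * Λ := by
    intro t ht s h0 h1
    have i1 := hii t ht v1 (v1 + s) le_rfl (by linarith) (by linarith)
    have i2 := hii t ht (v1 + s) (v2 - s) (by linarith) (by linarith) (by linarith)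
    have i3 := hii t ht (v2 - s) v2 (by linarith) (by linarith) le_rfl
    have e1 := intervalIntegral.integral_add_adjacent_intervals i1 i2
    have e2 := intervalIntegral.integral_add_adjacent_intervals (i1.trans i2) i3
    have p1 : 0 ≤ ∫ v in v1..(v1 + s), y v t := intervalIntegral.integral_nonneg (by linarith) fun v hv =>
      nn v ⟨hv.1, by linarith [hv.2]⟩ t ht
    have p3 : 0 ≤ ∫ v in (v2 - s)..v2, y v t := intervalIntegral.integral_nonneg (by linarith) fun v hv =>
      nn v ⟨by linarith [hv.1], hv.2⟩ t ht
    have q1 : ∫ v in v1..(v1 + s), y v t ≤ s * Λ := by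
      have := intervalIntegral.integral_mono_on (μ := volume) (by linarith) i1 (intervalIntegrable_const (c := Λ)) fun v hv =>
        up v ⟨hv.1, by linarith [hv.2]⟩ t ht
      simpa using this
    have q3 : ∫ v in (v2 - s)..v2, y v t ≤ s * Λ := by
      have := intervalIntegral.integral_mono_on (μ := volume) (by linarith) i3 (intervalIntegrable_const (c := Λ)) fun v hv =>
        up v ⟨by linarith [hv.1], hv.2⟩ t ht
      simpa using this
    constructor <;> linarith
  have hRc : ∀ s, 0 < s → s < (v2 - v1) / 2 → ContinuousOn (R s) (Icc c d) := by
    intro s h0 h1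
    have c1 := cg (v1 + s) ⟨by linarith, by linarith⟩
    have c2 := cg (v2 - s) ⟨by linarith, by linarith⟩
    exact continuousOn_const.sup (((hJc _).continuousOn.mul c1).sub ((hJc _).continuousOn.mul c2))
  have hRi : ∀ s, 0 < s → s < (v2 - v1) / 2 → IntervalIntegrable (R s) volume c d := by
    intro s h0 h1
    apply ContinuousOn.intervalIntegrable
    rw [uIcc_of_le hcd.le]
    exact hRc s h0 h1
  have hRlim : Tendsto (fun s => ∫ t in c..d, R s t) (𝓝[>] 0) (𝓝 (∫ t in c..d, (0:ℝ))) := by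
    refine vc_dct (B := Jm * Λ + Jm * Λ) hcd.le ?_ ?_ ?_
    · filter_upwards [hsm] with s hs using hRc s hs.1 hs.2
    · filter_upwards [hsm] with s hs t ht
      have : ∀ v ∈ Icc v1 v2, |Jflux VE gL v t * y v t| ≤ Jm * Λ := by
        intro v hv
        rw [abs_mul, abs_of_nonneg (nn v hv t ht)]
        exact mul_le_mul (hJm v hv t ht) (up v hv t ht) (nn v hv t ht) hJ0
      exact vc_max_bound (this _ ⟨by linarith, by linarith⟩) (this _ ⟨by linarith, by linarith⟩)
    · intro t ht
      have cJ : ContinuousOn (fun v => Jflux VE gL v t * y v t) (Icc v1 v2) := (hJc' t).continuousOn.mul (cv t ht)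
      have t1 : Tendsto (fun s => v1 + s) (𝓝[>] (0:ℝ)) (𝓝[Icc v1 v2] v1) := by
        apply tendsto_nhdsWithin_of_tendsto_nhds_of_eventually_within
        · have : Tendsto (fun s : ℝ => v1 + s) (𝓝[>] 0) (𝓝 (v1 + 0)) :=
            ((by fun_prop : Continuous fun s : ℝ => v1 + s).tendsto 0).mono_left nhdsWithin_le_nhds
          simpa using this
        · filter_upwards [hsm] with s hs
          exact ⟨by linarith, by linarith⟩
      have t2 : Tendsto (fun s => v2 - s) (𝓝[>] (0:ℝ)) (𝓝[Icc v1 v2] v2) := by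
        apply tendsto_nhdsWithin_of_tendsto_nhds_of_eventually_within
        · have : Tendsto (fun s : ℝ => v2 - s) (𝓝[>] 0) (𝓝 (v2 - 0)) :=
            ((by fun_prop : Continuous fun s : ℝ => v2 - s).tendsto 0).mono_left nhdsWithin_le_nhds
          simpa using this
        · filter_upwards [hsm] with s hs
          exact ⟨by linarith, by linarith⟩
      have l1 := (cJ v1 ⟨le_rfl, hv.le⟩).tendsto.comp t1
      have l2 := (cJ v2 ⟨hv.le, le_rfl⟩).tendsto.comp t2
      have := (tendsto_const_nhds (x := (0:ℝ))).max (l1.sub l2)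
      have e : max 0 (Jflux VE gL v1 t * y v1 t - Jflux VE gL v2 t * y v2 t) = 0 :=
        max_eq_left (by linarith [bd t ht])
      rw [e] at this
      exact this
  have hineq : ∀ᶠ s in 𝓝[>] (0:ℝ), ∫ v in v1..v2, y v g ≤
      max (∫ v in v1..v2, y v c) (∫ v in v1..v2, y v d) + (d - c) * (((∫ t in c..d, R s t) + (d - c) * (K * m)) / A) + 2 * s * Λ := by
    filter_upwards [hsm] with s hs
    obtain ⟨hs0, hs1⟩ := hs
    have H : VcH y (v1 + s / 2) (v2 - s / 2) c d Λ :=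
      { ha := by linarith
        hcd := hcd
        nn := fun v hv => nn v ⟨by linarith [hv.1], by linarith [hv.2]⟩
        up := fun v hv => up v ⟨by linarith [hv.1], by linarith [hv.2]⟩
        cv := fun g hg => (cv g hg).mono (Icc_subset_Icc (by linarith) (by linarith))
        cg := fun v hv => cg v ⟨by linarith [hv.1], by linarith [hv.2]⟩
        usc := fun v hv g hg t ht => by
          filter_upwards [usc v ⟨by linarith [hv.1], by linarith [hv.2]⟩ g hg t ht] with z hz _ _ using hz }
    have hP' : VcP VE gL A K y (v1 + s / 2) (v2 - s / 2) c d := fun v hv =>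
      hP v ⟨by linarith [hv.1], by linarith [hv.2]⟩
    have key := H.core1 hP' hA hK hgL hc (s := s / 2) (by linarith) (by linarith) hg
    have e1 : v1 + s / 2 + s / 2 = v1 + s := by ring
    have e2 : v2 - s / 2 - s / 2 = v2 - s := by ring
    rw [e1, e2] at key
    have k1 : ∫ t in c..d, (R s t + K * ∫ v in (v1 + s)..(v2 - s), y v t) / A ≤ ((∫ t in c..d, R s t) + (d - c) * (K * m)) / A := by
      have hcI : ContinuousOn (fun t => ∫ v in (v1 + s)..(v2 - s), y v t) (Icc c d) := by
        intro g0 hg0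
        refine vc_dct (B := Λ) (by linarith) ?_ ?_ ?_
        · filter_upwards [self_mem_nhdsWithin] with g hg
          exact (cv g hg).mono (Icc_subset_Icc (by linarith) (by linarith))
        · filter_upwards [self_mem_nhdsWithin] with g hg x hx
          have hx' : x ∈ Icc v1 v2 := ⟨by linarith [hx.1], by linarith [hx.2]⟩
          rw [abs_of_nonneg (nn x hx' g hg)]
          exact up x hx' g hg
        · intro x hx
          exact cg x ⟨by linarith [hx.1], by linarith [hx.2]⟩ g0 hg0
      have hcIi : IntervalIntegrable (fun t => ∫ v in (v1 + s)..(v2 - s), y v t) volume c d := by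
        apply ContinuousOn.intervalIntegrable
        rw [uIcc_of_le hcd.le]; exact hcI
      rw [intervalIntegral.integral_div]
      refine div_le_div_of_nonneg_right ?_ hA.le
      rw [intervalIntegral.integral_add (hRi s hs0 hs1) (hcIi.const_mul K)]
      have : ∫ t in c..d, K * ∫ v in (v1 + s)..(v2 - s), y v t ≤ ∫ t in c..d, K * m := by
        refine intervalIntegral.integral_mono_on hcd.le (hcIi.const_mul K) intervalIntegrable_const fun t ht => ?_
        exact mul_le_mul_of_nonneg_left ((hdiff t ht s hs0 hs1).1.trans (hm t ht)) hK
      rw [intervalIntegral.integral_const, smul_eq_mul] at this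
      linarith
    have k2 := mul_le_mul_of_nonneg_left k1 (show 0 ≤ d - c by linarith)
    have k3 := max_le_max (hdiff c hcm s hs0 hs1).1 (hdiff d hdm s hs0 hs1).1
    have k4 := (hdiff g hg s hs0 hs1).2
    linarith
  have hl1 : Tendsto (fun s : ℝ => 2 * s * Λ) (𝓝[>] 0) (𝓝 (2 * 0 * Λ)) :=
    ((by fun_prop : Continuous fun s : ℝ => 2 * s * Λ).tendsto 0).mono_left nhdsWithin_le_nhds
  have hfin := ge_of_tendsto (((((hRlim.add_const ((d - c) * (K * m))).div_const A).const_mul (d - c)).const_add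
    (max (∫ v in v1..v2, y v c) (∫ v in v1..v2, y v d))).add hl1) hineq
  refine hfin.trans (le_of_eq ?_)
  simp
  ring

end P5

lemma vc_ae_Ioo {v1 v2 : ℝ} (hv : v1 ≤ v2) : ∀ᵐ v, v ∈ uIoc v1 v2 → v ∈ Ioo v1 v2 := by
  rw [uIoc_of_le hv]
  have : ∀ᵐ v : ℝ, v ≠ v2 := by simp [ae_iff, measure_singleton]
  filter_upwards [this] with v h1 h2
  exact ⟨h2.1, lt_of_le_of_ne h2.2 h1⟩

lemma vc_dct' {ι : Type*} {l : Filter ι} [l.IsCountablyGenerated] {F : ι → ℝ → ℝ} {f : ℝ → ℝ}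
    {b1 b2 B : ℝ} (hb : b1 ≤ b2)
    (hF : ∀ᶠ n in l, ContinuousOn (F n) (Icc b1 b2))
    (hB : ∀ᶠ n in l, ∀ x ∈ Icc b1 b2, |F n x| ≤ B)
    (hlim : ∀ x ∈ Ioo b1 b2, Tendsto (fun n => F n x) l (𝓝 (f x))) :
    Tendsto (fun n => ∫ x in b1..b2, F n x) l (𝓝 (∫ x in b1..b2, f x)) := by
  have hsub : uIoc b1 b2 ⊆ Icc b1 b2 := by rw [uIoc_of_le hb]; exact Ioc_subset_Icc_self
  refine intervalIntegral.tendsto_integral_filter_of_dominated_convergence (fun _ => B) ?_ ?_ ?_ ?_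
  · filter_upwards [hF] with n hn
    exact (hn.mono hsub).aestronglyMeasurable measurableSet_uIoc
  · filter_upwards [hB] with n hn
    exact Eventually.of_forall fun x hx => hn x (hsub hx)
  · exact intervalIntegrable_const
  · filter_upwards [vc_ae_Ioo hb] with x h1 h2
    exact hlim x (h1 h2)

lemma vc_lemS {VE gL A K v1 v2 g1 g2 : ℝ} {w b : ℝ → ℝ → ℝ} {N : ℝ → ℝ}
    (hv : v1 < v2) (hA : 0 < A) (hK : 0 ≤ K) (hgL : 0 ≤ gL) (hg1 : 0 ≤ g1)
    (hsmall : K / A * (g2 - g1) ^ 2 ≤ 1 / 2)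
    (cv : ∀ g ∈ Ioo g1 g2, ContinuousOn (fun v => w v g) (Icc v1 v2))
    (cg : ∀ v ∈ Ioo v1 v2, ContinuousOn (fun g => w v g) (Icc g1 g2))
    (usc : ∀ v ∈ Ioo v1 v2, ∀ g ∈ Ioo g1 g2, ∀ t > w v g, ∀ᶠ z in 𝓝 (v, g), w z.1 z.2 < t)
    (pde : ∀ v ∈ Ioo v1 v2, ∀ g ∈ Ioo g1 g2, ∃ dv dgg : ℝ,
      HasDerivAt (fun v' => w v' g) dv v ∧
      Tendsto (fun h => vcD2 (w v) g h / h ^ 2) (𝓝[>] (0:ℝ)) (𝓝 dgg) ∧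
      Jflux VE gL v g * dv - K * w v g ≤ A * dgg)
    (bc : Continuous (fun z : ℝ × ℝ => b z.1 z.2))
    (bpde : ∀ v ∈ Ioo v1 v2, ∀ g ∈ Ioo g1 g2, ∃ dv dgg : ℝ,
      HasDerivAt (fun v' => b v' g) dv v ∧
      Tendsto (fun h => vcD2 (b v) g h / h ^ 2) (𝓝[>] (0:ℝ)) (𝓝 dgg) ∧
      A * dgg ≤ Jflux VE gL v g * dv - K * b v g)
    (edge : ∀ v ∈ Ioo v1 v2, w v g1 ≤ b v g1 ∧ w v g2 ≤ b v g2)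
    (bd : ∀ g ∈ Ioo g1 g2, Jflux VE gL v1 g * max (w v1 g - b v1 g) 0
      ≤ Jflux VE gL v2 g * max (w v2 g - b v2 g) 0)
    (locb : ∀ c d, g1 < c → d < g2 → ∃ Λ, ∀ v ∈ Icc v1 v2, ∀ g ∈ Icc c d, w v g ≤ Λ)
    (hNi : IntervalIntegrable N volume v1 v2)
    (hN : ∀ᵐ v, v ∈ Ioo v1 v2 → ∀ g ∈ Icc g1 g2, w v g - b v g ≤ N v) :
    ∀ v ∈ Icc v1 v2, ∀ g ∈ Ioo g1 g2, w v g ≤ b v g := by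
  set y : ℝ → ℝ → ℝ := fun v g => max (w v g - b v g) 0 with hy
  have bcv : ∀ g, Continuous (fun v => b v g) := fun g =>
    bc.comp (by fun_prop : Continuous fun v : ℝ => (v, g))
  have bcg : ∀ v, Continuous (fun g => b v g) := fun v =>
    bc.comp (by fun_prop : Continuous fun g : ℝ => (v, g))
  have ycv : ∀ g ∈ Ioo g1 g2, ContinuousOn (fun v => y v g) (Icc v1 v2) := fun g hg =>
    ((cv g hg).sub (bcv g).continuousOn).sup continuousOn_const
  have ycg : ∀ v ∈ Ioo v1 v2, ContinuousOn (fun g => y v g) (Icc g1 g2) := fun v hv =>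
    ((cg v hv).sub (bcg v).continuousOn).sup continuousOn_const
  have ynn : ∀ v g, 0 ≤ y v g := fun v g => le_max_right _ _
  have yusc : ∀ v ∈ Ioo v1 v2, ∀ g ∈ Ioo g1 g2, ∀ t > y v g, ∀ᶠ z in 𝓝 (v, g), y z.1 z.2 < t := by
    intro v hv g hg t ht
    have h1 : w v g - b v g < t := lt_of_le_of_lt (le_max_left _ _) ht
    have h0 : 0 < t := lt_of_le_of_lt (le_max_right _ _) ht
    obtain ⟨t1, ht1, ht2⟩ : ∃ t1, w v g < t1 ∧ t1 < t + b v g := exists_between (by linarith)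
    have e2 : ∀ᶠ z : ℝ × ℝ in 𝓝 (v, g), t1 < t + b z.1 z.2 :=
      ((bc.const_add t).tendsto (v, g)).eventually (lt_mem_nhds ht2)
    filter_upwards [usc v hv g hg t1 ht1, e2] with z z1 z2
    exact max_lt (by linarith) h0
  have yP : ∀ c d, g1 < c → d < g2 → VcP VE gL A K y v1 v2 c d := by
    intro c d hc hd v hvv g hg hpos
    have hg' : g ∈ Ioo g1 g2 := ⟨hc.trans hg.1, hg.2.trans hd⟩
    obtain ⟨wv, wgg, h1, h2, h3⟩ := pde v hvv g hg'
    obtain ⟨bv, bgg, k1, k2, k3⟩ := bpde v hvv g hg'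
    have hp : 0 < w v g - b v g := by
      by_contra hcon
      have : y v g = 0 := max_eq_right (by linarith)
      linarith
    have hyv : y v g = w v g - b v g := max_eq_left hp.le
    refine ⟨wv - bv, wgg - bgg, ?_, ?_, ?_⟩
    · refine (h1.sub k1).congr_of_eventuallyEq ?_
      have : ContinuousAt (fun v' => w v' g - b v' g) v := (h1.sub k1).continuousAt
      filter_upwards [this.eventually (lt_mem_nhds hp)] with v' hv'
      exact max_eq_left hv'.le
    · have hcont : ContinuousAt (fun g' => w v g' - b v g') g :=
        ((cg v hvv).continuousAt (Icc_mem_nhds hg'.1 hg'.2)).sub (bcg v).continuousAt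
      have hev := hcont.eventually (lt_mem_nhds hp)
      have tp : Tendsto (fun h : ℝ => g + h) (𝓝[>] 0) (𝓝 g) := by
        have : Tendsto (fun h : ℝ => g + h) (𝓝 0) (𝓝 (g + 0)) := (by fun_prop : Continuous fun h : ℝ => g + h).tendsto 0
        rw [add_zero] at this
        exact this.mono_left nhdsWithin_le_nhds
      have tm : Tendsto (fun h : ℝ => g - h) (𝓝[>] 0) (𝓝 g) := by
        have : Tendsto (fun h : ℝ => g - h) (𝓝 0) (𝓝 (g - 0)) := (by fun_prop : Continuous fun h : ℝ => g - h).tendsto 0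
        rw [sub_zero] at this
        exact this.mono_left nhdsWithin_le_nhds
      refine (h2.sub k2).congr' ?_
      filter_upwards [tp.eventually hev, tm.eventually hev] with h hh1 hh2
      have q1 : y v (g + h) = w v (g + h) - b v (g + h) := max_eq_left hh1.le
      have q2 : y v (g - h) = w v (g - h) - b v (g - h) := max_eq_left hh2.le
      simp only [vcD2, q1, q2, hyv]
      ring
    · rw [hyv]; nlinarith
  set P : ℝ → ℝ := fun g => ∫ v in v1..v2, y v g with hPdef
  have hP0 : ∀ g, 0 ≤ P g := fun g => intervalIntegral.integral_nonneg hv.le fun v _ => ynn v g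
  have two : ∀ c d, g1 < c → c < d → d < g2 → ∀ g ∈ Icc c d, P g ≤ 2 * max (P c) (P d) := by
    intro c d hc hcd hd
    have hsub : ∀ g ∈ Icc c d, g ∈ Ioo g1 g2 := fun g hg => ⟨lt_of_lt_of_le hc hg.1, lt_of_le_of_lt hg.2 hd⟩
    obtain ⟨Λ, hΛ⟩ := locb c d hc hd
    obtain ⟨B, hB⟩ : ∃ B, ∀ z ∈ Icc v1 v2 ×ˢ Icc c d, ‖b z.1 z.2‖ ≤ B :=
      (isCompact_Icc.prod isCompact_Icc).exists_bound_of_continuousOn bc.continuousOn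
    have yup : ∀ v ∈ Icc v1 v2, ∀ g ∈ Icc c d, y v g ≤ max (Λ + B) 0 := by
      intro v hv g hg
      have h1 := hΛ v hv g hg
      have h2 := hB (v, g) ⟨hv, hg⟩
      rw [Real.norm_eq_abs] at h2
      have h3 := (abs_le.1 h2).1
      exact max_le_max (by linarith) le_rfl
    have Pc : ContinuousOn P (Icc c d) := by
      intro g0 hg0
      refine vc_dct' (B := max (Λ + B) 0) hv.le ?_ ?_ ?_
      · filter_upwards [self_mem_nhdsWithin] with g hg using ycv g (hsub g hg)
      · filter_upwards [self_mem_nhdsWithin] with g hg x hx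
        rw [abs_of_nonneg (ynn x g)]
        exact yup x hx g hg
      · intro x hx
        exact ((ycg x hx).mono (Icc_subset_Icc hc.le hd.le)) g0 hg0
    obtain ⟨gs, hgs, hmax⟩ := isCompact_Icc.exists_isMaxOn (nonempty_Icc.2 hcd.le) Pc
    have key := vc_core (m := P gs) hv hcd hA hK hgL (by linarith) (fun v _ g _ => ynn v g) yup
      (fun g hg => ycv g (hsub g hg)) (fun v hv => (ycg v hv).mono (Icc_subset_Icc hc.le hd.le))
      (fun v hv g hg => yusc v hv g (hsub g hg)) (yP c d hc hd) (fun g hg => bd g (hsub g hg))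
      (fun g hg => hmax hg) hgs
    have h1 : K * P gs / A * (d - c) ^ 2 ≤ P gs / 2 := by
      have : (d - c) ^ 2 ≤ (g2 - g1) ^ 2 := by
        apply pow_le_pow_left₀ <;> linarith
      have h2 : K / A * (d - c) ^ 2 ≤ 1 / 2 := (mul_le_mul_of_nonneg_left this (by positivity)).trans hsmall
      have h3 := mul_le_mul_of_nonneg_left h2 (hP0 gs)
      have e : K * P gs / A * (d - c) ^ 2 = P gs * (K / A * (d - c) ^ 2) := by ring
      rw [e]; linarith
    intro g hg
    have := hmax hg
    simp only [mem_ofPred_eq] at this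
    change P gs ≤ max (P c) (P d) + _ at key
    linarith
  have hae := vc_ae_Ioo hv.le
  have lim : ∀ (g0 : ℝ) (hg0 : g0 ∈ Icc g1 g2) (h0 : ∀ v ∈ Ioo v1 v2, w v g0 ≤ b v g0),
      Tendsto P (𝓝[Ioo g1 g2] g0) (𝓝 0) := by
    intro g0 hg0 h0
    have : Tendsto P (𝓝[Ioo g1 g2] g0) (𝓝 (∫ v in v1..v2, (0:ℝ))) := by
      refine intervalIntegral.tendsto_integral_filter_of_dominated_convergence (fun v => |N v|) ?_ ?_ hNi.abs ?_
      · filter_upwards [self_mem_nhdsWithin] with g hg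
        refine ((ycv g hg).mono ?_).aestronglyMeasurable measurableSet_uIoc
        rw [uIoc_of_le hv.le]; exact Ioc_subset_Icc_self
      · filter_upwards [self_mem_nhdsWithin] with g hg
        filter_upwards [hN, hae] with v h1 h2 h3
        rw [Real.norm_eq_abs, abs_of_nonneg (ynn v g)]
        exact max_le ((h1 (h2 h3) g ⟨hg.1.le, hg.2.le⟩).trans (le_abs_self _)) (abs_nonneg _)
      · filter_upwards [hae] with v h2 h3
        have := (ycg v (h2 h3) g0 hg0).tendsto
        have e : y v g0 = 0 := max_eq_right (by linarith [h0 v (h2 h3)])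
        rw [e] at this
        exact this.mono_left (nhdsWithin_mono _ Ioo_subset_Icc_self)
    simpa using this
  intro v hvv g hg
  have hPg : P g = 0 := by
    refine le_antisymm ?_ (hP0 g)
    refine le_of_forall_pos_le_add fun η hη => ?_
    have hg12 : g1 < g2 := hg.1.trans hg.2
    have l1 := lim g1 ⟨le_rfl, hg12.le⟩ (fun v hv => (edge v hv).1)
    have l2 := lim g2 ⟨hg12.le, le_rfl⟩ (fun v hv => (edge v hv).2)
    rw [nhdsWithin_Ioo_eq_nhdsGT hg12] at l1
    rw [nhdsWithin_Ioo_eq_nhdsLT hg12] at l2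
    obtain ⟨c, hc1, hc2⟩ := ((l1.eventually (gt_mem_nhds (show (0:ℝ) < η / 2 by linarith))).and (Ioo_mem_nhdsGT hg.1)).exists
    obtain ⟨d, hd1, hd2⟩ := ((l2.eventually (gt_mem_nhds (show (0:ℝ) < η / 2 by linarith))).and (Ioo_mem_nhdsLT hg.2)).exists
    have := two c d hc2.1 (hc2.2.trans hd2.1) hd2.2 g ⟨hc2.2.le, hd2.1.le⟩
    have h3 : max (P c) (P d) ≤ η / 2 := max_le hc1.le hd1.le
    linarith
  by_contra hcon
  push Not at hcon
  have : 0 < P g := intervalIntegral.integral_pos hv (ycv g hg) (fun v _ => ynn v g)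
    ⟨v, hvv, lt_of_lt_of_le (by linarith : 0 < w v g - b v g) (le_max_left _ _)⟩
  linarith

lemma vc_gap {S : Set ℝ} (hS : IsClosed S) {x a0 b0 : ℝ} (hx : x ∉ S) (ha : a0 ∈ S) (hax : a0 ≤ x)
    (hb : b0 ∈ S) (hxb : x ≤ b0) :
    ∃ a ∈ S, ∃ b ∈ S, a < x ∧ x < b ∧ a0 ≤ a ∧ b ≤ b0 ∧ ∀ z ∈ Ioo a b, z ∉ S := by
  have c1 : IsCompact (S ∩ Icc a0 x) := isCompact_Icc.inter_left hS
  have c2 : IsCompact (S ∩ Icc x b0) := isCompact_Icc.inter_left hS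
  have m1 := c1.sSup_mem ⟨a0, ha, le_rfl, hax⟩
  have m2 := c2.sInf_mem ⟨b0, hb, hxb, le_rfl⟩
  set a := sSup (S ∩ Icc a0 x) with hadef
  set b := sInf (S ∩ Icc x b0) with hbdef
  refine ⟨a, m1.1, b, m2.1, lt_of_le_of_ne m1.2.2 ?_, lt_of_le_of_ne m2.2.1 ?_, m1.2.1, m2.2.2, ?_⟩
  · intro h; rw [h] at m1; exact hx m1.1
  · intro h; rw [← h] at m2; exact hx m2.1
  · intro z hz hzS
    rcases le_total z x with h | h
    · have := le_csSup c1.bddAbove ⟨hzS, (m1.2.1.trans hz.1.le), h⟩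
      linarith [hz.1]
    · have := csInf_le c2.bddBelow ⟨hzS, h, (hz.2.le.trans m2.2.2)⟩
      linarith [hz.2]

lemma vc_baire {X : Type*} [TopologicalSpace X] [T2Space X] [LocallyCompactSpace X] {S : Set X}
    (hS : IsLocallyClosed S) (hne : S.Nonempty) (E : ℕ → Set X) (hE : S ⊆ ⋃ n, E n) :
    ∃ n, ∃ U : Set X, IsOpen U ∧ (S ∩ U).Nonempty ∧ S ∩ U ⊆ closure (E n) := by
  have : LocallyCompactSpace S := hS.locallyCompactSpace
  have : Nonempty S := hne.to_subtype
  obtain ⟨n, hn⟩ := nonempty_interior_of_iUnion_of_closed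
    (f := fun n => ((↑) : S → X) ⁻¹' closure (E n)) (fun n => isClosed_closure.preimage continuous_subtype_val) (by
      rw [eq_univ_iff_forall]
      intro x
      obtain ⟨n, hn⟩ := mem_iUnion.1 (hE x.2)
      exact mem_iUnion.2 ⟨n, subset_closure hn⟩)
  obtain ⟨U, hU, hUe⟩ := isOpen_induced_iff.1 (isOpen_interior (s := ((↑) : S → X) ⁻¹' closure (E n)))
  obtain ⟨x, hx⟩ := hn
  refine ⟨n, U, hU, ⟨x, x.2, ?_⟩, ?_⟩
  · rw [← hUe] at hx; exact hx
  · rintro z ⟨hz, hzU⟩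
    have : (⟨z, hz⟩ : S) ∈ interior (((↑) : S → X) ⁻¹' closure (E n)) := by rw [← hUe]; exact hzU
    exact (interior_subset this : (⟨z, hz⟩ : S) ∈ ((↑) : S → X) ⁻¹' closure (E n))

section P8

structure VcW (VF VE gL A K G : ℝ) (w : ℝ → ℝ → ℝ) : Prop where
  hVF : 0 < VF
  hA : 0 < A
  hK : 0 < K
  hgL : 0 ≤ gL
  nn : ∀ v ∈ Icc 0 VF, ∀ g, 0 ≤ g → 0 ≤ w v g
  cv : ∀ g, 0 ≤ g → ContinuousOn (fun v => w v g) (Icc 0 VF)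
  c1 : ∀ v ∈ Ioo 0 VF, ContDiffOn ℝ 1 (fun g => w v g) (Ici 0)
  pde : ∀ v ∈ Ioo 0 VF, ∀ g ∈ Ioo 0 G, ∃ dv dgg : ℝ,
      HasDerivAt (fun v' => w v' g) dv v ∧
      Tendsto (fun h => vcD2 (w v) g h / h ^ 2) (𝓝[>] (0:ℝ)) (𝓝 dgg) ∧
      Jflux VE gL v g * dv - K * w v g ≤ A * dgg

/-- upper semicontinuity at a point -/
def VcU (w : ℝ → ℝ → ℝ) (z : ℝ × ℝ) : Prop := ∀ t > w z.1 z.2, ∀ᶠ z' in 𝓝 z, w z'.1 z'.2 < t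

variable {VF VE gL A K G : ℝ} {w : ℝ → ℝ → ℝ}

def vcB (c1 L v0 g0 ρ r v g : ℝ) : ℝ :=
  c1 + L * ((v - v0) ^ 2 / ρ ^ 2 + 2 * |g - g0| / r - (g - g0) ^ 2 / r ^ 2)

lemma vcB_ge {c1 L v0 g0 ρ r v g : ℝ} (hL : 0 ≤ L) (hr : 0 < r) (hg : |g - g0| ≤ r) :
    c1 + L * ((v - v0) ^ 2 / ρ ^ 2) ≤ vcB c1 L v0 g0 ρ r v g ∧
    c1 + L * (|g - g0| / r) ≤ vcB c1 L v0 g0 ρ r v g := by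
  have h1 : (g - g0) ^ 2 / r ^ 2 = (|g - g0| / r) ^ 2 := by rw [div_pow, sq_abs]
  have h2 : |g - g0| / r ≤ 1 := by rw [div_le_one hr]; exact hg
  have h3 : 0 ≤ |g - g0| / r := by positivity
  have h4 : 0 ≤ (v - v0) ^ 2 / ρ ^ 2 := by positivity
  have h5 : 2 * |g - g0| / r = 2 * (|g - g0| / r) := by ring
  unfold vcB
  rw [h1, h5]
  set x := |g - g0| / r
  constructor
  · gcongr; nlinarith
  · gcongr; nlinarith

lemma vc_box (W : VcW VF VE gL A K G w) {L c1 v0 g0 ρ r Jm : ℝ} {X Y : Set ℝ}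
    (hX : IsClosed X) (hY : IsClosed Y) (hg0 : g0 ∈ Y) (hρ : 0 < ρ) (hr : 0 < r)
    (hin1 : Icc (v0 - ρ) (v0 + ρ) ⊆ Ioo 0 VF) (hin2 : Icc (g0 - r) (g0 + r) ⊆ Ioo 0 G)
    (hw : ∀ v ∈ Icc (v0 - ρ) (v0 + ρ), ∀ g ∈ Icc (g0 - r) (g0 + r), w v g ≤ L)
    (hc0 : 0 ≤ c1) (hc1 : c1 ≤ L)
    (hXw : ∀ v ∈ Icc (v0 - ρ) (v0 + ρ), ∀ g ∈ Icc (g0 - r) (g0 + r), v ∈ X ∨ g ∈ Y → w v g ≤ c1)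
    (husc : ∀ v ∈ Icc (v0 - ρ) (v0 + ρ), ∀ g ∈ Icc (g0 - r) (g0 + r), v ∉ X → g ∉ Y → VcU w (v, g))
    (hJm : ∀ v ∈ Icc (v0 - ρ) (v0 + ρ), ∀ g ∈ Icc (g0 - r) (g0 + r), |Jflux VE gL v g| ≤ Jm)
    (hr1 : 2 * Jm / ρ + 3 * K ≤ 2 * A / r ^ 2) (hr2 : K / A * (2 * r) ^ 2 ≤ 1 / 2) :
    ∀ v ∈ Icc (v0 - ρ) (v0 + ρ), ∀ g ∈ Icc (g0 - r) (g0 + r), w v g ≤ vcB c1 L v0 g0 ρ r v g := by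
  have hL : 0 ≤ L := hc0.trans hc1
  have habs : ∀ g ∈ Icc (g0 - r) (g0 + r), |g - g0| ≤ r := fun g hg => by
    rw [abs_le]; constructor <;> linarith [hg.1, hg.2]
  have hb1 : ∀ v, ∀ g ∈ Icc (g0 - r) (g0 + r), c1 ≤ vcB c1 L v0 g0 ρ r v g := fun v g hg => by
    refine le_trans ?_ (vcB_ge hL hr (habs g hg)).1
    have : 0 ≤ L * ((v - v0) ^ 2 / ρ ^ 2) := by positivity
    linarith
  set S := X ∪ {v0 - ρ, v0 + ρ} with hS
  set T := Y ∪ {g0 - r, g0 + r} with hT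
  have hSc : IsClosed S := hX.union (Set.toFinite _).isClosed
  have hTc : IsClosed T := hY.union (Set.toFinite _).isClosed
  have good : ∀ v ∈ Icc (v0 - ρ) (v0 + ρ), ∀ g ∈ Icc (g0 - r) (g0 + r), v ∈ S ∨ g ∈ T →
      w v g ≤ vcB c1 L v0 g0 ρ r v g := by
    intro v hv g hg h
    have hvb : v = v0 - ρ ∨ v = v0 + ρ → w v g ≤ vcB c1 L v0 g0 ρ r v g := by
      intro h
      have e : (v - v0) ^ 2 = ρ ^ 2 := by rcases h with h | h <;> rw [h] <;> ring
      have := (vcB_ge (c1 := c1) (v0 := v0) (ρ := ρ) (v := v) hL hr (habs g hg)).1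
      rw [e, div_self (by positivity)] at this
      linarith [hw v hv g hg]
    have hgb : g = g0 - r ∨ g = g0 + r → w v g ≤ vcB c1 L v0 g0 ρ r v g := by
      intro h
      have e : |g - g0| = r := by
        rcases h with h | h <;> rw [h] <;> simp [abs_of_pos hr]
      have := (vcB_ge (c1 := c1) (v0 := v0) (ρ := ρ) (v := v) hL hr (habs g hg)).2
      rw [e, div_self (by positivity)] at this
      linarith [hw v hv g hg]
    rcases h with h | h
    · rcases h with h | h
      · exact (hXw v hv g hg (Or.inl h)).trans (hb1 v g hg)
      · exact hvb h
    · rcases h with h | h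
      · exact (hXw v hv g hg (Or.inr h)).trans (hb1 v g hg)
      · exact hgb h
  intro v hv g hg
  by_cases hvS : v ∈ S
  · exact good v hv g hg (Or.inl hvS)
  by_cases hgT : g ∈ T
  · exact good v hv g hg (Or.inr hgT)
  obtain ⟨va, hva, vb, hvb, hav, hvb', hva0, hvb0, hvgap⟩ := vc_gap hSc hvS (a0 := v0 - ρ) (b0 := v0 + ρ)
    (by simp [hS]) hv.1 (by simp [hS]) hv.2
  obtain ⟨ga, hga, gb, hgb, hag, hgb', hga0, hgb0, hggap⟩ := vc_gap hTc hgT (a0 := g0 - r) (b0 := g0 + r)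
    (by simp [hT]) hg.1 (by simp [hT]) hg.2
  have subv : ∀ x ∈ Icc va vb, x ∈ Icc (v0 - ρ) (v0 + ρ) := fun x hx => ⟨hva0.trans hx.1, hx.2.trans hvb0⟩
  have subg : ∀ x ∈ Icc ga gb, x ∈ Icc (g0 - r) (g0 + r) := fun x hx => ⟨hga0.trans hx.1, hx.2.trans hgb0⟩
  have subv' : ∀ x ∈ Ioo va vb, x ∈ Icc (v0 - ρ) (v0 + ρ) := fun x hx => subv x ⟨hx.1.le, hx.2.le⟩
  have subg' : ∀ x ∈ Ioo ga gb, x ∈ Icc (g0 - r) (g0 + r) := fun x hx => subg x ⟨hx.1.le, hx.2.le⟩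
  have hvab : va < vb := hav.trans hvb'
  have hgab : ga < gb := hag.trans hgb'
  have hbc : Continuous (fun z : ℝ × ℝ => vcB c1 L v0 g0 ρ r z.1 z.2) := by
    unfold vcB; fun_prop
  refine vc_lemS (VE := VE) (gL := gL) (A := A) (K := K) (N := fun _ => L) hvab W.hA W.hK.le W.hgL (hin2 (subg ga ⟨le_rfl, hgab.le⟩)).1.le ?_ ?_ ?_ ?_ ?_ hbc ?_ ?_ ?_ ?_ ?_ ?_ v ⟨hav.le, hvb'.le⟩ g ⟨hag, hgb'⟩
  · refine le_trans ?_ hr2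
    have h1 : (gb - ga) ^ 2 ≤ (2 * r) ^ 2 := by
      apply pow_le_pow_left₀ <;> linarith
    exact mul_le_mul_of_nonneg_left h1 (div_nonneg W.hK.le W.hA.le)
  · intro g hg
    refine (W.cv g (hin2 (subg' g hg)).1.le).mono ?_
    intro x hx
    have := hin1 (subv x hx)
    exact ⟨this.1.le, this.2.le⟩
  · intro v hv
    refine (W.c1 v (hin1 (subv' v hv))).continuousOn.mono ?_
    intro x hx
    exact (hin2 (subg x hx)).1.le
  · intro v hv g hg
    refine husc v (subv' v hv) g (subg' g hg) ?_ ?_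
    · intro h; exact hvgap v hv (Or.inl h)
    · intro h; exact hggap g hg (Or.inl h)
  · intro v hv g hg
    exact W.pde v (hin1 (subv' v hv)) g (hin2 (subg' g hg))
  · intro v hv g hg
    have hgne : g ≠ g0 := by
      intro h; exact hggap g hg (Or.inl (h ▸ hg0))
    refine ⟨L * (2 * (v - v0) / ρ ^ 2), L * (-2 / r ^ 2), ?_, ?_, ?_⟩
    · unfold vcB
      have h1 : HasDerivAt (fun v' : ℝ => (v' - v0) ^ 2) (2 * (v - v0)) v := by
        simpa using ((hasDerivAt_id v).sub_const v0).fun_pow 2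
      exact ((((h1.div_const (ρ ^ 2)).add_const _).sub_const _).const_mul L).const_add c1
    · refine tendsto_const_nhds.congr' ?_
      have hex : ∃ θ : ℝ, ∀ᶠ x in 𝓝 g, |x - g0| = θ * (x - g0) := by
        rcases lt_or_gt_of_ne hgne with h | h
        · refine ⟨-1, ?_⟩
          filter_upwards [gt_mem_nhds h] with x hx
          rw [abs_of_neg (by linarith)]; ring
        · refine ⟨1, ?_⟩
          filter_upwards [lt_mem_nhds h] with x hx
          rw [abs_of_pos (by linarith)]; ring
      obtain ⟨θ, hθ⟩ := hex
      have tp : Tendsto (fun h : ℝ => g + h) (𝓝[>] 0) (𝓝 g) := by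
        have : Tendsto (fun h : ℝ => g + h) (𝓝 0) (𝓝 (g + 0)) := (by fun_prop : Continuous fun h : ℝ => g + h).tendsto 0
        rw [add_zero] at this
        exact this.mono_left nhdsWithin_le_nhds
      have tm : Tendsto (fun h : ℝ => g - h) (𝓝[>] 0) (𝓝 g) := by
        have : Tendsto (fun h : ℝ => g - h) (𝓝 0) (𝓝 (g - 0)) := (by fun_prop : Continuous fun h : ℝ => g - h).tendsto 0
        rw [sub_zero] at this
        exact this.mono_left nhdsWithin_le_nhds
      filter_upwards [tp.eventually hθ, tm.eventually hθ, self_mem_nhdsWithin] with h h1 h2 h3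
      have h3' : (0:ℝ) < h := h3
      simp only [vcD2, vcB, h1, h2, hθ.self_of_nhds]
      field_simp
      ring
    · have hvv := subv' v hv
      have hgg := subg' g hg
      have hJ := hJm v hvv g hgg
      have hd : |L * (2 * (v - v0) / ρ ^ 2)| ≤ L * (2 / ρ) := by
        rw [abs_mul, abs_of_nonneg hL]
        gcongr
        rw [abs_div, abs_of_pos (show (0:ℝ) < ρ ^ 2 by positivity), abs_mul, abs_two]
        have : |v - v0| ≤ ρ := by rw [abs_le]; constructor <;> linarith [hvv.1, hvv.2]
        rw [div_le_div_iff₀ (by positivity) (by positivity)]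
        nlinarith
      have hJ0 : 0 ≤ Jm := (abs_nonneg _).trans hJ
      have hJd : |Jflux VE gL v g * (L * (2 * (v - v0) / ρ ^ 2))| ≤ Jm * (L * (2 / ρ)) := by
        rw [abs_mul]
        exact mul_le_mul hJ hd (abs_nonneg _) hJ0
      have hJd' := (abs_le.1 hJd).1
      have hbu : vcB c1 L v0 g0 ρ r v g ≤ 3 * L := by
        unfold vcB
        have u1 : (v - v0) ^ 2 / ρ ^ 2 ≤ 1 := by
          rw [div_le_one (by positivity)]
          apply sq_le_sq'  <;> linarith [hvv.1, hvv.2]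
        have e1 : (g - g0) ^ 2 / r ^ 2 = (|g - g0| / r) ^ 2 := by rw [div_pow, sq_abs]
        have e2 : 2 * |g - g0| / r = 2 * (|g - g0| / r) := by ring
        rw [e1, e2]
        set x := |g - g0| / r
        have : L * ((v - v0) ^ 2 / ρ ^ 2 + 2 * x - x ^ 2) ≤ L * 2 := by
          gcongr; nlinarith [sq_nonneg (x - 1)]
        linarith
      have h1 := mul_le_mul_of_nonneg_left hbu W.hK.le
      have h2 := mul_le_mul_of_nonneg_left hr1 hL
      have e : A * (L * (-2 / r ^ 2)) = - (L * (2 * A / r ^ 2)) := by ring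
      have e2 : L * (2 * Jm / ρ + 3 * K) = Jm * (L * (2 / ρ)) + K * (3 * L) := by ring
      rw [e]
      linarith
  · intro v hv
    exact ⟨good v (subv' v hv) ga (subg ga ⟨le_rfl, hgab.le⟩) (Or.inr hga),
      good v (subv' v hv) gb (subg gb ⟨hgab.le, le_rfl⟩) (Or.inr hgb)⟩
  · intro g hg
    have h1 := good va (subv va ⟨le_rfl, hvab.le⟩) g (subg' g hg) (Or.inl hva)
    have h2 := good vb (subv vb ⟨hvab.le, le_rfl⟩) g (subg' g hg) (Or.inl hvb)
    rw [max_eq_right (by linarith), max_eq_right (by linarith)]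
    simp
  · intro c d hc hd
    refine ⟨L, fun v hv g hg => hw v (subv v hv) g (subg g ⟨hc.le.trans hg.1, hg.2.trans hd.le⟩)⟩
  · exact intervalIntegrable_const
  · refine Eventually.of_forall fun v hv g hg => ?_
    have := hw v (subv' v hv) g (subg g hg)
    have := hb1 v g (subg g hg)
    linarith

end P8

section P9

variable {VF VE gL A K G : ℝ} {w : ℝ → ℝ → ℝ}

/-- the set of Lipschitz-controlled points -/
def vcLE (VF c d : ℝ) (w : ℝ → ℝ → ℝ) (k : ℕ) : Set (ℝ × ℝ) :=
  {z | z.1 ∈ Ioo 0 VF ∧ z.2 ∈ Ioo c d ∧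
    (∀ g ∈ Icc c d, ∀ g' ∈ Icc c d, w z.1 g ≤ w z.1 g' + k * |g - g'|) ∧
    ∀ v' ∈ Icc 0 VF, w v' z.2 ≤ w z.1 z.2 + k * |v' - z.1|}

lemma vcLE_cover (W : VcW VF VE gL A K G w) {c d Λ : ℝ} (hc : 0 < c) (hdG : d < G)
    (hΛ : ∀ v ∈ Icc 0 VF, ∀ g ∈ Icc c d, w v g ≤ Λ) {z : ℝ × ℝ} (hz : z.1 ∈ Ioo 0 VF) (hz2 : z.2 ∈ Ioo c d) :
    ∃ k, z ∈ vcLE VF c d w k := by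
  have hcd : c < d := hz2.1.trans hz2.2
  obtain ⟨C, hC⟩ := ((W.c1 z.1 hz).mono (fun x (hx : x ∈ Icc c d) => hc.le.trans hx.1)).exists_lipschitzOnWith
    (by norm_num) (convex_Icc c d) isCompact_Icc
  obtain ⟨dv, _, hdv, _⟩ := W.pde z.1 hz z.2 ⟨hc.trans hz2.1, hz2.2.trans hdG⟩
  have hO := hdv.isBigO_sub
  obtain ⟨D, hD⟩ := hO.bound
  obtain ⟨r, hr, hball⟩ := Metric.eventually_nhds_iff.1 hD
  have hL0 : 0 ≤ Λ := (W.nn z.1 ⟨hz.1.le, hz.2.le⟩ z.2 (hc.trans hz2.1).le).trans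
    (hΛ z.1 ⟨hz.1.le, hz.2.le⟩ z.2 ⟨hz2.1.le, hz2.2.le⟩)
  obtain ⟨k, hk⟩ := exists_nat_ge (max (C:ℝ) (max D (Λ / r)))
  have hk1 : (C:ℝ) ≤ k := (le_max_left _ _).trans hk
  have hk2 : D ≤ k := ((le_max_left _ _).trans (le_max_right _ _)).trans hk
  have hk3 : Λ / r ≤ k := ((le_max_right _ _).trans (le_max_right _ _)).trans hk
  refine ⟨k, hz, hz2, ?_, ?_⟩
  · intro g hg g' hg'
    have h := hC.dist_le_mul g hg g' hg'
    rw [Real.dist_eq, Real.dist_eq] at h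
    have h1 := (abs_le.1 h).2
    have h2 : (C:ℝ) * |g - g'| ≤ k * |g - g'| := by gcongr
    linarith
  · intro v' hv'
    by_cases hlt : dist v' z.1 < r
    · have h := hball hlt
      rw [Real.norm_eq_abs, Real.norm_eq_abs] at h
      have h1 := (le_abs_self _).trans h
      have h2 : D * |v' - z.1| ≤ k * |v' - z.1| := by gcongr
      linarith
    · push Not at hlt
      rw [Real.dist_eq] at hlt
      have h1 : Λ / r * r ≤ k * |v' - z.1| := by gcongr
      rw [div_mul_cancel₀ _ hr.ne'] at h1
      have := hΛ v' hv' z.2 ⟨hz2.1.le, hz2.2.le⟩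
      have := W.nn z.1 ⟨hz.1.le, hz.2.le⟩ z.2 (hc.trans hz2.1).le
      linarith

lemma vcLE_closure (W : VcW VF VE gL A K G w) {c d : ℝ} (hc : 0 < c) {k : ℕ} {z : ℝ × ℝ}
    (hz : z.1 ∈ Ioo 0 VF) (hz2 : z.2 ∈ Ioo c d) (hcl : z ∈ closure (vcLE VF c d w k)) :
    (∀ g ∈ Icc c d, ∀ g' ∈ Icc c d, w z.1 g ≤ w z.1 g' + k * |g - g'|) ∧
    ∀ v' ∈ Ioo 0 VF, w v' z.2 ≤ w z.1 z.2 + k * |v' - z.1| := by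
  obtain ⟨x, hxE, hxz⟩ := mem_closure_iff_seq_limit.1 hcl
  have t1 : Tendsto (fun n => (x n).1) atTop (𝓝 z.1) := (continuous_fst.tendsto z).comp hxz
  have t2 : Tendsto (fun n => (x n).2) atTop (𝓝 z.2) := (continuous_snd.tendsto z).comp hxz
  have cvt : ∀ g ∈ Icc c d, Tendsto (fun n => w (x n).1 g) atTop (𝓝 (w z.1 g)) := by
    intro g hg
    have := ((W.cv g (hc.le.trans hg.1)).continuousAt (Icc_mem_nhds hz.1 hz.2)).tendsto
    exact this.comp t1
  refine ⟨?_, ?_⟩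
  · intro g hg g' hg'
    exact le_of_tendsto_of_tendsto' (cvt g hg) ((cvt g' hg').add_const _) (fun n => (hxE n).2.2.1 g hg g' hg')
  · intro v' hv'
    have hzz : z.2 ∈ Icc c d := ⟨hz2.1.le, hz2.2.le⟩
    have l1 : Tendsto (fun n => w v' (x n).2) atTop (𝓝 (w v' z.2)) := by
      have := ((W.c1 v' hv').continuousOn.continuousAt (Ici_mem_nhds (hc.trans hz2.1))).tendsto
      exact this.comp t2
    have l2 : Tendsto (fun n => w (x n).1 z.2 + k * |(x n).2 - z.2| + k * |v' - (x n).1|) atTop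
        (𝓝 (w z.1 z.2 + k * |z.2 - z.2| + k * |v' - z.1|)) := by
      refine ((cvt z.2 hzz).add ?_).add ?_
      · exact ((t2.sub_const _).abs).const_mul _
      · exact ((t1.const_sub _).abs).const_mul _
    have := le_of_tendsto_of_tendsto' l1 l2 (fun n => by
      have h1 := (hxE n).2.2.2 v' ⟨hv'.1.le, hv'.2.le⟩
      have h2 := (hxE n).2.2.1 (x n).2 ⟨(hxE n).2.1.1.le, (hxE n).2.1.2.le⟩ z.2 hzz
      linarith)
    simpa using this

lemma vc_usc (W : VcW VF VE gL A K G w) {c d Λ : ℝ} (hc : 0 < c) (hdG : d < G)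
    (hΛ : ∀ v ∈ Icc 0 VF, ∀ g ∈ Icc c d, w v g ≤ Λ) :
    ∀ z ∈ Ioo 0 VF ×ˢ Ioo c d, VcU w z := by
  set Q : Set (ℝ × ℝ) := Ioo 0 VF ×ˢ Ioo c d with hQ
  have hQo : IsOpen Q := isOpen_Ioo.prod isOpen_Ioo
  set O : Set (ℝ × ℝ) := {z | ∀ᶠ z' in 𝓝 z, VcU w z'} with hO
  have hOo : IsOpen O := isOpen_setOfPred_eventually_nhds
  set Z := Q ∩ Oᶜ with hZ
  have hOU : ∀ z ∈ O, VcU w z := fun z hz => Filter.Eventually.self_of_nhds hz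
  by_cases hne : Z.Nonempty
  swap
  · intro z hz
    by_contra hcon
    exact hne ⟨z, hz, fun h => hcon (hOU z h)⟩
  exfalso
  have hZl : IsLocallyClosed Z := ⟨Q, Oᶜ, hQo, hOo.isClosed_compl, rfl⟩
  obtain ⟨k, U, hU, ⟨z0, hz0Z, hz0U⟩, hsub⟩ := vc_baire hZl hne (vcLE VF c d w) (by
    intro z hz
    obtain ⟨k, hk⟩ := vcLE_cover W hc hdG hΛ hz.1.1 hz.1.2
    exact mem_iUnion.2 ⟨k, hk⟩)
  have hcl : ∀ z ∈ Z ∩ U, (∀ g ∈ Icc c d, ∀ g' ∈ Icc c d, w z.1 g ≤ w z.1 g' + k * |g - g'|) ∧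
    ∀ v' ∈ Ioo 0 VF, w v' z.2 ≤ w z.1 z.2 + k * |v' - z.1| := fun z hz =>
      vcLE_closure W hc hz.1.1.1 hz.1.1.2 (hsub hz)
  have key : ∀ z ∈ Q ∩ U, VcU w z := by
    rintro ⟨v0, g0⟩ ⟨hzQ, hzU⟩
    by_cases hzO : (v0, g0) ∈ O
    · exact hOU _ hzO
    have hzZ : (v0, g0) ∈ Z := ⟨hzQ, hzO⟩
    intro t ht
    change w v0 g0 < t at ht
    obtain ⟨η, hη, hball⟩ := Metric.isOpen_iff.1 (hQo.inter hU) (v0, g0) ⟨hzQ, hzU⟩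
    have hk0 : (0:ℝ) ≤ k := Nat.cast_nonneg k
    obtain ⟨ρ, hρ, hρη, hρt⟩ : ∃ ρ > 0, ρ < η ∧ k * (4 * ρ) < t - w v0 g0 := by
      refine ⟨min (η / 2) ((t - w v0 g0) / (4 * k + 1) / 2), ?_, ?_, ?_⟩
      · have : 0 < t - w v0 g0 := by linarith
        positivity
      · exact lt_of_le_of_lt (min_le_left _ _) (by linarith)
      · have h0 : 0 < t - w v0 g0 := by linarith
        set T := t - w v0 g0
        have h1 : k * (4 * min (η / 2) (T / (4 * k + 1) / 2)) ≤ k * (4 * (T / (4 * k + 1) / 2)) := by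
          gcongr; exact min_le_right _ _
        refine lt_of_le_of_lt h1 ?_
        have : k * (4 * (T / (4 * k + 1) / 2)) = T * ((2 * k) / (4 * k + 1)) := by
          field_simp; ring
        rw [this]
        have h2 : (2 * k) / (4 * k + 1) < (1:ℝ) := by
          rw [div_lt_one (by positivity)]; linarith
        nlinarith
    obtain ⟨Jm, hJ0, hJm⟩ := vc_J_bound VE gL (v0 - ρ) (v0 + ρ) (g0 - ρ) (g0 + ρ)
    obtain ⟨r, hr, hrρ, hr1, hr2⟩ : ∃ r > 0, r ≤ ρ ∧ 2 * Jm / ρ + 3 * K ≤ 2 * A / r ^ 2 ∧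
        K / A * (2 * r) ^ 2 ≤ 1 / 2 := by
      have hA := W.hA
      have hK := W.hK
      have T1 : Tendsto (fun r : ℝ => (2 * Jm / ρ + 3 * K) * r ^ 2) (𝓝[>] 0) (𝓝 0) := by
        have : Tendsto (fun r : ℝ => (2 * Jm / ρ + 3 * K) * r ^ 2) (𝓝 0) (𝓝 ((2 * Jm / ρ + 3 * K) * 0 ^ 2)) :=
          (by fun_prop : Continuous fun r : ℝ => (2 * Jm / ρ + 3 * K) * r ^ 2).tendsto 0
        simpa using this.mono_left nhdsWithin_le_nhds
      have T2 : Tendsto (fun r : ℝ => K / A * (2 * r) ^ 2) (𝓝[>] 0) (𝓝 0) := by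
        have : Tendsto (fun r : ℝ => K / A * (2 * r) ^ 2) (𝓝 0) (𝓝 (K / A * (2 * 0) ^ 2)) :=
          (by fun_prop : Continuous fun r : ℝ => K / A * (2 * r) ^ 2).tendsto 0
        simpa using this.mono_left nhdsWithin_le_nhds
      have e3 : ∀ᶠ r : ℝ in 𝓝[>] 0, r ≤ ρ := nhdsWithin_le_nhds (Iic_mem_nhds hρ)
      obtain ⟨r, h1, h2, h3, h4⟩ := ((T1.eventually (Iic_mem_nhds (show (0:ℝ) < 2 * A by positivity))).and
        ((T2.eventually (Iic_mem_nhds (show (0:ℝ) < 1 / 2 by norm_num))).and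
          (e3.and self_mem_nhdsWithin))).exists
      refine ⟨r, h4, h3, ?_, h2⟩
      have h4' : 0 < r := h4
      rw [le_div_iff₀ (by positivity)]
      exact h1
    have hbox : ∀ v ∈ Icc (v0 - ρ) (v0 + ρ), ∀ g ∈ Icc (g0 - r) (g0 + r), (v, g) ∈ Q ∩ U := by
      intro v hv g hg
      apply hball
      rw [Metric.mem_ball, Prod.dist_eq, max_lt_iff]
      simp only [Real.dist_eq, abs_lt]
      refine ⟨⟨?_, ?_⟩, ?_, ?_⟩ <;> linarith [hv.1, hv.2, hg.1, hg.2]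
    have hv0 : v0 ∈ Icc (v0 - ρ) (v0 + ρ) := ⟨by linarith, by linarith⟩
    have hg0 : g0 ∈ Icc (g0 - r) (g0 + r) := ⟨by linarith, by linarith⟩
    set B : Set (ℝ × ℝ) := Icc (v0 - ρ) (v0 + ρ) ×ˢ Icc (g0 - r) (g0 + r) with hB
    have hBc : IsCompact B := isCompact_Icc.prod isCompact_Icc
    have hBO : IsCompact (B ∩ Oᶜ) := hBc.inter_right hOo.isClosed_compl
    have hBZ : ∀ z ∈ B ∩ Oᶜ, z ∈ Z ∩ U := fun z hz => by
      have := hbox z.1 hz.1.1 z.2 hz.1.2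
      exact ⟨⟨this.1, hz.2⟩, this.2⟩
    set c1 := w v0 g0 + k * (3 * ρ + r) with hc1
    have hw0 : 0 ≤ w v0 g0 := W.nn v0 ⟨hzQ.1.1.le, hzQ.1.2.le⟩ g0 (hc.trans hzQ.2.1).le
    have hc10 : 0 ≤ c1 := by positivity
    have hc1t : c1 < t := by
      have : k * (3 * ρ + r) ≤ k * (4 * ρ) := by gcongr; linarith
      linarith
    have inv : ∀ v ∈ Icc (v0 - ρ) (v0 + ρ), v ∈ Ioo 0 VF := fun v hv => (hbox v hv g0 hg0).1.1
    have ing : ∀ g ∈ Icc (g0 - r) (g0 + r), g ∈ Ioo c d := fun g hg => (hbox v0 hv0 g hg).1.2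
    have ing' : ∀ g ∈ Icc (g0 - r) (g0 + r), g ∈ Icc c d := fun g hg => ⟨(ing g hg).1.le, (ing g hg).2.le⟩
    have absv : ∀ v ∈ Icc (v0 - ρ) (v0 + ρ), |v - v0| ≤ ρ := fun v hv => by
      rw [abs_le]; constructor <;> linarith [hv.1, hv.2]
    have absg : ∀ g ∈ Icc (g0 - r) (g0 + r), |g - g0| ≤ r := fun g hg => by
      rw [abs_le]; constructor <;> linarith [hg.1, hg.2]
    have hz1 := hcl (v0, g0) ⟨hzZ, hzU⟩
    have stepX : ∀ z ∈ B ∩ Oᶜ, ∀ g ∈ Icc (g0 - r) (g0 + r), w z.1 g ≤ w v0 g0 + k * ρ + k * r := by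
      intro z hz g hg
      have h1 := (hcl z (hBZ z hz)).1 g (ing' g hg) g0 (ing' g0 hg0)
      have h2 := hz1.2 z.1 (inv z.1 hz.1.1)
      have h3 : k * |g - g0| ≤ k * r := by gcongr; exact absg g hg
      have h4 : k * |z.1 - v0| ≤ k * ρ := by gcongr; exact absv z.1 hz.1.1
      simp only at h2
      linarith
    have stepY : ∀ z ∈ B ∩ Oᶜ, ∀ v ∈ Icc (v0 - ρ) (v0 + ρ), w v z.2 ≤ c1 := by
      intro z hz v hv
      have h1 := (hcl z (hBZ z hz)).2 v (inv v hv)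
      have h2 := stepX z hz z.2 hz.1.2
      have h3 : k * |v - z.1| ≤ k * (2 * ρ) := by
        gcongr
        rw [abs_le]; constructor <;> linarith [hv.1, hv.2, hz.1.1.1, hz.1.1.2]
      linarith
    have main := vc_box W (L := max Λ c1) (c1 := c1) (v0 := v0) (g0 := g0) (ρ := ρ) (r := r) (Jm := Jm)
      (X := Prod.fst '' (B ∩ Oᶜ)) (Y := Prod.snd '' (B ∩ Oᶜ))
      (hBO.image continuous_fst).isClosed (hBO.image continuous_snd).isClosed
      ⟨(v0, g0), ⟨⟨hv0, hg0⟩, hzO⟩, rfl⟩ hρ hr inv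
      (fun g hg => ⟨hc.trans (ing g hg).1, (ing g hg).2.trans hdG⟩)
      (fun v hv g hg => (hΛ v ⟨(inv v hv).1.le, (inv v hv).2.le⟩ g (ing' g hg)).trans (le_max_left _ _))
      hc10 (le_max_right _ _)
      (by
        rintro v hv g hg (⟨z, hz, rfl⟩ | ⟨z, hz, rfl⟩)
        · have := stepX z hz g hg
          have : 0 ≤ k * ρ := by positivity
          linarith
        · exact stepY z hz v hv)
      (by
        intro v hv g hg hvX _
        refine hOU _ ?_
        by_contra hcon
        exact hvX ⟨(v, g), ⟨⟨hv, hg⟩, hcon⟩, rfl⟩)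
      (fun v hv g hg => hJm v hv g ⟨by linarith [hg.1], by linarith [hg.2]⟩)
      hr1 hr2
    have hbc : Continuous (fun z : ℝ × ℝ => vcB c1 (max Λ c1) v0 g0 ρ r z.1 z.2) := by
      unfold vcB; fun_prop
    have hb0 : vcB c1 (max Λ c1) v0 g0 ρ r v0 g0 < t := by
      unfold vcB; simpa using hc1t
    have ev1 : ∀ᶠ z in 𝓝 (v0, g0), vcB c1 (max Λ c1) v0 g0 ρ r z.1 z.2 < t :=
      (hbc.tendsto (v0, g0)).eventually (gt_mem_nhds hb0)
    have ev2 : B ∈ 𝓝 (v0, g0) := prod_mem_nhds (Icc_mem_nhds (by linarith) (by linarith))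
      (Icc_mem_nhds (by linarith) (by linarith))
    filter_upwards [ev1, ev2] with z h1 h2
    exact lt_of_le_of_lt (main z.1 h2.1 z.2 h2.2) h1
  refine hz0Z.2 ?_
  filter_upwards [(hQo.inter hU).mem_nhds ⟨hz0Z.1, hz0U⟩] with z hz
  exact key z hz

end P9

section P10

variable {VF VE gL A K G : ℝ} {w : ℝ → ℝ → ℝ}

/-- local boundedness, uniformly in the voltage -/
def vcO (VF : ℝ) (w : ℝ → ℝ → ℝ) : Set ℝ :=
  {g | ∀ᶠ g' in 𝓝 g, ∃ Λ : ℝ, ∀ᶠ g'' in 𝓝 g', ∀ v ∈ Icc 0 VF, w v g'' ≤ Λ}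

lemma vcO_mem {g Λ : ℝ} (h : ∀ᶠ g'' in 𝓝 g, ∀ v ∈ Icc 0 VF, w v g'' ≤ Λ) : g ∈ vcO VF w := by
  have := eventually_eventually_nhds.2 h
  exact this.mono fun x hx => ⟨Λ, hx⟩

lemma vcO_compact {c d : ℝ} (h : Icc c d ⊆ vcO VF w) :
    ∃ Λ : ℝ, ∀ v ∈ Icc 0 VF, ∀ g ∈ Icc c d, w v g ≤ Λ := by
  have := isCompact_Icc (a := c) (b := d) |>.induction_on
    (p := fun s => ∃ Λ : ℝ, ∀ v ∈ Icc 0 VF, ∀ g ∈ s, w v g ≤ Λ) ⟨0, by simp⟩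
    (fun s t hst ⟨Λ, h⟩ => ⟨Λ, fun v hv g hg => h v hv g (hst hg)⟩)
    (fun s t ⟨Λ, h⟩ ⟨Λ', h'⟩ => ⟨max Λ Λ', fun v hv g hg => by
      rcases hg with hg | hg
      · exact (h v hv g hg).trans (le_max_left _ _)
      · exact (h' v hv g hg).trans (le_max_right _ _)⟩)
    (fun g hg => by
      obtain ⟨Λ, hΛ⟩ := Filter.Eventually.self_of_nhds (h hg)
      exact ⟨_, nhdsWithin_le_nhds hΛ, Λ, fun v hv g' hg' => hg' v hv⟩)
  exact this

lemma vc_M (W : VcW VF VE gL A K G w) {g : ℝ} (hg : 0 ≤ g) : ∃ M : ℝ, ∀ v ∈ Icc 0 VF, w v g ≤ M := by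
  obtain ⟨M, hM⟩ := (isCompact_Icc.image_of_continuousOn (W.cv g hg)).bddAbove
  exact ⟨M, fun v hv => hM ⟨v, hv, rfl⟩⟩

lemma vc_ext (W : VcW VF VE gL A K G w) {g M : ℝ} (hg : 0 ≤ g) (h : ∀ v ∈ Ioo 0 VF, w v g ≤ M) :
    ∀ v ∈ Icc 0 VF, w v g ≤ M := by
  have hcl : IsClosed (Icc 0 VF ∩ (fun v => w v g) ⁻¹' Iic M) :=
    (W.cv g hg).preimage_isClosed_of_isClosed isClosed_Icc isClosed_Iic
  have hs : Ioo 0 VF ⊆ (Icc 0 VF ∩ (fun v => w v g) ⁻¹' Iic M) :=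
    fun v hv => ⟨⟨hv.1.le, hv.2.le⟩, h v hv⟩
  have := closure_minimal hs hcl
  rw [closure_Ioo W.hVF.ne] at this
  exact fun v hv => (this hv).2

lemma vc_strip (W : VcW VF VE gL A K G w) {N : ℝ → ℝ}
    (bd : ∀ g ∈ Ioo 0 G, ∀ κ : ℝ, 0 ≤ κ → Jflux VE gL 0 g * max (w 0 g - κ) 0
      ≤ Jflux VE gL VF g * max (w VF g - κ) 0)
    (hNi : IntervalIntegrable N volume 0 VF)
    (hN : ∀ᵐ v, v ∈ Ioo 0 VF → ∀ g ∈ Icc 0 G, w v g ≤ N v)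
    {g1 g2 g0 r k : ℝ} (h1 : 0 ≤ g1) (h12 : g1 < g2) (h2 : g2 ≤ G) (hr : 0 < r)
    (hin : ∀ g ∈ Icc g1 g2, |g - g0| ≤ r) (hk : 0 ≤ k) (hsm : K / A * (2 * r) ^ 2 ≤ 1 / 2)
    (he : ∀ v ∈ Ioo 0 VF, w v g1 ≤ k ∧ w v g2 ≤ k) (hO : Ioo g1 g2 ⊆ vcO VF w) :
    ∀ v ∈ Icc 0 VF, ∀ g ∈ Ioo g1 g2, w v g ≤ 2 * k := by
  have hA := W.hA
  have hK := W.hK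
  have locb : ∀ c d, g1 < c → d < g2 → ∃ Λ, ∀ v ∈ Icc 0 VF, ∀ g ∈ Icc c d, w v g ≤ Λ :=
    fun c d hc hd => vcO_compact (fun x hx => hO ⟨hc.trans_le hx.1, hx.2.trans_lt hd⟩)
  have hq : ∀ g ∈ Icc g1 g2, (g - g0) ^ 2 / r ^ 2 ≤ 1 := fun g hg => by
    rw [div_le_one (by positivity), ← sq_abs]
    exact pow_le_pow_left₀ (abs_nonneg _) (hin g hg) 2
  have hq0 : ∀ g : ℝ, 0 ≤ (g - g0) ^ 2 / r ^ 2 := fun g => by positivity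
  have hble : ∀ g ∈ Icc g1 g2, k ≤ k * (2 - (g - g0) ^ 2 / r ^ 2) := fun g hg => by
    nlinarith [hq g hg]
  have hbu : ∀ g : ℝ, k * (2 - (g - g0) ^ 2 / r ^ 2) ≤ 2 * k := fun g => by nlinarith [hq0 g]
  have hKr : K * r ^ 2 ≤ A := by
    have : K / A * (2 * r) ^ 2 = 4 * (K * r ^ 2) / A := by field_simp; ring
    rw [this, div_le_iff₀ hA] at hsm
    linarith
  have res := vc_lemS (VE := VE) (gL := gL) (A := A) (K := K) (v1 := 0) (v2 := VF) (g1 := g1) (g2 := g2)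
    (w := w) (b := fun _ g => k * (2 - (g - g0) ^ 2 / r ^ 2)) (N := N) W.hVF hA hK.le W.hgL h1
    (by
      refine le_trans ?_ hsm
      have a1 := abs_le.1 (hin g1 ⟨le_rfl, h12.le⟩)
      have a2 := abs_le.1 (hin g2 ⟨h12.le, le_rfl⟩)
      have : (g2 - g1) ^ 2 ≤ (2 * r) ^ 2 := by
        apply pow_le_pow_left₀ <;> linarith
      exact mul_le_mul_of_nonneg_left this (by positivity))
    (fun g hg => W.cv g (h1.trans hg.1.le))
    (fun v hv => (W.c1 v hv).continuousOn.mono (fun x hx => h1.trans hx.1))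
    (by
      intro v hv g hg
      obtain ⟨Λ, hΛ⟩ := locb ((g1 + g) / 2) ((g + g2) / 2) (by linarith [hg.1]) (by linarith [hg.2])
      exact vc_usc W (by linarith [hg.1]) (by linarith [hg.2]) hΛ (v, g)
        ⟨hv, by linarith [hg.1], by linarith [hg.2]⟩)
    (fun v hv g hg => W.pde v hv g ⟨h1.trans_lt hg.1, hg.2.trans_le h2⟩)
    (by fun_prop)
    (by
      intro v hv g hg
      refine ⟨0, -2 * k / r ^ 2, hasDerivAt_const _ _, ?_, ?_⟩
      · refine tendsto_const_nhds.congr' ?_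
        filter_upwards [self_mem_nhdsWithin] with h h3
        have h3' : (0:ℝ) < h := h3
        simp only [vcD2]
        field_simp
        ring
      · have e : A * (-2 * k / r ^ 2) = - (2 * k * (A / r ^ 2)) := by ring
        have h3 : K ≤ A / r ^ 2 := by rw [le_div_iff₀ (by positivity)]; exact hKr
        rw [e]
        have h4 := mul_le_mul_of_nonneg_left (hbu g) hK.le
        have h5 := mul_le_mul_of_nonneg_left h3 (show 0 ≤ 2 * k by positivity)
        linarith)
    (fun v hv => ⟨(he v hv).1.trans (hble g1 ⟨le_rfl, h12.le⟩), (he v hv).2.trans (hble g2 ⟨h12.le, le_rfl⟩)⟩)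
    (fun g hg => bd g ⟨h1.trans_lt hg.1, hg.2.trans_le h2⟩ _
      (hk.trans (hble g ⟨hg.1.le, hg.2.le⟩)))
    locb hNi
    (by
      filter_upwards [hN] with v hv hvi g hg
      have := hv hvi g ⟨h1.trans hg.1, hg.2.trans h2⟩
      have := hble g hg
      linarith)
  exact fun v hv g hg => (res v hv g hg).trans (hbu g)

lemma vc_main (W : VcW VF VE gL A K G w) {N : ℝ → ℝ}
    (bd : ∀ g ∈ Ioo 0 G, ∀ κ : ℝ, 0 ≤ κ → Jflux VE gL 0 g * max (w 0 g - κ) 0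
      ≤ Jflux VE gL VF g * max (w VF g - κ) 0)
    (hNi : IntervalIntegrable N volume 0 VF)
    (hN : ∀ᵐ v, v ∈ Ioo 0 VF → ∀ g ∈ Icc 0 G, w v g ≤ N v)
    {G' : ℝ} (hG0 : 0 < G) (hG' : G' < G) :
    ∃ C : ℝ, ∀ v ∈ Ioo 0 VF, ∀ g ∈ Ioc 0 G', w v g ≤ C := by
  have hA := W.hA
  have hK := W.hK
  have small : ∀ η > 0, ∃ r > 0, r < η ∧ K / A * (2 * r) ^ 2 ≤ 1 / 2 := by
    intro η hη
    have T2 : Tendsto (fun r : ℝ => K / A * (2 * r) ^ 2) (𝓝[>] 0) (𝓝 0) := by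
      have : Tendsto (fun r : ℝ => K / A * (2 * r) ^ 2) (𝓝 0) (𝓝 (K / A * (2 * 0) ^ 2)) :=
        (by fun_prop : Continuous fun r : ℝ => K / A * (2 * r) ^ 2).tendsto 0
      simpa using this.mono_left nhdsWithin_le_nhds
    have e3 : ∀ᶠ r : ℝ in 𝓝[>] 0, r < η := nhdsWithin_le_nhds (Iio_mem_nhds hη)
    obtain ⟨r, h2, h3, h4⟩ :=
      ((T2.eventually (Iic_mem_nhds (show (0:ℝ) < 1 / 2 by norm_num))).and
        (e3.and self_mem_nhdsWithin)).exists
    exact ⟨r, h4, h3, h2⟩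
  have hOo : IsOpen (vcO VF w) := isOpen_setOfPred_eventually_nhds
  have all : Ioo 0 G ⊆ vcO VF w := by
    by_contra hcon
    obtain ⟨x, hx, hxO⟩ := Set.not_subset.1 hcon
    have hSl : IsLocallyClosed (Ioo 0 G ∩ (vcO VF w)ᶜ) :=
      ⟨_, _, isOpen_Ioo, hOo.isClosed_compl, rfl⟩
    obtain ⟨k, U, hU, ⟨g0, hg0S, hg0U⟩, hsub⟩ := vc_baire hSl ⟨x, hx, hxO⟩
      (fun k : ℕ => {g | 0 < g ∧ ∀ v ∈ Icc 0 VF, w v g ≤ k}) (by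
        intro g hg
        obtain ⟨M, hM⟩ := vc_M W hg.1.1.le
        obtain ⟨k, hk⟩ := exists_nat_ge M
        exact mem_iUnion.2 ⟨k, hg.1.1, fun v hv => (hM v hv).trans hk⟩)
    have hbk : ∀ g ∈ Ioo 0 G ∩ (vcO VF w)ᶜ ∩ U, ∀ v ∈ Icc 0 VF, w v g ≤ k := by
      intro g hg
      refine vc_ext W hg.1.1.1.le ?_
      intro v hv
      obtain ⟨x, hxE, hxg⟩ := mem_closure_iff_seq_limit.1 (hsub hg)
      have := ((W.c1 v hv).continuousOn.continuousAt (Ici_mem_nhds hg.1.1.1)).tendsto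
      exact le_of_tendsto' (this.comp hxg) (fun n => (hxE n).2 v ⟨hv.1.le, hv.2.le⟩)
    obtain ⟨η, hη, hball⟩ := Metric.isOpen_iff.1 (isOpen_Ioo.inter hU) g0 ⟨hg0S.1, hg0U⟩
    obtain ⟨r, hr, hrη, hsm⟩ := small η hη
    have hin : ∀ g ∈ Icc (g0 - r) (g0 + r), g ∈ Ioo 0 G ∩ U := by
      intro g hg
      apply hball
      rw [Metric.mem_ball, Real.dist_eq, abs_lt]
      constructor <;> linarith [hg.1, hg.2]
    obtain ⟨M1, hM1⟩ := vc_M W (hin (g0 - r) ⟨le_rfl, by linarith⟩).1.1.le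
    obtain ⟨M2, hM2⟩ := vc_M W (hin (g0 + r) ⟨by linarith, le_rfl⟩).1.1.le
    set k' := max (k:ℝ) (max M1 M2) with hk'
    have hk0 : 0 ≤ k' := (Nat.cast_nonneg k).trans (le_max_left _ _)
    set T := ((vcO VF w)ᶜ ∩ Icc (g0 - r) (g0 + r)) ∪ {g0 - r, g0 + r} with hT
    have hTc : IsClosed T := (hOo.isClosed_compl.inter isClosed_Icc).union (Set.toFinite _).isClosed
    have hTk : ∀ g ∈ T, ∀ v ∈ Icc 0 VF, w v g ≤ k' := by
      rintro g (hg | hg | hg) v hv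
      · exact (hbk g ⟨⟨(hin g hg.2).1, hg.1⟩, (hin g hg.2).2⟩ v hv).trans (le_max_left _ _)
      · rw [hg]; exact (hM1 v hv).trans ((le_max_left _ _).trans (le_max_right _ _))
      · rw [hg]; exact (hM2 v hv).trans ((le_max_right _ _).trans (le_max_right _ _))
    have fin : ∀ g ∈ Icc (g0 - r) (g0 + r), ∀ v ∈ Icc 0 VF, w v g ≤ 2 * k' := by
      intro g hg v hv
      by_cases hgT : g ∈ T
      · linarith [hTk g hgT v hv]
      obtain ⟨ga, hga, gb, hgb, hag, hgb', hga0, hgb0, hgap⟩ := vc_gap hTc hgT (a0 := g0 - r) (b0 := g0 + r)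
        (by simp [hT]) hg.1 (by simp [hT]) hg.2
      have sub : ∀ z ∈ Icc ga gb, z ∈ Icc (g0 - r) (g0 + r) := fun z hz =>
        ⟨hga0.trans hz.1, hz.2.trans hgb0⟩
      have hab : ga < gb := hag.trans hgb'
      refine vc_strip W bd hNi hN (g1 := ga) (g2 := gb) (g0 := g0) (r := r)
        (hin ga (sub ga ⟨le_rfl, hab.le⟩)).1.1.le hab
        (hin gb (sub gb ⟨hab.le, le_rfl⟩)).1.2.le hr ?_ hk0 hsm ?_ ?_ v hv g ⟨hag, hgb'⟩
      · intro z hz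
        have := sub z hz
        rw [abs_le]; constructor <;> linarith [this.1, this.2]
      · intro v hv
        exact ⟨hTk ga hga v ⟨hv.1.le, hv.2.le⟩, hTk gb hgb v ⟨hv.1.le, hv.2.le⟩⟩
      · intro z hz
        by_contra hcon
        exact hgap z hz (Or.inl ⟨hcon, sub z ⟨hz.1.le, hz.2.le⟩⟩)
    refine hg0S.2 (vcO_mem (Λ := 2 * k') ?_)
    filter_upwards [Icc_mem_nhds (show g0 - r < g0 by linarith) (show g0 < g0 + r by linarith)] with g hg
    exact fin g hg
  obtain ⟨r, hr, hrG, hsm⟩ := small G hG0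
  obtain ⟨M1, hM1⟩ := vc_M W le_rfl
  obtain ⟨M2, hM2⟩ := vc_M W hr.le
  have s := vc_strip W bd hNi hN (g1 := 0) (g2 := r) (g0 := 0) (r := r) (k := max 0 (max M1 M2)) le_rfl hr
    hrG.le hr (fun g hg => by rw [sub_zero, abs_of_nonneg hg.1]; exact hg.2) (le_max_left _ _) hsm
    (fun v hv => ⟨(hM1 v ⟨hv.1.le, hv.2.le⟩).trans ((le_max_left _ _).trans (le_max_right _ _)),
      (hM2 v ⟨hv.1.le, hv.2.le⟩).trans ((le_max_right _ _).trans (le_max_right _ _))⟩)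
    (fun z hz => all ⟨hz.1, hz.2.trans hrG⟩)
  obtain ⟨Λ, hΛ⟩ := vcO_compact (VF := VF) (w := w) (c := r / 2) (d := G')
    (fun z hz => all ⟨by linarith [hz.1], hz.2.trans_lt hG'⟩)
  refine ⟨max (2 * max 0 (max M1 M2)) Λ, fun v hv g hg => ?_⟩
  rcases lt_or_ge g r with h | h
  · exact (s v ⟨hv.1.le, hv.2.le⟩ g ⟨hg.1, h⟩).trans (le_max_left _ _)
  · exact (hΛ v ⟨hv.1.le, hv.2.le⟩ g ⟨by linarith, hg.2⟩).trans (le_max_right _ _)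

end P10

lemma vc_meas {VF : ℝ} (hVF : 0 < VF) {p : ℝ → ℝ → ℝ}
    (cv : ∀ g ∈ Ici (0:ℝ), ContinuousOn (fun v => p v g) (Icc 0 VF))
    (cg : ∀ v ∈ Ioo 0 VF, ContinuousOn (fun g => p v g) (Ici 0)) :
    Measurable (fun z : ℝ × ℝ => p (projIcc 0 VF hVF.le z.1) (max z.2 0)) := by
  have h1 : ∀ g : ℝ, Continuous (fun v : ℝ => p (projIcc 0 VF hVF.le v) (max g 0)) := fun g =>
    (cv (max g 0) (mem_Ici.2 (le_max_right _ _))).comp_continuous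
      (continuous_subtype_val.comp continuous_projIcc) (fun v => (projIcc 0 VF hVF.le v).2)
  have h2 : ∀ v ∈ Ioo 0 VF, Continuous (fun g : ℝ => p v (max g 0)) := fun v hv =>
    (cg v hv).comp_continuous (by fun_prop) (fun g => mem_Ici.2 (le_max_right _ _))
  have h3 : ∀ v ∈ Icc 0 VF, Measurable (fun g : ℝ => p v (max g 0)) := by
    intro v hv
    have tt : Tendsto (fun n : ℕ => v + (VF / 2 - v) * (1 / ((n:ℝ) + 1) / 2)) atTop (𝓝 v) := by
      have := ((tendsto_one_div_add_atTop_nhds_zero_nat (𝕜 := ℝ)).div_const 2).const_mul (VF / 2 - v) |>.const_add v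
      simpa using this
    have hin : ∀ n : ℕ, v + (VF / 2 - v) * (1 / ((n:ℝ) + 1) / 2) ∈ Ioo 0 VF := by
      intro n
      have a1 : 0 < 1 / ((n:ℝ) + 1) / 2 := by positivity
      have a2 : 1 / ((n:ℝ) + 1) / 2 < 1 := by
        have : 1 / ((n:ℝ) + 1) ≤ 1 := by
          rw [div_le_one (by positivity)]; linarith [Nat.cast_nonneg (α := ℝ) n]
        linarith
      set s := 1 / ((n:ℝ) + 1) / 2
      have e : v + (VF / 2 - v) * s = (1 - s) * v + s * (VF / 2) := by ring
      rw [e]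
      constructor
      · have := mul_nonneg (sub_nonneg.2 a2.le) hv.1
        have := mul_pos a1 hVF
        linarith
      · have := mul_le_mul_of_nonneg_left hv.2 (sub_nonneg.2 a2.le)
        have := mul_pos a1 hVF
        linarith
    refine measurable_of_tendsto_metrizable (f := fun (n:ℕ) (g:ℝ) => p (v + (VF / 2 - v) * (1 / ((n:ℝ) + 1) / 2)) (max g 0))
      (fun n => (h2 _ (hin n)).measurable) ?_
    rw [tendsto_pi_nhds]
    intro g
    have := cv (max g 0) (mem_Ici.2 (le_max_right _ _)) v hv
    refine this.tendsto.comp (tendsto_nhdsWithin_iff.2 ⟨tt, Eventually.of_forall fun n => ?_⟩)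
    exact ⟨(hin n).1.le, (hin n).2.le⟩
  exact measurable_uncurry_of_continuous_of_measurable
    (u := fun (v:ℝ) (g:ℝ) => p (projIcc 0 VF hVF.le v) (max g 0)) h1 (fun v => h3 _ (projIcc 0 VF hVF.le v).2)

lemma vc_meas_deriv {VF : ℝ} (hVF : 0 < VF) {p : ℝ → ℝ → ℝ}
    (cv : ∀ g ∈ Ici (0:ℝ), ContinuousOn (fun v => p v g) (Icc 0 VF))
    (c2 : ∀ v ∈ Ioo 0 VF, ContDiffOn ℝ 2 (fun g => p v g) (Ici 0)) :
    AEMeasurable (fun z : ℝ × ℝ => deriv (fun g => p z.1 g) z.2)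
      (volume.restrict (Ioo (0:ℝ) VF ×ˢ Ioi (0:ℝ))) := by
  have hP := vc_meas hVF cv (fun v hv => (c2 v hv).continuousOn)
  set P := fun z : ℝ × ℝ => p (projIcc 0 VF hVF.le z.1) (max z.2 0) with hPd
  refine aemeasurable_of_tendsto_metrizable_ae (u := atTop)
    (f := fun (n:ℕ) (z : ℝ × ℝ) => (1 / ((n:ℝ) + 1))⁻¹ • (P (z.1, z.2 + 1 / ((n:ℝ) + 1)) - P z)) ?_ ?_
  · intro n
    have : Measurable fun z : ℝ × ℝ => P (z.1, z.2 + 1 / ((n:ℝ) + 1)) :=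
      hP.comp (by fun_prop)
    exact ((this.sub hP).const_smul ((1 / ((n:ℝ) + 1))⁻¹)).aemeasurable
  · filter_upwards [self_mem_ae_restrict (measurableSet_Ioo.prod measurableSet_Ioi)] with z hz
    have hz1 : z.1 ∈ Ioo 0 VF := hz.1
    have hz2 : 0 < z.2 := hz.2
    have hd : HasDerivAt (fun g => p z.1 g) (deriv (fun g => p z.1 g) z.2) z.2 :=
      (((c2 z.1 hz1).contDiffAt (Ici_mem_nhds hz2)).differentiableAt (by norm_num)).hasDerivAt
    have ht := hasDerivAt_iff_tendsto_slope_zero.1 hd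
    have hs : Tendsto (fun n : ℕ => 1 / ((n:ℝ) + 1)) atTop (𝓝[≠] 0) :=
      tendsto_nhdsWithin_iff.2 ⟨tendsto_one_div_add_atTop_nhds_zero_nat, Eventually.of_forall fun n => by
        have : 0 < 1 / ((n:ℝ) + 1) := by positivity
        exact this.ne'⟩
    refine (ht.comp hs).congr fun n => ?_
    have hpr : ((projIcc 0 VF hVF.le z.1 : Icc 0 VF) : ℝ) = z.1 := by
      rw [projIcc_of_mem hVF.le ⟨hz1.1.le, hz1.2.le⟩]
    have hn : 0 < 1 / ((n:ℝ) + 1) := by positivity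
    simp only [Function.comp, hPd, hpr]
    rw [max_eq_left hz2.le, max_eq_left (by linarith)]

lemma vc_N {VF a : ℝ} (hVF : 0 < VF) (ha : 0 < a) {p : ℝ → ℝ → ℝ}
    (cv : ∀ g ∈ Ici (0:ℝ), ContinuousOn (fun v => p v g) (Icc 0 VF))
    (c2 : ∀ v ∈ Ioo 0 VF, ContDiffOn ℝ 2 (fun g => p v g) (Ici 0))
    (dec : ∃ G : ℝ, ∀ g ∈ Ici G, ∀ v ∈ Ioo 0 VF, p v g ≤ 1)
    (hint1 : ∫⁻ x in (Ioo (0:ℝ) VF) ×ˢ (Ioi (0:ℝ)),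
        ENNReal.ofReal (Real.exp (x.2 ^ 2 / (8 * a)) * |deriv (fun g => p x.1 g) x.2|) < ⊤) :
    ∃ N : ℝ → ℝ, IntervalIntegrable N volume 0 VF ∧
      ∀ᵐ v, v ∈ Ioo 0 VF → ∀ g, 0 ≤ g → p v g ≤ N v := by
  have hm := vc_meas_deriv hVF cv c2
  have hfin : ∫⁻ x in (Ioo (0:ℝ) VF) ×ˢ (Ioi (0:ℝ)), ‖deriv (fun g => p x.1 g) x.2‖ₑ < ⊤ := by
    refine lt_of_le_of_lt (lintegral_mono fun x => ?_) hint1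
    rw [Real.enorm_eq_ofReal_abs]
    apply ENNReal.ofReal_le_ofReal
    have : 1 ≤ Real.exp (x.2 ^ 2 / (8 * a)) := Real.one_le_exp (by positivity)
    nlinarith [abs_nonneg (deriv (fun g => p x.1 g) x.2)]
  rw [Measure.volume_eq_prod, ← Measure.prod_restrict] at hm hfin
  have hme := hm.enorm
  rw [lintegral_prod _ hme] at hfin
  have hmI := hme.lintegral_prod_right'
  set I : ℝ → ENNReal := fun v => ∫⁻ g in Ioi (0:ℝ), ‖deriv (fun g => p v g) g‖ₑ with hI
  have hint : Integrable (fun v => (I v).toReal) (volume.restrict (Ioo 0 VF)) :=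
    integrable_toReal_of_lintegral_ne_top hmI hfin.ne
  have hae : ∀ᵐ v ∂(volume.restrict (Ioo 0 VF)), I v < ⊤ := ae_lt_top' hmI hfin.ne
  refine ⟨fun v => 1 + (I v).toReal, ?_, ?_⟩
  · refine (intervalIntegrable_const).add ?_
    rw [intervalIntegrable_iff_integrableOn_Ioo_of_le hVF.le]
    exact hint
  · rw [ae_restrict_iff' measurableSet_Ioo] at hae
    obtain ⟨G, hG⟩ := dec
    filter_upwards [hae] with v hv hvi g hg
    set G1 := max G g with hG1
    have hgG : g ≤ G1 := le_max_right _ _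
    have h1 := hG G1 (mem_Ici.2 (le_max_left _ _)) v hvi
    have h2 := enorm_sub_le_lintegral_deriv_of_contDiffOn_Icc (f := fun g => p v g) (a := g) (b := G1)
      (((c2 v hvi).of_le (by norm_num)).mono (fun x hx => hg.trans hx.1)) hgG
    have h3 : ∫⁻ x in Icc g G1, ‖deriv (fun g => p v g) x‖ₑ ≤ I v := by
      rw [← restrict_Ioc_eq_restrict_Icc]
      exact lintegral_mono_set (fun x hx => hg.trans_lt hx.1)
    have h4 := ENNReal.toReal_mono (hv hvi).ne (h2.trans h3)
    rw [toReal_enorm, Real.norm_eq_abs] at h4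
    have := (abs_le.1 h4).1
    linarith

lemma vc_gauge {gin a : ℝ} (ha : 0 < a) {f : ℝ → ℝ} {g : ℝ} (hf : ContDiffAt ℝ 2 f g) :
    Tendsto (fun h => vcD2 (fun x => f x * Real.exp ((x - gin) ^ 2 / (4 * a))) g h / h ^ 2) (𝓝[>] (0:ℝ))
      (𝓝 (Real.exp ((g - gin) ^ 2 / (4 * a)) * (deriv (deriv f) g + 2 * ((g - gin) / (2 * a)) * deriv f g
        + (1 / (2 * a) + ((g - gin) / (2 * a)) ^ 2) * f g))) := by
  have hE : ∀ x, HasDerivAt (fun x : ℝ => Real.exp ((x - gin) ^ 2 / (4 * a)))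
      (Real.exp ((x - gin) ^ 2 / (4 * a)) * ((x - gin) / (2 * a))) x := by
    intro x
    have h1 : HasDerivAt (fun v' : ℝ => (v' - gin) ^ 2) (2 * (x - gin)) x := by
      simpa using ((hasDerivAt_id x).sub_const gin).fun_pow 2
    have := (h1.div_const (4 * a)).exp
    convert this using 2
    field_simp; ring
  have hev : ∀ᶠ x in 𝓝 g, HasDerivAt f (deriv f x) x := by
    have := hf.eventually (by simp)
    exact this.mono fun x hx => (hx.differentiableAt (by norm_num)).hasDerivAt
  have hdd : HasDerivAt (deriv f) (deriv (deriv f) g) g := by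
    have : ContDiffAt ℝ 1 (deriv f) g := by
      obtain ⟨u, hu, huo, hgu, hcu⟩ : ∃ u ∈ 𝓝 g, IsOpen u ∧ g ∈ u ∧ ContDiffOn ℝ 2 f u := by
        obtain ⟨u, hu, hcu⟩ := hf.contDiffOn (m := 2) le_rfl (by simp)
        obtain ⟨t, ht, hto, hgt⟩ := mem_nhds_iff.1 hu
        exact ⟨t, hto.mem_nhds hgt, hto, hgt, hcu.mono ht⟩
      exact (hcu.deriv_of_isOpen (m := 1) huo (by norm_num)).contDiffAt hu
    exact (this.differentiableAt (by norm_num)).hasDerivAt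
  refine vc_D2_tendsto (f' := fun x => deriv f x * Real.exp ((x - gin) ^ 2 / (4 * a)) +
    f x * (Real.exp ((x - gin) ^ 2 / (4 * a)) * ((x - gin) / (2 * a)))) ?_ ?_
  · exact hev.mono fun x hx => hx.mul (hE x)
  · have h1 := hdd.mul (hE g)
    have h2 : HasDerivAt (fun x : ℝ => (x - gin) / (2 * a)) (1 / (2 * a)) g :=
      ((hasDerivAt_id g).sub_const gin).div_const _
    have h3 := hev.self_of_nhds.mul ((hE g).mul h2)
    refine (h1.add h3).congr_deriv ?_
    simp only [Pi.mul_apply]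
    ring

lemma vc_W {VF VE gL gin a σE G : ℝ} (hVF : 0 < VF) (hgL : 0 < gL) (ha : 0 < a) (hσE : 0 < σE) (hG : 0 < G)
    {p : ℝ → ℝ → ℝ} (hp : StatSol VF VE gL gin a σE p) :
    VcW VF VE gL (a / σE) (gL + G + 1 / (2 * σE)) G (fun v g => p v g * Real.exp ((g - gin) ^ 2 / (4 * a))) := by
  have hpn : ∀ v ∈ Icc 0 VF, ∀ g, 0 ≤ g → 0 ≤ p v g := by
    intro v hv g hg
    have hcl : IsClosed (Icc 0 VF ∩ (fun v => p v g) ⁻¹' Ici 0) :=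
      (hp.cont_v g hg).preimage_isClosed_of_isClosed isClosed_Icc isClosed_Ici
    have hs : Ioo 0 VF ⊆ (Icc 0 VF ∩ (fun v => p v g) ⁻¹' Ici 0) :=
      fun v hv => ⟨⟨hv.1.le, hv.2.le⟩, hp.nonneg v hv g hg⟩
    have := closure_minimal hs hcl
    rw [closure_Ioo hVF.ne] at this
    exact (this hv).2
  refine ⟨hVF, by positivity, by positivity, hgL.le, ?_, ?_, ?_, ?_⟩
  · intro v hv g hg
    exact mul_nonneg (hpn v hv g hg) (Real.exp_pos _).le
  · intro g hg
    exact (hp.cont_v g hg).mul continuousOn_const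
  · intro v hv
    refine ((hp.smooth_g v hv).of_le (by norm_num)).mul ?_
    apply ContDiff.contDiffOn
    fun_prop
  · intro v hv g hg
    have hc : ContDiffAt ℝ 2 (fun g => p v g) g := (hp.smooth_g v hv).contDiffAt (Ici_mem_nhds hg.1)
    have hdv := (hp.diff_v v hv g hg.1).hasDerivAt
    set pv := deriv (fun v' => p v' g) v with hpv
    set E := Real.exp ((g - gin) ^ 2 / (4 * a)) with hE
    refine ⟨_, _, hdv.mul_const E, vc_gauge (gin := gin) ha hc, ?_⟩
    have hpde := hp.pde v hv g hg.1
    have hg1 : HasDerivAt (fun g' => p v g') (deriv (fun g' => p v g') g) g :=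
      (hc.differentiableAt (by norm_num)).hasDerivAt
    have e1 : deriv (fun v' => Jflux VE gL v' g * p v' g) v = (-gL - g) * p v g + Jflux VE gL v g * pv := by
      have hJ : HasDerivAt (fun v' => Jflux VE gL v' g) (-gL - g) v := by
        unfold Jflux
        have := ((hasDerivAt_id v).const_mul (-gL)).add (((hasDerivAt_id v).const_sub VE).const_mul g)
        refine this.congr_deriv ?_
        ring
      exact (hJ.mul hdv).deriv
    have e2 : deriv (fun g' => ((gin - g') / σE) * p v g') g =
        (-1 / σE) * p v g + (gin - g) / σE * deriv (fun g' => p v g') g := by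
      have h : HasDerivAt (fun g' : ℝ => (gin - g') / σE) (-1 / σE) g :=
        ((hasDerivAt_id g).const_sub gin).div_const σE
      exact (h.mul hg1).deriv
    rw [e1, e2] at hpde
    change Jflux VE gL v g * (pv * E) - (gL + G + 1 / (2 * σE)) * (p v g * E) ≤ a / σE * (E * (deriv (deriv fun g' => p v g') g + 2 * ((g - gin) / (2 * a)) * deriv (fun g' => p v g') g
        + (1 / (2 * a) + ((g - gin) / (2 * a)) ^ 2) * p v g))
    set p1 := deriv (fun g' => p v g') g
    set p2 := deriv (deriv fun g' => p v g') g
    have e3 : Jflux VE gL v g * pv = (gL + g) * p v g + 1 / σE * p v g - (gin - g) / σE * p1 + a / σE * p2 := by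
      have : (-1 / σE) = - (1 / σE) := by ring
      rw [this] at hpde
      linarith
    have e4 : a / σE * (E * (p2 + 2 * ((g - gin) / (2 * a)) * p1 + (1 / (2 * a) + ((g - gin) / (2 * a)) ^ 2) * p v g))
        - (Jflux VE gL v g * (pv * E) - (gL + G + 1 / (2 * σE)) * (p v g * E)) =
        E * p v g * ((G - g) + (g - gin) ^ 2 / (4 * a * σE)) := by
      have : Jflux VE gL v g * (pv * E) = (Jflux VE gL v g * pv) * E := by ring
      rw [this, e3]
      field_simp
      ring
    have h5 : 0 ≤ E * p v g * ((G - g) + (g - gin) ^ 2 / (4 * a * σE)) := by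
      have h6 : 0 ≤ p v g := hp.nonneg v hv g hg.1.le
      have h7 : 0 ≤ G - g := by linarith [hg.2]
      have h8 : 0 ≤ E := (Real.exp_pos _).le
      have h9 : 0 ≤ (g - gin) ^ 2 / (4 * a * σE) := by positivity
      positivity
    linarith

/-- a strictly positive classical stationary solution with the stated
integrability properties is bounded on `Ω`. -/
theorem stmt0 (VF VE gL gin a σE : ℝ)
    (hVF : 0 < VF) (hVE : VF < VE) (hgL : 0 < gL) (hgin : 0 < gin)
    (ha : 0 < a) (hσE : 0 < σE)
    (p : ℝ → ℝ → ℝ) (hp : StatSol VF VE gL gin a σE p)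
    (hpos : ∀ v ∈ Ioo 0 VF, ∀ g ∈ Ioi (0:ℝ), 0 < p v g)
    (hint1 : ∫⁻ x in (Ioo (0:ℝ) VF) ×ˢ (Ioi (0:ℝ)),
        ENNReal.ofReal (Real.exp (x.2 ^ 2 / (8 * a)) * |deriv (fun g => p x.1 g) x.2|) < ⊤)
    (hint2 : ∫⁻ x in (Ioo (0:ℝ) VF) ×ˢ (Ioi (0:ℝ)),
        ENNReal.ofReal ((x.2 + gL) ^ 2 * p x.1 x.2) < ⊤) :
    ∃ C : ℝ, ∀ v ∈ Ioo 0 VF, ∀ g ∈ Ioi (0:ℝ), p v g ≤ C := by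
  obtain ⟨G0, hG0⟩ := hp.decay 1 one_pos
  have dec : ∃ G : ℝ, ∀ g ∈ Ici G, ∀ v ∈ Ioo 0 VF, p v g ≤ 1 :=
    ⟨G0, fun g hg v hv => (hG0 g hg v hv).1.le⟩
  obtain ⟨N, hNi, hN⟩ := vc_N hVF ha hp.cont_v hp.smooth_g dec hint1
  set G := max G0 0 + 1 with hG
  have hGp : 0 < G := by positivity
  have W := vc_W hVF hgL ha hσE hGp hp
  have hcE : ContinuousOn (fun g : ℝ => Real.exp ((g - gin) ^ 2 / (4 * a))) (Icc 0 G) := by fun_prop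
  obtain ⟨M, hM⟩ := (isCompact_Icc.image_of_continuousOn hcE).bddAbove
  have hM' : ∀ g ∈ Icc 0 G, Real.exp ((g - gin) ^ 2 / (4 * a)) ≤ M := fun g hg => hM ⟨g, hg, rfl⟩
  have hD : 0 < VE - VF := by linarith
  obtain ⟨C, hC⟩ := vc_main W (N := fun v => N v * M) (G' := max G0 0) (by
      intro g hg κ hκ
      have hJ0 : Jflux VE gL 0 g = g * VE := by unfold Jflux; ring
      have hJ1 : Jflux VE gL VF g = g * (VE - VF) - gL * VF := by unfold Jflux; ring
      have hJ0p : 0 < Jflux VE gL 0 g := by rw [hJ0]; exact mul_pos hg.1 (by linarith)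
      set E := Real.exp ((g - gin) ^ 2 / (4 * a)) with hE
      rcases lt_or_ge g (gL * VF / (VE - VF)) with h | h
      · have hlow := hp.bc_v_low g ⟨hg.1, h⟩
        have hJ1n : Jflux VE gL VF g < 0 := by
          rw [lt_div_iff₀ hD] at h
          rw [hJ1]; linarith
        have p0 : p 0 g = 0 := (mul_eq_zero.1 hlow.1).resolve_left hJ0p.ne'
        have p1 : p VF g = 0 := (mul_eq_zero.1 hlow.2).resolve_left hJ1n.ne
        simp only [p0, p1, zero_mul]
        rw [max_eq_right (by linarith)]
        simp
      · have hh := hp.bc_v_high g h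
        have hJ1n : 0 ≤ Jflux VE gL VF g := by
          rw [div_le_iff₀ hD] at h
          rw [hJ1]; linarith
        have hJ10 : Jflux VE gL VF g ≤ Jflux VE gL 0 g := by
          rw [hJ0, hJ1]
          have := mul_pos hg.1 hVF
          have := mul_pos hgL hVF
          linarith
        rw [mul_max_of_nonneg _ _ hJ0p.le, mul_max_of_nonneg _ _ hJ1n]
        simp only [mul_zero]
        apply max_le_max _ le_rfl
        have e : Jflux VE gL 0 g * (p 0 g * E) = Jflux VE gL VF g * (p VF g * E) := by
          rw [← mul_assoc, hh, mul_assoc]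
        have := mul_le_mul_of_nonneg_right hJ10 hκ
        rw [mul_sub, mul_sub]
        linarith)
    (hNi.mul_const M) (by
      filter_upwards [hN] with v hv hvi g hg
      have h1 := hv hvi g hg.1
      have h0 := hp.nonneg v hvi g hg.1
      exact mul_le_mul h1 (hM' g hg) (Real.exp_pos _).le (h0.trans h1)) hGp (by rw [hG]; linarith)
  refine ⟨max C 1, fun v hv g hg => ?_⟩
  rcases le_total g (max G0 0) with h | h
  · have h1 := hC v hv g ⟨hg, h⟩
    have h2 : 1 ≤ Real.exp ((g - gin) ^ 2 / (4 * a)) := Real.one_le_exp (by positivity)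
    have h3 := (hpos v hv g hg).le
    refine le_trans ?_ (le_max_left _ _)
    refine le_trans ?_ h1
    nlinarith
  · exact (hG0 g (mem_Ici.2 ((le_max_left _ _).trans h)) v hv).1.le.trans (le_max_right _ _)
end
end

section
/- Let p be a classical stationary solution of the voltage–conductance equation, and assume in addition that p, ∂_g p and ∂²_g p are continuous on (0,V_F)×[0,∞) and locally uniformly bounded in v (so that differentiation in g under the v-integral is justified). Then the g-marginal of p is Gaussian: for every g ≥ 0, ∫_0^{V_F} p(v,g) dv = M(g)/Z, where Z = ∫_0^∞ M(g') dg'. -/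
open Real MeasureTheory Set Filter

noncomputable section

lemma aux_slice {VF : ℝ} {f : ℝ → ℝ → ℝ}
    (hf : ContinuousOn (fun x : ℝ × ℝ => f x.1 x.2) ((Ioo 0 VF) ×ˢ (Ici 0)))
    {g : ℝ} (hg : 0 ≤ g) : ContinuousOn (fun v => f v g) (Ioo 0 VF) :=
  hf.comp (f := fun v : ℝ => (v, g)) (by fun_prop) (fun v hv => ⟨hv, hg⟩)

lemma aux_slice_g {VF : ℝ} {f : ℝ → ℝ → ℝ}
    (hf : ContinuousOn (fun x : ℝ × ℝ => f x.1 x.2) ((Ioo 0 VF) ×ˢ (Ici 0)))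
    {v : ℝ} (hv : v ∈ Ioo 0 VF) : ContinuousOn (fun g => f v g) (Ici 0) :=
  hf.comp (f := fun g : ℝ => (v, g)) (by fun_prop) (fun g hg => ⟨hv, hg⟩)

lemma aux_int {VF : ℝ} {f : ℝ → ℝ → ℝ}
    (hf : ContinuousOn (fun x : ℝ × ℝ => f x.1 x.2) ((Ioo 0 VF) ×ˢ (Ici 0)))
    (hb : ∀ G > 0, ∃ C : ℝ, ∀ v ∈ Ioo 0 VF, ∀ g ∈ Icc (0:ℝ) G, |f v g| ≤ C)
    {g : ℝ} (hg : 0 ≤ g) : IntegrableOn (fun v => f v g) (Ioo 0 VF) := by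
  obtain ⟨C, hC⟩ := hb (g + 1) (by linarith)
  refine IntegrableOn.of_bound (C := C) (by simp)
    ((aux_slice hf hg).aestronglyMeasurable measurableSet_Ioo) ?_
  filter_upwards [ae_restrict_mem measurableSet_Ioo] with v hv
  exact hC v hv g ⟨hg, by linarith⟩

lemma aux_cont {VF : ℝ} {f : ℝ → ℝ → ℝ}
    (hf : ContinuousOn (fun x : ℝ × ℝ => f x.1 x.2) ((Ioo 0 VF) ×ˢ (Ici 0)))
    (hb : ∀ G > 0, ∃ C : ℝ, ∀ v ∈ Ioo 0 VF, ∀ g ∈ Icc (0:ℝ) G, |f v g| ≤ C) :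
    ContinuousOn (fun g => ∫ v in Ioo 0 VF, f v g) (Ici 0) := by
  intro g hg
  have hg0 : (0:ℝ) ≤ g := hg
  obtain ⟨C, hC⟩ := hb (g + 1) (by linarith)
  refine continuousWithinAt_of_dominated (bound := fun _ => C) ?_ ?_ ?_ ?_
  · filter_upwards [self_mem_nhdsWithin] with x hx
    exact (aux_slice hf hx).aestronglyMeasurable measurableSet_Ioo
  · have : ∀ᶠ x in nhdsWithin g (Ici 0), x < g + 1 :=
      nhdsWithin_le_nhds (Iio_mem_nhds (by linarith))
    filter_upwards [self_mem_nhdsWithin, this] with x hx hx1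
    filter_upwards [ae_restrict_mem measurableSet_Ioo] with v hv
    exact hC v hv x ⟨hx, hx1.le⟩
  · exact integrableOn_const (by simp)
  · filter_upwards [ae_restrict_mem measurableSet_Ioo] with v hv
    exact aux_slice_g hf hv g hg

lemma aux_deriv {VF : ℝ} {f f' : ℝ → ℝ → ℝ}
    (hf : ContinuousOn (fun x : ℝ × ℝ => f x.1 x.2) ((Ioo 0 VF) ×ˢ (Ici 0)))
    (hf' : ContinuousOn (fun x : ℝ × ℝ => f' x.1 x.2) ((Ioo 0 VF) ×ˢ (Ici 0)))
    (hb : ∀ G > 0, ∃ C : ℝ, ∀ v ∈ Ioo 0 VF, ∀ g ∈ Icc (0:ℝ) G, |f v g| ≤ C)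
    (hb' : ∀ G > 0, ∃ C : ℝ, ∀ v ∈ Ioo 0 VF, ∀ g ∈ Icc (0:ℝ) G, |f' v g| ≤ C)
    (hd : ∀ v ∈ Ioo 0 VF, ∀ g > 0, HasDerivAt (f v) (f' v g) g)
    {g : ℝ} (hg : 0 < g) :
    HasDerivAt (fun g => ∫ v in Ioo 0 VF, f v g) (∫ v in Ioo 0 VF, f' v g) g := by
  obtain ⟨C, hC⟩ := hb' (g + 1) (by linarith)
  have hs : Ioo 0 (g + 1) ∈ nhds g := Ioo_mem_nhds hg (by linarith)
  refine (hasDerivAt_integral_of_dominated_loc_of_deriv_le (F := fun g v => f v g)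
    (F' := fun g v => f' v g) (bound := fun _ => C) hs ?_ ?_ ?_ ?_ ?_ ?_).2
  · filter_upwards [hs] with x hx
    exact (aux_slice hf hx.1.le).aestronglyMeasurable measurableSet_Ioo
  · exact aux_int hf hb hg.le
  · exact (aux_slice hf' hg.le).aestronglyMeasurable measurableSet_Ioo
  · filter_upwards [ae_restrict_mem measurableSet_Ioo] with v hv x hx
    exact hC v hv x ⟨hx.1.le, hx.2.le⟩
  · exact integrableOn_const (by simp)
  · filter_upwards [ae_restrict_mem measurableSet_Ioo] with v hv x hx
    exact hd v hv x hx.1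

lemma aux_const {F : ℝ → ℝ} (hc : ContinuousOn F (Ici 0))
    (hd : ∀ g > 0, HasDerivAt F 0 g) {g : ℝ} (hg : 0 ≤ g) : F g = F 0 := by
  rcases hg.eq_or_lt with rfl | hg
  · rfl
  obtain ⟨c, _, h⟩ := exists_hasDerivAt_eq_slope F (fun _ => 0) hg
    (hc.mono Icc_subset_Ici_self) (fun x hx => hd x hx.1)
  rw [eq_comm, div_eq_zero_iff] at h
  rcases h with h | h <;> linarith


/-- the `g`-marginal of a classical stationary solution is Gaussian. -/
theorem stmt2 (VF VE gL gin a σE : ℝ)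
    (hVF : 0 < VF) (hVE : VF < VE) (hgL : 0 < gL) (hgin : 0 < gin)
    (ha : 0 < a) (hσE : 0 < σE)
    (p : ℝ → ℝ → ℝ) (hp : StatSol VF VE gL gin a σE p)
    (hcont0 : ContinuousOn (fun x : ℝ × ℝ => p x.1 x.2) ((Ioo 0 VF) ×ˢ (Ici 0)))
    (hcont1 : ContinuousOn (fun x : ℝ × ℝ => deriv (fun g => p x.1 g) x.2)
      ((Ioo 0 VF) ×ˢ (Ici 0)))
    (hcont2 : ContinuousOn (fun x : ℝ × ℝ => deriv (deriv (fun g => p x.1 g)) x.2)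
      ((Ioo 0 VF) ×ˢ (Ici 0)))
    (hloc : ∀ G > 0, ∃ C : ℝ, ∀ v ∈ Ioo 0 VF, ∀ g ∈ Icc (0:ℝ) G,
      |p v g| ≤ C ∧ |deriv (fun g' => p v g') g| ≤ C ∧
        |deriv (deriv (fun g' => p v g')) g| ≤ C) :
    ∀ g ∈ Ici (0:ℝ),
      ∫ v in Ioo 0 VF, p v g = Mw gin a g / (∫ g' in Ioi (0:ℝ), Mw gin a g') := by
  have hb0 : ∀ G > 0, ∃ C : ℝ, ∀ v ∈ Ioo 0 VF, ∀ g ∈ Icc (0:ℝ) G, |p v g| ≤ C :=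
    fun G hG => (hloc G hG).imp fun C h v hv g hg => (h v hv g hg).1
  have hb1 : ∀ G > 0, ∃ C : ℝ, ∀ v ∈ Ioo 0 VF, ∀ g ∈ Icc (0:ℝ) G,
      |deriv (fun g' => p v g') g| ≤ C :=
    fun G hG => (hloc G hG).imp fun C h v hv g hg => (h v hv g hg).2.1
  have hb2 : ∀ G > 0, ∃ C : ℝ, ∀ v ∈ Ioo 0 VF, ∀ g ∈ Icc (0:ℝ) G,
      |deriv (deriv (fun g' => p v g')) g| ≤ C :=
    fun G hG => (hloc G hG).imp fun C h v hv g hg => (h v hv g hg).2.2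
  have hd1 : ∀ v ∈ Ioo 0 VF, ∀ g > 0, HasDerivAt (p v) (deriv (fun g' => p v g') g) g := by
    intro v hv g hg
    have h := ((hp.smooth_g v hv).contDiffAt (Ici_mem_nhds hg)).differentiableAt (by simp)
    exact h.hasDerivAt
  have hd2 : ∀ v ∈ Ioo 0 VF, ∀ g > 0, HasDerivAt (fun g => deriv (fun g' => p v g') g)
      (deriv (deriv (fun g' => p v g')) g) g := by
    intro v hv g hg
    have h := ((hp.smooth_g v hv).mono (Ioi_subset_Ici_self)).deriv_of_isOpen (m := 1) isOpen_Ioi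
      (by norm_num)
    exact ((h.contDiffAt (Ioi_mem_nhds hg)).differentiableAt (by simp)).hasDerivAt
  set N : ℝ → ℝ := fun g => ∫ v in Ioo 0 VF, p v g with hN
  set N1 : ℝ → ℝ := fun g => ∫ v in Ioo 0 VF, deriv (fun g' => p v g') g with hN1
  set N2 : ℝ → ℝ := fun g => ∫ v in Ioo 0 VF, deriv (deriv (fun g' => p v g')) g with hN2
  have cN : ContinuousOn N (Ici 0) := aux_cont hcont0 hb0
  have cN1 : ContinuousOn N1 (Ici 0) :=
    aux_cont (f := fun v g => deriv (fun g' => p v g') g) hcont1 hb1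
  have dN : ∀ g > 0, HasDerivAt N (N1 g) g := fun g hg =>
    aux_deriv (f := p) (f' := fun v g => deriv (fun g' => p v g') g) hcont0 hcont1 hb0 hb1 hd1 hg
  have dN1 : ∀ g > 0, HasDerivAt N1 (N2 g) g := fun g hg =>
    aux_deriv (f := fun v g => deriv (fun g' => p v g') g)
      (f' := fun v g => deriv (deriv (fun g' => p v g')) g) hcont1 hcont2 hb1 hb2 hd2 hg
  -- the integrated equation
  have key : ∀ g > 0, - N g + (gin - g) * N1 g - a * N2 g = 0 := by
    intro g hg
    have i0 := aux_int hcont0 hb0 hg.le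
    have i1 := aux_int (f := fun v g => deriv (fun g' => p v g') g) hcont1 hb1 hg.le
    have i2 := aux_int (f := fun v g => deriv (deriv (fun g' => p v g')) g) hcont2 hb2 hg.le
    have hD : ∀ v ∈ Ioo 0 VF, HasDerivAt (fun v' => Jflux VE gL v' g * p v' g)
        ((1 / σE) * p v g + (-((gin - g) / σE)) * deriv (fun g' => p v g') g
          + (a / σE) * deriv (deriv (fun g' => p v g')) g) v := by
      intro v hv
      have h1 : DifferentiableAt ℝ (fun v' => Jflux VE gL v' g * p v' g) v := by
        refine DifferentiableAt.mul ?_ (hp.diff_v v hv g hg)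
        unfold Jflux
        fun_prop
      have h2 : deriv (fun g' => ((gin - g') / σE) * p v g') g
          = (-1 / σE) * p v g + ((gin - g) / σE) * deriv (fun g' => p v g') g :=
        (HasDerivAt.mul (((hasDerivAt_id' g).const_sub gin).div_const σE) (hd1 v hv g hg)).deriv
      have h3 := hp.pde v hv g hg
      rw [h2] at h3
      refine h1.hasDerivAt.congr_deriv ?_
      linear_combination h3
    have j0 := i0.const_mul (1 / σE)
    have j1 := i1.const_mul (-((gin - g) / σE))
    have j2 := i2.const_mul (a / σE)
    have hc : ContinuousOn (fun v' => Jflux VE gL v' g * p v' g) (Icc 0 VF) := by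
      refine ContinuousOn.mul ?_ (hp.cont_v g hg.le)
      unfold Jflux
      fun_prop
    have hI := intervalIntegral.integral_eq_sub_of_hasDerivAt_of_le hVF.le hc hD
      ((intervalIntegrable_iff_integrableOn_Ioo_of_le hVF.le).2 ((j0.add j1).add j2))
    have hbc : Jflux VE gL VF g * p VF g - Jflux VE gL 0 g * p 0 g = 0 := by
      rcases lt_or_ge g (gL * VF / (VE - VF)) with h | h
      · have := hp.bc_v_low g ⟨hg, h⟩
        linarith [this.1, this.2]
      · linarith [hp.bc_v_high g h]
    rw [hbc, intervalIntegral.integral_of_le hVF.le, integral_Ioc_eq_integral_Ioo,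
      integral_add (f := fun t => 1 / σE * p t g
        + -((gin - g) / σE) * deriv (fun g' => p t g') g) (j0.add j1) j2, integral_add j0 j1, integral_const_mul, integral_const_mul,
      integral_const_mul] at hI
    change 1 / σE * N g + -((gin - g) / σE) * N1 g + a / σE * N2 g = 0 at hI
    field_simp at hI
    linarith
  have hF : ∀ g, 0 ≤ g → (gin - g) * N g - a * N1 g = 0 := by
    intro g hg
    have h := aux_const (F := fun g => (gin - g) * N g - a * N1 g)
      (((by fun_prop : ContinuousOn (fun g : ℝ => gin - g) (Ici 0)).mul cN).sub (cN1.const_mul a))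
      (fun x hx => by
        have h := (((hasDerivAt_id' x).const_sub gin).mul (dN x hx)).sub ((dN1 x hx).const_mul a)
        refine h.congr_deriv ?_
        linear_combination key x hx) hg
    have h0 : (gin - 0) * N 0 - a * N1 0 = 0 := by
      have i0 := (aux_int hcont0 hb0 le_rfl).const_mul (0 - gin)
      have i1 := (aux_int (f := fun v g => deriv (fun g' => p v g') g) hcont1 hb1
        le_rfl).const_mul a
      have : ∫ v in Ioo 0 VF, ((0 - gin) * p v 0 + a * deriv (fun g' => p v g') 0) = 0 := by
        rw [setIntegral_congr_fun measurableSet_Ioo (g := fun _ => (0:ℝ)) hp.bc_g]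
        simp
      rw [integral_add i0 i1, integral_const_mul, integral_const_mul] at this
      change (0 - gin) * N 0 + a * N1 0 = 0 at this
      linarith
    exact h.trans h0
  -- solve the first-order equation
  have hE : ∀ g : ℝ, HasDerivAt (fun g : ℝ => Real.exp ((g - gin) ^ 2 / (2 * a)))
      (Real.exp ((g - gin) ^ 2 / (2 * a)) * ((g - gin) / a)) g := by
    intro g
    have := ((((hasDerivAt_id' g).sub_const gin).pow 2).div_const (2 * a)).exp
    refine this.congr_deriv ?_
    simp only [Pi.pow_apply]
    field_simp
    norm_num
    ring
  obtain ⟨c, hcM⟩ : ∃ c, ∀ g, 0 ≤ g → N g = c * Mw gin a g := by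
    refine ⟨N 0 * Real.exp ((0 - gin) ^ 2 / (2 * a)), fun g hg => ?_⟩
    have h := aux_const (F := fun g => N g * Real.exp ((g - gin) ^ 2 / (2 * a)))
      (cN.mul (by fun_prop))
      (fun x hx => by
        have h := (dN x hx).mul (hE x)
        refine h.congr_deriv ?_
        have h' := hF x hx.le
        have : N1 x = (gin - x) / a * N x := by
          field_simp
          linarith
        rw [this]
        ring) hg
    change N g * Real.exp ((g - gin) ^ 2 / (2 * a)) = N 0 * Real.exp ((0 - gin) ^ 2 / (2 * a)) at h
    rw [← h, Mw, mul_assoc, ← Real.exp_add, neg_div, add_neg_cancel, Real.exp_zero, mul_one]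
  -- normalization
  have hint : Integrable (fun x : ℝ × ℝ => p x.1 x.2)
      ((volume.restrict (Ioo 0 VF)).prod (volume.restrict (Ioi (0:ℝ)))) := by
    obtain ⟨G0, hG0⟩ := hp.decay 1 one_pos
    set G := max G0 1 with hG
    have hG1 : 1 ≤ G := le_max_right _ _
    obtain ⟨C, hC⟩ := hb0 G (by linarith)
    have hbd : Integrable (fun g : ℝ => (Ioc 0 G).indicator (fun _ => C) g
        + (Ioi G).indicator (fun g => g ^ (-2:ℝ)) g) (volume.restrict (Ioi (0:ℝ))) := by
      refine Integrable.add ?_ ?_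
      · refine Integrable.mono_measure ?_ Measure.restrict_le_self
        exact (integrable_indicator_iff measurableSet_Ioc).2 (integrableOn_const (by simp))
      · refine Integrable.mono_measure ?_ Measure.restrict_le_self
        exact (integrable_indicator_iff measurableSet_Ioi).2
          (integrableOn_Ioi_rpow_of_lt (by norm_num) (by linarith))
    have hone : Integrable (fun _ : ℝ => (1:ℝ)) (volume.restrict (Ioo 0 VF)) :=
      integrableOn_const (by simp)
    refine (hone.mul_prod hbd).mono' ?_ ?_
    · rw [Measure.prod_restrict]
      exact (hcont0.mono (prod_mono_right Ioi_subset_Ici_self)).aestronglyMeasurable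
        (measurableSet_Ioo.prod measurableSet_Ioi)
    · rw [Measure.prod_restrict]
      filter_upwards [ae_restrict_mem (measurableSet_Ioo.prod measurableSet_Ioi)] with x hx
      obtain ⟨hx1, hx2⟩ := hx
      have hx2' : 0 < x.2 := hx2
      rw [Real.norm_eq_abs, one_mul]
      rcases le_or_gt x.2 G with h | h
      · rw [indicator_of_mem (show x.2 ∈ Ioc 0 G from ⟨hx2', h⟩),
          indicator_of_notMem (by simp [h]), add_zero]
        exact hC _ hx1 _ ⟨hx2'.le, h⟩
      · rw [indicator_of_notMem (by simp [h]), indicator_of_mem (show x.2 ∈ Ioi G from h),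
          zero_add, abs_of_nonneg (hp.nonneg _ hx1 _ hx2'.le), Real.rpow_neg hx2'.le]
        have := (hG0 x.2 ((le_max_left _ _).trans h.le) x.1 hx1).2.1
        rw [← one_div, le_div_iff₀ (by positivity), mul_comm]
        exact_mod_cast this.le
  have hnorm : ∫ g in Ioi (0:ℝ), N g = 1 := by
    rw [← hp.normalized]
    exact (integral_integral_swap hint).symm
  have hcZ : c * ∫ g in Ioi (0:ℝ), Mw gin a g = 1 := by
    rw [← hnorm, ← integral_const_mul]
    exact setIntegral_congr_fun measurableSet_Ioi (fun g hg => (hcM g (le_of_lt hg)).symm)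
  intro g hg
  have hZ : (∫ g in Ioi (0:ℝ), Mw gin a g) ≠ 0 := by
    intro h
    rw [h] at hcZ
    simp at hcZ
  change N g = _
  rw [hcM g hg, eq_div_iff hZ]
  linear_combination Mw gin a g * hcZ
end
end

section
/- Let p : (0,V_F)×(0,∞) → [0,∞) be measurable and suppose that A := ∫_0^{V_F} esssup_{g>0} p(v,g) dv < ∞, B := ∫_0^{V_F}∫_0^∞ J(v,g)²·p(v,g)² dg dv < ∞, and D := ∫_0^{V_F}∫_0^∞ (g + g_L)²·p(v,g) dg dv < ∞. Then for every q with 1 ≤ q < 4/3, ∫_0^{V_F}∫_0^∞ (g + g_L)²·p(v,g)^q dg dv < ∞. -/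
open Real MeasureTheory Set Filter

noncomputable section

theorem aux_pw (p j q : ℝ) (hp : 0 ≤ p) (hj : 0 < j) (h1 : 1 ≤ q) (h2 : q < 4/3) :
    p ^ q ≤ j ^ 2 * p ^ 2 + p * j ^ (-(2 * (q - 1) / (2 - q))) := by
  rcases hp.eq_or_lt with rfl | hp
  · rw [Real.zero_rpow (by linarith)]; positivity
  have hq : 0 < 2 - q := by linarith
  by_cases h : p ^ (q - 2) ≤ j ^ 2
  · have e : p ^ q = p ^ (q - 2) * p ^ 2 := by
      rw [← Real.rpow_natCast p 2, ← Real.rpow_add hp]; congr 1; push_cast; ring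
    have : p ^ (q - 2) * p ^ 2 ≤ j ^ 2 * p ^ 2 := by gcongr
    have h3 : 0 ≤ p * j ^ (-(2 * (q - 1) / (2 - q))) := by positivity
    linarith
  · push Not at h
    have h3 := Real.rpow_le_rpow_of_nonpos (z := -((q - 1) / (2 - q))) (by positivity : 0 < j ^ 2)
      h.le (by
        have : 0 ≤ (q - 1) / (2 - q) := div_nonneg (by linarith) hq.le
        linarith)
    rw [← Real.rpow_mul hp.le, ← Real.rpow_natCast j 2, ← Real.rpow_mul hj.le] at h3
    have e1 : (q - 2) * -((q - 1) / (2 - q)) = q - 1 := by field_simp; ring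
    have e2 : ((2 : ℕ) : ℝ) * -((q - 1) / (2 - q)) = -(2 * (q - 1) / (2 - q)) := by
      push_cast; ring
    rw [e1, e2] at h3
    have e : p ^ q = p * p ^ (q - 1) := by
      nth_rewrite 2 [← Real.rpow_one p]
      rw [← Real.rpow_add hp]; congr 1; ring
    have h4 : p * p ^ (q - 1) ≤ p * j ^ (-(2 * (q - 1) / (2 - q))) := by gcongr
    have : 0 ≤ j ^ 2 * p ^ 2 := by positivity
    linarith

theorem aux_far (p q : ℝ) (hp : 0 ≤ p) (h1 : 1 ≤ q) (h2 : q < 4/3) : p ^ q ≤ p + p ^ 2 := by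
  rcases hp.eq_or_lt with rfl | hp
  · rw [Real.zero_rpow (by linarith)]; norm_num
  rcases le_total p 1 with h | h
  · have := Real.rpow_le_rpow_of_exponent_ge hp h h1
    rw [Real.rpow_one] at this
    nlinarith
  · have := Real.rpow_le_rpow_of_exponent_le h (by push_cast; linarith : q ≤ ((2 : ℕ) : ℝ))
    rw [Real.rpow_natCast] at this
    linarith

/-- truncated singular kernel -/
def ker0 (M s : ℝ) (u : ℝ) : ENNReal := (Ioc 0 M).indicator (fun u => ENNReal.ofReal (u ^ (-s))) u

theorem ker0_meas (M s : ℝ) : Measurable (ker0 M s) := by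
  unfold ker0
  exact Measurable.indicator (by fun_prop) measurableSet_Ioc

theorem ker0_fin (M s : ℝ) (hs : s < 1) : ∫⁻ u, ker0 M s u < ⊤ := by
  unfold ker0
  rw [lintegral_indicator measurableSet_Ioc]
  have h := (intervalIntegral.intervalIntegrable_rpow' (a := 0) (b := M) (r := -s)
    (by linarith)).1
  exact h.lintegral_lt_top

theorem aux_real (VF VE gL : ℝ) (hVE : VF < VE) (hgL : 0 < gL)
    (v g p q : ℝ) (hv : v ∈ Ioo 0 VF) (hg : 0 < g) (hp : 0 ≤ p) (h1 : 1 ≤ q) (h2 : q < 4/3)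
    (hne : g ≠ gL * v / (VE - v)) :
    ENNReal.ofReal ((g + gL) ^ 2 * p ^ q) ≤ ENNReal.ofReal ((g + gL) ^ 2 * p) +
      ENNReal.ofReal (4 / (VE - VF) ^ 2 + (2 * gL * VF / (VE - VF) + gL + gL) ^ 2) *
        ENNReal.ofReal ((Jflux VE gL v g) ^ 2 * p ^ 2) +
      ENNReal.ofReal p * (ENNReal.ofReal ((2 * gL * VF / (VE - VF) + gL + gL) ^ 2 *
          (VE - VF) ^ (-(2 * (q - 1) / (2 - q)))) *
        (ker0 (2 * gL * VF / (VE - VF) + gL) (2 * (q - 1) / (2 - q)) (g - gL * v / (VE - v)) +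
         ker0 (2 * gL * VF / (VE - VF) + gL) (2 * (q - 1) / (2 - q)) (gL * v / (VE - v) - g))) := by
  obtain ⟨hv0, hv1⟩ := hv
  have hVF : 0 < VF := hv0.trans hv1
  set d := VE - VF with hd
  have hd0 : 0 < d := by linarith
  have hdv : d ≤ VE - v := by linarith
  have hdv0 : 0 < VE - v := by linarith
  set s := 2 * (q - 1) / (2 - q) with hs
  set M := 2 * gL * VF / d + gL with hM
  have hM0 : 0 < M := by positivity
  set a := gL * v / (VE - v) with ha
  have ha0 : 0 < a := by positivity
  have haG : a ≤ gL * VF / d := by rw [ha]; gcongr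
  have hGM : M = 2 * (gL * VF / d) + gL := by rw [hM]; ring
  have hG0 : 0 < gL * VF / d := by positivity
  have haM : a ≤ M := by linarith
  have hJ : Jflux VE gL v g = (VE - v) * (g - a) := by
    unfold Jflux; rw [ha]; field_simp; ring
  have hJ2 : d ^ 2 * (g - a) ^ 2 ≤ (Jflux VE gL v g) ^ 2 := by
    rw [hJ, mul_pow]; gcongr
  have hJp : 0 ≤ (Jflux VE gL v g) ^ 2 * p ^ 2 := by positivity
  rcases le_or_gt g M with hgM | hgM
  · -- near
    have key : ∀ u : ℝ, 0 < u → u ≤ M → u ^ 2 = (g - a) ^ 2 →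
        ENNReal.ofReal ((g + gL) ^ 2 * p ^ q) ≤
        ENNReal.ofReal (4 / d ^ 2 + (M + gL) ^ 2) *
          ENNReal.ofReal ((Jflux VE gL v g) ^ 2 * p ^ 2) +
        ENNReal.ofReal p * (ENNReal.ofReal ((M + gL) ^ 2 * d ^ (-s)) * ker0 M s u) := by
      intro u hu huM hu2
      have hk : ker0 M s u = ENNReal.ofReal (u ^ (-s)) := by
        unfold ker0; rw [Set.indicator_of_mem (show u ∈ Ioc 0 M from ⟨hu, huM⟩)]
      rw [hk, ← ENNReal.ofReal_mul (by positivity), ← ENNReal.ofReal_mul (by positivity),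
        ← ENNReal.ofReal_mul (by positivity), ← ENNReal.ofReal_add (by positivity) (by positivity)]
      apply ENNReal.ofReal_le_ofReal
      have h3 := aux_pw p (d * u) q hp (by positivity) h1 h2
      rw [← hs, Real.mul_rpow hd0.le hu.le, mul_pow, hu2] at h3
      have h4 : d ^ 2 * (g - a) ^ 2 * p ^ 2 ≤ (Jflux VE gL v g) ^ 2 * p ^ 2 := by gcongr
      have h5 : (g + gL) ^ 2 * p ^ q ≤ (M + gL) ^ 2 * p ^ q := by gcongr
      have h6 : (M + gL) ^ 2 * p ^ q ≤ (M + gL) ^ 2 * ((Jflux VE gL v g) ^ 2 * p ^ 2 +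
        p * (d ^ (-s) * u ^ (-s))) := by gcongr; linarith
      have h7 : 0 ≤ 4 / d ^ 2 * ((Jflux VE gL v g) ^ 2 * p ^ 2) := by positivity
      linarith
    rcases lt_or_gt_of_ne hne with h | h
    · refine (key (a - g) (by linarith) (by linarith) (by ring)).trans ?_
      gcongr
      · exact le_add_self
      · exact le_add_self
    · refine (key (g - a) (by linarith) (by linarith) (by ring)).trans ?_
      gcongr
      · exact le_add_self
      · exact le_self_add
  · -- far
    refine le_trans ?_ le_self_add
    rw [← ENNReal.ofReal_mul (by positivity), ← ENNReal.ofReal_add (by positivity) (by positivity)]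
    apply ENNReal.ofReal_le_ofReal
    have h3 := aux_far p q hp h1 h2
    have h4 : (g + gL) / 2 ≤ g - a := by linarith
    have h5 : (g + gL) ^ 2 ≤ 4 / d ^ 2 * (Jflux VE gL v g) ^ 2 := by
      have h6 : ((g + gL) / 2) ^ 2 ≤ (g - a) ^ 2 := by gcongr
      have h7 : 4 / d ^ 2 * (d ^ 2 * (g - a) ^ 2) ≤ 4 / d ^ 2 * (Jflux VE gL v g) ^ 2 := by gcongr
      have h8 : 4 / d ^ 2 * (d ^ 2 * (g - a) ^ 2) = 4 * (g - a) ^ 2 := by field_simp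
      linarith
    have h9 : (g + gL) ^ 2 * p ^ q ≤ (g + gL) ^ 2 * (p + p ^ 2) := by gcongr
    have h10 : (g + gL) ^ 2 * p ^ 2 ≤ 4 / d ^ 2 * (Jflux VE gL v g) ^ 2 * p ^ 2 := by gcongr
    have h11 : 0 ≤ (M + gL) ^ 2 * ((Jflux VE gL v g) ^ 2 * p ^ 2) := by positivity
    linarith

/-- weighted `L^q` integrability for all `1 ≤ q < 4/3`. -/
theorem stmt7 (VF VE gL : ℝ) (hVF : 0 < VF) (hVE : VF < VE) (hgL : 0 < gL)
    (p : ℝ → ℝ → ℝ)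
    (hmeas : Measurable (fun x : ℝ × ℝ => p x.1 x.2))
    (hnonneg : ∀ v ∈ Ioo 0 VF, ∀ g ∈ Ioi (0:ℝ), 0 ≤ p v g)
    (hA : ∫⁻ v in Ioo (0:ℝ) VF,
        essSup (fun g => ENNReal.ofReal (p v g)) (volume.restrict (Ioi 0)) < ⊤)
    (hB : ∫⁻ x in (Ioo (0:ℝ) VF) ×ˢ (Ioi (0:ℝ)),
        ENNReal.ofReal ((Jflux VE gL x.1 x.2) ^ 2 * (p x.1 x.2) ^ 2) < ⊤)
    (hD : ∫⁻ x in (Ioo (0:ℝ) VF) ×ˢ (Ioi (0:ℝ)),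
        ENNReal.ofReal ((x.2 + gL) ^ 2 * p x.1 x.2) < ⊤) :
    ∀ q : ℝ, 1 ≤ q → q < 4 / 3 →
      ∫⁻ x in (Ioo (0:ℝ) VF) ×ˢ (Ioi (0:ℝ)),
        ENNReal.ofReal ((x.2 + gL) ^ 2 * (p x.1 x.2) ^ q) < ⊤ := by
  intro q h1 h2
  have hs : 2 * (q - 1) / (2 - q) < 1 := by
    rw [div_lt_one (by linarith)]; linarith
  have hker := ker0_fin (2 * gL * VF / (VE - VF) + gL) _ hs
  have hpw := fun v g p hv hg hp hne =>
    aux_real VF VE gL hVE hgL v g p q hv hg hp h1 h2 hne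
  generalize hI : ∫⁻ u, ker0 (2 * gL * VF / (VE - VF) + gL) (2 * (q - 1) / (2 - q)) u = I at hker
  have hkm := ker0_meas (2 * gL * VF / (VE - VF) + gL) (2 * (q - 1) / (2 - q))
  generalize ker0 (2 * gL * VF / (VE - VF) + gL) (2 * (q - 1) / (2 - q)) = k at *
  generalize hK' : ENNReal.ofReal ((2 * gL * VF / (VE - VF) + gL + gL) ^ 2 *
          (VE - VF) ^ (-(2 * (q - 1) / (2 - q)))) = K' at *
  have hK't : K' ≠ ⊤ := by rw [← hK']; exact ENNReal.ofReal_ne_top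
  generalize hK : ENNReal.ofReal
    (4 / (VE - VF) ^ 2 + (2 * gL * VF / (VE - VF) + gL + gL) ^ 2) = K at *
  have hKt : K ≠ ⊤ := by rw [← hK]; exact ENNReal.ofReal_ne_top
  have hJm : Measurable (fun x : ℝ × ℝ =>
      ENNReal.ofReal ((Jflux VE gL x.1 x.2) ^ 2 * (p x.1 x.2) ^ 2)) := by
    unfold Jflux; fun_prop
  have hDm : Measurable (fun x : ℝ × ℝ => ENNReal.ofReal ((x.2 + gL) ^ 2 * p x.1 x.2)) := by
    fun_prop
  have hqm : Measurable (fun x : ℝ × ℝ => ENNReal.ofReal ((x.2 + gL) ^ 2 * (p x.1 x.2) ^ q)) := by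
    fun_prop
  rw [Measure.volume_eq_prod, ← Measure.prod_restrict] at hB hD ⊢
  rw [lintegral_prod _ hJm.aemeasurable] at hB
  rw [lintegral_prod _ hDm.aemeasurable] at hD
  rw [lintegral_prod _ hqm.aemeasurable]
  have hinner : ∀ v ∈ Ioo 0 VF,
      ∫⁻ g in Ioi (0:ℝ), ENNReal.ofReal ((g + gL) ^ 2 * (p v g) ^ q) ≤
      (∫⁻ g in Ioi (0:ℝ), ENNReal.ofReal ((g + gL) ^ 2 * p v g)) +
      K * (∫⁻ g in Ioi (0:ℝ), ENNReal.ofReal ((Jflux VE gL v g) ^ 2 * (p v g) ^ 2)) +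
      essSup (fun g => ENNReal.ofReal (p v g)) (volume.restrict (Ioi 0)) * (K' * (I + I)) := by
    intro v hv
    have hpv : Measurable (fun g => p v g) := hmeas.comp (measurable_prodMk_left (x := v))
    have hm1 : Measurable (fun g => ENNReal.ofReal ((g + gL) ^ 2 * p v g)) := by fun_prop
    have hm2 : Measurable (fun g => ENNReal.ofReal ((Jflux VE gL v g) ^ 2 * (p v g) ^ 2)) := by
      unfold Jflux; fun_prop
    have hae : ∀ᵐ g ∂(volume.restrict (Ioi (0:ℝ))),
        ENNReal.ofReal ((g + gL) ^ 2 * (p v g) ^ q) ≤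
        ENNReal.ofReal ((g + gL) ^ 2 * p v g) +
        K * ENNReal.ofReal ((Jflux VE gL v g) ^ 2 * (p v g) ^ 2) +
        essSup (fun g => ENNReal.ofReal (p v g)) (volume.restrict (Ioi 0)) *
          (K' * (k (g - gL * v / (VE - v)) + k (gL * v / (VE - v) - g))) := by
      have hne : ∀ᵐ g ∂(volume.restrict (Ioi (0:ℝ))), g ≠ gL * v / (VE - v) :=
        ae_restrict_of_ae (Measure.ae_ne volume _)
      filter_upwards [hne, ae_restrict_mem measurableSet_Ioi,
        ENNReal.ae_le_essSup (μ := volume.restrict (Ioi (0:ℝ)))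
          (fun g => ENNReal.ofReal (p v g))] with g hg1 hg2 hg3
      refine (hpw v g (p v g) hv hg2 (hnonneg v hv g hg2) hg1).trans ?_
      exact add_le_add le_rfl (mul_le_mul' hg3 le_rfl)
    refine (lintegral_mono_ae hae).trans ?_
    rw [lintegral_add_left (by fun_prop), lintegral_add_left hm1, lintegral_const_mul _ hm2,
      lintegral_const_mul _ (by fun_prop), lintegral_const_mul _ (by fun_prop),
      lintegral_add_left (by fun_prop)]
    gcongr
    · refine (setLIntegral_le_lintegral _ _).trans ?_
      rw [lintegral_sub_right_eq_self k, hI]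
    · refine (setLIntegral_le_lintegral _ _).trans ?_
      rw [lintegral_sub_left_eq_self k, hI]
  refine (setLIntegral_mono' measurableSet_Ioo hinner).trans_lt ?_
  have hC : K' * (I + I) ≠ ⊤ := ENNReal.mul_ne_top hK't (by simp [hker.ne])
  have hm1 := hDm.lintegral_prod_right' (ν := volume.restrict (Ioi (0:ℝ)))
  have hm2 := hJm.lintegral_prod_right' (ν := volume.restrict (Ioi (0:ℝ)))
  dsimp only at hm1 hm2 hB hD
  rw [lintegral_add_left (by fun_prop), lintegral_add_left hm1,
    lintegral_const_mul' _ _ hKt, lintegral_mul_const' _ _ hC]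
  exact ENNReal.add_lt_top.2 ⟨ENNReal.add_lt_top.2 ⟨hD, ENNReal.mul_lt_top hKt.lt_top hB⟩,
    ENNReal.mul_lt_top hA hC.lt_top⟩
end
end
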